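/- arXiv:1406.1723 — 13 statements merged into one kernel-verified Lean document; each statement's English description precedes it below -/
import Mathlib

section
/- Suppose the embedding D(A) ∩ closure(R(A*)) ↪ X is compact. Then there exists a constant c_A > 0 such that ‖x‖_X ≤ c_A ‖A x‖_Y for every x ∈ D(A) ∩ closure(R(A*)). -/
open scoped InnerProductSpace

/-- The range of a partially defined linear map, as a submodule of the codomain. -/
def LinearPMap.pmRange {R E F : Type*} [Ring R] [AddCommGroup E] [Module R E]
    [AddCommGroup F] [Module R F] (T : E →ₗ.[R] F) : Submodule R F :=
  LinearMap.range T.toFun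

/-- A limit of vectors in `D(A)` whose images under `A` tend to zero is orthogonal to the closure of
the range of the adjoint. -/
theorem inner_eq_zero_of_tendsto_of_mem_closure_pmRange_adjoint
    {X Y ι : Type*} [NormedAddCommGroup X] [InnerProductSpace ℝ X] [CompleteSpace X]
    [NormedAddCommGroup Y] [InnerProductSpace ℝ Y]
    {A : X →ₗ.[ℝ] Y} (hdense : Dense (A.domain : Set X)) {l : Filter ι} [l.NeBot]
    {v : ι → A.domain} {x : X} (hv : Filter.Tendsto (fun n => (v n : X)) l (nhds x))
    (hAv : Filter.Tendsto (fun n => A (v n)) l (nhds 0))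
    {w : X} (hw : w ∈ closure (A.adjoint.pmRange : Set X)) : ⟪w, x⟫_ℝ = 0 := by
  have hclosed : IsClosed {w : X | ⟪w, x⟫_ℝ = 0} :=
    isClosed_eq (by fun_prop) continuous_const
  refine closure_minimal ?_ hclosed hw
  rintro _ ⟨y, rfl⟩
  have h₁ : Filter.Tendsto (fun n => ⟪A.adjoint y, (v n : X)⟫_ℝ) l (nhds ⟪A.adjoint y, x⟫_ℝ) :=
    tendsto_const_nhds.inner hv
  have h₂ : Filter.Tendsto (fun n => ⟪(y : Y), A (v n)⟫_ℝ) l (nhds ⟪(y : Y), (0 : Y)⟫_ℝ) :=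
    tendsto_const_nhds.inner hAv
  rw [inner_zero_right] at h₂
  refine tendsto_nhds_unique h₁ (h₂.congr fun n => ?_)
  exact (LinearPMap.adjoint_isFormalAdjoint hdense y (v n)).symm

/-- If `A` is a closed, densely defined operator between Hilbert spaces and the
embedding `D(A) ∩ closure (R(A*)) ↪ X` is compact (every sequence therein which is bounded in the
graph norm of `A` has a subsequence converging in `X`), then there is a constant `c > 0` with
`‖x‖ ≤ c * ‖A x‖` for all `x ∈ D(A) ∩ closure (R(A*))`. -/
theorem stmt0
    {X Y : Type*} [NormedAddCommGroup X] [InnerProductSpace ℝ X] [CompleteSpace X]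
    [NormedAddCommGroup Y] [InnerProductSpace ℝ Y] [CompleteSpace Y]
    (A : X →ₗ.[ℝ] Y) (hdense : Dense (A.domain : Set X)) (hclosed : A.IsClosed)
    (hcomp : ∀ u : ℕ → A.domain,
      (∀ n, (u n : X) ∈ closure (A.adjoint.pmRange : Set X)) →
      (∃ C : ℝ, ∀ n, ‖(u n : X)‖ ^ 2 + ‖A (u n)‖ ^ 2 ≤ C) →
      ∃ (x : X) (φ : ℕ → ℕ), StrictMono φ ∧
        Filter.Tendsto (fun n => (u (φ n) : X)) Filter.atTop (nhds x)) :
    ∃ c : ℝ, 0 < c ∧ ∀ u : A.domain,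
      (u : X) ∈ closure (A.adjoint.pmRange : Set X) → ‖(u : X)‖ ≤ c * ‖A u‖ := by
  by_contra! h
  choose u hu hlt using fun n : ℕ => h ((n : ℝ) + 1) (by positivity)
  have hpos : ∀ n, 0 < ‖(u n : X)‖ := fun n => lt_of_le_of_lt (by positivity) (hlt n)
  let v : ℕ → A.domain := fun n => ‖(u n : X)‖⁻¹ • u n
  have hv_norm : ∀ n, ‖(v n : X)‖ = 1 := fun n => by
    simp [v, norm_smul, (hpos n).ne']
  have hAv_norm : ∀ n, ‖A (v n)‖ ≤ 1 / ((n : ℝ) + 1) := fun n => by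
    have hn : (0 : ℝ) < n + 1 := by positivity
    rw [LinearPMap.map_smul, norm_smul, norm_inv, norm_norm, inv_mul_eq_div,
      div_le_div_iff₀ (hpos n) hn]
    linarith [hlt n]
  have hv_mem : ∀ n, (v n : X) ∈ closure (A.adjoint.pmRange : Set X) := fun n =>
    A.adjoint.pmRange.topologicalClosure.smul_mem _ (hu n)
  have hAv : Filter.Tendsto (fun n => A (v n)) Filter.atTop (nhds 0) :=
    squeeze_zero_norm hAv_norm tendsto_one_div_add_atTop_nhds_zero_nat
  obtain ⟨x, φ, hφ, hx⟩ := hcomp v hv_mem ⟨2, fun n => by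
    have h₁ : 1 / ((n : ℝ) + 1) ≤ 1 := by
      rw [div_le_one (by positivity)]
      linarith [Nat.cast_nonneg (α := ℝ) n]
    have h₂ := pow_le_one₀ (n := 2) (norm_nonneg _) ((hAv_norm n).trans h₁)
    rw [hv_norm]
    linarith⟩
  have hx_mem : x ∈ closure (A.adjoint.pmRange : Set X) :=
    isClosed_closure.mem_of_tendsto hx (.of_forall fun n => hv_mem (φ n))
  have hx_zero : x = 0 := inner_self_eq_zero.mp <|
    inner_eq_zero_of_tendsto_of_mem_closure_pmRange_adjoint hdense hx
      (hAv.comp hφ.tendsto_atTop) hx_mem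
  have hx_norm : ‖x‖ = 1 := tendsto_nhds_unique hx.norm (by simp [hv_norm])
  simp [hx_zero] at hx_norm
end

section
/- Suppose the embedding D(A) ∩ closure(R(A*)) ↪ X is compact. Then there exists a constant c_{A*} > 0 such that ‖y‖_Y ≤ c_{A*} ‖A* y‖_X for every y ∈ D(A*) ∩ closure(R(A)). -/
open scoped InnerProductSpace

/-- The kernel of a partially defined linear map, as a submodule of the domain space. -/
def LinearPMap.pmKer {R E F : Type*} [Ring R] [AddCommGroup E] [Module R E]
    [AddCommGroup F] [Module R F] (T : E →ₗ.[R] F) : Submodule R E :=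
  (LinearMap.ker T.toFun).map T.domain.subtype

/-- A vector orthogonal to the range of the adjoint of a closed, densely defined operator lies in
the kernel of the operator. -/
theorem mem_graph_zero_of_inner_adjoint_eq_zero
    {X Y : Type*} [NormedAddCommGroup X] [InnerProductSpace ℝ X] [CompleteSpace X]
    [NormedAddCommGroup Y] [InnerProductSpace ℝ Y] [CompleteSpace Y]
    (A : X →ₗ.[ℝ] Y) (hdense : Dense (A.domain : Set X)) (hclosed : A.IsClosed) (q : X)
    (hq : ∀ y : A.adjoint.domain, ⟪q, A.adjoint y⟫_ℝ = 0) : (q, (0 : Y)) ∈ A.graph := by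
  let G : Submodule ℝ (WithLp 2 (X × Y)) :=
    A.graph.comap (WithLp.linearEquiv 2 ℝ (X × Y)).toLinearMap
  have hG : IsClosed (G : Set (WithLp 2 (X × Y))) :=
    IsClosed.preimage (WithLp.prodContinuousLinearEquiv 2 ℝ X Y).continuous hclosed
  have : CompleteSpace G := hG.completeSpace_coe
  obtain ⟨g, hg, w, hw, hgw⟩ := G.exists_add_mem_mem_orthogonal (WithLp.toLp 2 (q, (0 : Y)))
  have hg' : (g.fst, g.snd) ∈ A.graph := hg
  obtain ⟨a, ha, hAa⟩ := (LinearPMap.mem_graph_iff A).1 hg'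
  simp only at ha hAa
  have h₁ : q = g.fst + w.fst := congrArg (fun z => z.fst) hgw
  have h₂ : (0 : Y) = g.snd + w.snd := congrArg (fun z => z.snd) hgw
  have hw₂ : w.snd = -A a := by rw [hAa]; exact (neg_eq_of_add_eq_zero_right h₂.symm).symm
  have horth : ∀ x : A.domain, ⟪w.fst, x⟫_ℝ = ⟪A a, A x⟫_ℝ := by
    intro x
    have hx := (Submodule.mem_orthogonal' G w).1 hw (WithLp.toLp 2 ((x : X), A x)) (A.mem_graph x)
    rw [WithLp.prod_inner_apply] at hx
    change ⟪w.fst, (x : X)⟫_ℝ + ⟪w.snd, A x⟫_ℝ = 0 at hx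
    rw [hw₂, inner_neg_left] at hx
    linarith
  have hmem : A a ∈ A.adjoint.domain := A.mem_adjoint_domain_of_exists _ ⟨_, horth⟩
  have hadj : A.adjoint ⟨A a, hmem⟩ = w.fst := A.adjoint_apply_eq hdense _ horth
  have hqw := hq ⟨A a, hmem⟩
  rw [hadj, h₁, inner_add_left, real_inner_comm, ← ha, horth a, real_inner_self_eq_norm_sq,
    real_inner_self_eq_norm_sq] at hqw
  have hA0 : A a = 0 := by
    rw [← norm_eq_zero]; nlinarith [sq_nonneg ‖A a‖, sq_nonneg ‖w.fst‖]
  have hw0 : w.fst = 0 := by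
    rw [← norm_eq_zero]; nlinarith [sq_nonneg ‖A a‖, sq_nonneg ‖w.fst‖]
  have hqa : q = a := by rw [h₁, hw0, add_zero, ha]
  exact (LinearPMap.mem_graph_iff A).2 ⟨a, hqa.symm, hA0⟩

/-- A vector of the kernel of a densely defined operator is orthogonal to the closure of the range
of the adjoint. -/
theorem inner_eq_zero_of_mem_closure_adjoint_range
    {X Y : Type*} [NormedAddCommGroup X] [InnerProductSpace ℝ X] [CompleteSpace X]
    [NormedAddCommGroup Y] [InnerProductSpace ℝ Y]
    (A : X →ₗ.[ℝ] Y) (hdense : Dense (A.domain : Set X)) (k : A.domain) (hk : A k = 0) (z : X)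
    (hz : z ∈ closure (A.adjoint.pmRange : Set X)) : ⟪z, k⟫_ℝ = 0 := by
  have hcl : IsClosed {z : X | ⟪z, k⟫_ℝ = 0} := isClosed_eq (by fun_prop) continuous_const
  refine closure_minimal ?_ hcl hz
  rintro _ ⟨y, rfl⟩
  have h := A.adjoint_isFormalAdjoint hdense y k
  rw [hk, inner_zero_right] at h
  exact h

/-- The Friedrichs–Poincaré estimate for a closed, densely defined operator whose reduced domain
embeds compactly. -/
theorem exists_norm_le_of_compact_embedding
    {X Y : Type*} [NormedAddCommGroup X] [InnerProductSpace ℝ X] [CompleteSpace X]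
    [NormedAddCommGroup Y] [InnerProductSpace ℝ Y]
    (A : X →ₗ.[ℝ] Y) (hdense : Dense (A.domain : Set X)) (hclosed : A.IsClosed)
    (hcomp : ∀ u : ℕ → A.domain,
      (∀ n, (u n : X) ∈ closure (A.adjoint.pmRange : Set X)) →
      (∃ C : ℝ, ∀ n, ‖(u n : X)‖ ^ 2 + ‖A (u n)‖ ^ 2 ≤ C) →
      ∃ (x : X) (φ : ℕ → ℕ), StrictMono φ ∧
        Filter.Tendsto (fun n => (u (φ n) : X)) Filter.atTop (nhds x)) :
    ∃ c : ℝ, 0 < c ∧ ∀ x : A.domain,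
      (x : X) ∈ closure (A.adjoint.pmRange : Set X) → ‖(x : X)‖ ≤ c * ‖A x‖ := by
  by_contra! hcon
  have hseq : ∀ n : ℕ, ∃ x : A.domain, (x : X) ∈ closure (A.adjoint.pmRange : Set X) ∧
      ‖(x : X)‖ = 1 ∧ ‖A x‖ ≤ 1 / ((n : ℝ) + 1) := by
    intro n
    have hn : (0 : ℝ) < n + 1 := by positivity
    obtain ⟨x, hx, hlt⟩ := hcon (n + 1) hn
    have hpos : 0 < ‖(x : X)‖ := lt_of_le_of_lt (by positivity) hlt
    refine ⟨‖(x : X)‖⁻¹ • x, ?_, ?_, ?_⟩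
    · have := A.adjoint.pmRange.topologicalClosure.smul_mem ‖(x : X)‖⁻¹ hx
      exact this
    · simp [norm_smul, hpos.ne']
    · rw [A.map_smul, norm_smul, norm_inv, norm_norm, inv_mul_eq_div, div_le_div_iff₀ hpos hn]
      linarith
  choose u hu hnorm hAu using hseq
  obtain ⟨x, φ, hφ, hx⟩ := hcomp u hu ⟨2, fun n => by
    have h1 : ‖A (u n)‖ ≤ 1 := (hAu n).trans (by
      rw [div_le_one (by positivity)]; linarith [Nat.cast_nonneg (α := ℝ) n])
    rw [hnorm]
    nlinarith [norm_nonneg (A (u n))]⟩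
  have hA0 : Filter.Tendsto (fun n => A (u (φ n))) Filter.atTop (nhds 0) :=
    (squeeze_zero_norm hAu tendsto_one_div_add_atTop_nhds_zero_nat).comp hφ.tendsto_atTop
  have hmem : (x, (0 : Y)) ∈ A.graph :=
    IsClosed.mem_of_tendsto hclosed (hx.prodMk_nhds hA0)
      (Filter.Eventually.of_forall fun n => A.mem_graph (u (φ n)))
  obtain ⟨k, hk, hAk⟩ := (LinearPMap.mem_graph_iff A).1 hmem
  simp only at hk hAk
  have hxcl : x ∈ closure (A.adjoint.pmRange : Set X) :=
    isClosed_closure.mem_of_tendsto hx (Filter.Eventually.of_forall fun n => hu (φ n))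
  have h0 := inner_eq_zero_of_mem_closure_adjoint_range A hdense k hAk x hxcl
  rw [hk, inner_self_eq_zero] at h0
  have h1 : ‖x‖ = 1 := tendsto_nhds_unique hx.norm (by simp [hnorm])
  simp [h0] at h1

/-- Under the compactness of the embedding `D(A) ∩ closure (R(A*)) ↪ X`,
there is a constant `c > 0` with `‖y‖ ≤ c * ‖A* y‖` for all `y ∈ D(A*) ∩ closure (R(A))`. -/
theorem stmt1
    {X Y : Type*} [NormedAddCommGroup X] [InnerProductSpace ℝ X] [CompleteSpace X]
    [NormedAddCommGroup Y] [InnerProductSpace ℝ Y] [CompleteSpace Y]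
    (A : X →ₗ.[ℝ] Y) (hdense : Dense (A.domain : Set X)) (hclosed : A.IsClosed)
    (hcomp : ∀ u : ℕ → A.domain,
      (∀ n, (u n : X) ∈ closure (A.adjoint.pmRange : Set X)) →
      (∃ C : ℝ, ∀ n, ‖(u n : X)‖ ^ 2 + ‖A (u n)‖ ^ 2 ≤ C) →
      ∃ (x : X) (φ : ℕ → ℕ), StrictMono φ ∧
        Filter.Tendsto (fun n => (u (φ n) : X)) Filter.atTop (nhds x)) :
    ∃ c : ℝ, 0 < c ∧ ∀ v : A.adjoint.domain,
      (v : Y) ∈ closure (A.pmRange : Set Y) → ‖(v : Y)‖ ≤ c * ‖A.adjoint v‖ := by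
  obtain ⟨c, hc, hbound⟩ := exists_norm_le_of_compact_embedding A hdense hclosed hcomp
  refine ⟨c, hc, fun v hv => ?_⟩
  have key : ∀ x : A.domain, ⟪(v : Y), A x⟫_ℝ ≤ c * ‖A.adjoint v‖ * ‖A x‖ := by
    intro x
    obtain ⟨p, hp, q, hq, hpq⟩ :=
      A.adjoint.pmRange.topologicalClosure.exists_add_mem_mem_orthogonal (x : X)
    have hker : (q, (0 : Y)) ∈ A.graph := by
      refine mem_graph_zero_of_inner_adjoint_eq_zero A hdense hclosed q fun y => ?_
      exact (Submodule.mem_orthogonal' _ q).1 hq _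
        (Submodule.le_topologicalClosure _ (LinearMap.mem_range_self _ y))
    obtain ⟨k, hk, hAk⟩ := (LinearPMap.mem_graph_iff A).1 hker
    simp only at hk hAk
    have hxk : ((x - k : A.domain) : X) = p := by
      rw [Submodule.coe_sub, hk, hpq, add_sub_cancel_right]
    have hAxk : A (x - k) = A x := by rw [A.map_sub, hAk, sub_zero]
    have hle := hbound (x - k) (by rw [hxk]; exact hp)
    rw [hAxk] at hle
    calc ⟪(v : Y), A x⟫_ℝ = ⟪A.adjoint v, ((x - k : A.domain) : X)⟫_ℝ := by
          rw [← hAxk]; exact (A.adjoint_isFormalAdjoint hdense v (x - k)).symm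
      _ ≤ ‖A.adjoint v‖ * ‖((x - k : A.domain) : X)‖ := real_inner_le_norm _ _
      _ ≤ ‖A.adjoint v‖ * (c * ‖A x‖) := by gcongr
      _ = c * ‖A.adjoint v‖ * ‖A x‖ := by ring
  have hcl : IsClosed {z : Y | ⟪(v : Y), z⟫_ℝ ≤ c * ‖A.adjoint v‖ * ‖z‖} :=
    isClosed_le (by fun_prop) (by fun_prop)
  have hvv : ⟪(v : Y), v⟫_ℝ ≤ c * ‖A.adjoint v‖ * ‖(v : Y)‖ := by
    refine closure_minimal ?_ hcl hv
    rintro _ ⟨x, rfl⟩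
    exact key x
  rw [real_inner_self_eq_norm_sq, sq] at hvv
  rcases (norm_nonneg (v : Y)).eq_or_lt with h | h
  · rw [← h]; positivity
  · exact le_of_mul_le_mul_right hvv h
end

section
/- Suppose the embedding D(A) ∩ closure(R(A*)) ↪ X is compact. Then the ranges R(A) ⊆ Y and R(A*) ⊆ X are closed subspaces. -/
open scoped InnerProductSpace

open Filter Topology

section ClosedRange

variable {X Y : Type*} [NormedAddCommGroup X] [InnerProductSpace ℝ X]
  [NormedAddCommGroup Y] [InnerProductSpace ℝ Y]

/-- A vector orthogonal to the range of the adjoint of a closed operator lies in the kernel of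
the operator. -/
lemma LinearPMap.exists_apply_eq_zero_of_inner_adjoint [CompleteSpace X]
    [CompleteSpace Y] {A : X →ₗ.[ℝ] Y}
    (hdense : Dense (A.domain : Set X)) (hclosed : A.IsClosed) {x : X}
    (hx : ∀ y : A.adjoint.domain, ⟪A.adjoint y, x⟫_ℝ = 0) :
    ∃ x' : A.domain, (x' : X) = x ∧ A x' = 0 := by
  let G : Submodule ℝ (WithLp 2 (X × Y)) :=
    A.graph.comap (WithLp.linearEquiv 2 ℝ (X × Y)).toLinearMap
  have hG : _root_.IsClosed (G : Set (WithLp 2 (X × Y))) :=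
    _root_.IsClosed.preimage (WithLp.prod_continuous_ofLp 2 X Y) hclosed
  have hmem : WithLp.toLp 2 (x, (0 : Y)) ∈ G := by
    rw [← hG.submodule_topologicalClosure_eq, ← Submodule.orthogonal_orthogonal_eq_closure,
      Submodule.mem_orthogonal]
    intro u hu
    have hu' : ∀ v : A.domain, ⟪-u.fst, (v : X)⟫_ℝ = ⟪u.snd, A v⟫_ℝ := by
      intro v
      have h := (Submodule.mem_orthogonal' _ _).1 hu (WithLp.toLp 2 ((v : X), A v))
        (A.mem_graph v)
      simp only [WithLp.prod_inner_apply] at h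
      rw [inner_neg_left]
      change ⟪u.fst, (v : X)⟫_ℝ + ⟪u.snd, A v⟫_ℝ = 0 at h
      linarith
    have hd := LinearPMap.mem_adjoint_domain_of_exists (T := A) u.snd ⟨_, hu'⟩
    have h := hx ⟨_, hd⟩
    rw [LinearPMap.adjoint_apply_eq hdense ⟨_, hd⟩ hu', inner_neg_left, neg_eq_zero] at h
    simpa [WithLp.prod_inner_apply] using h
  obtain ⟨x', h1, h2⟩ := (LinearPMap.mem_graph_iff A).1 hmem
  exact ⟨x', h1, h2⟩

/-- A limit of points of the domain whose images converge belongs to the domain of a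
closed operator, with the expected image. -/
lemma LinearPMap.IsClosed.exists_apply_eq_of_tendsto {A : X →ₗ.[ℝ] Y} (hclosed : A.IsClosed)
    {u : ℕ → A.domain} {x : X} {y : Y} (hu : Tendsto (fun n => (u n : X)) atTop (𝓝 x))
    (hAu : Tendsto (fun n => A (u n)) atTop (𝓝 y)) :
    ∃ x' : A.domain, (x' : X) = x ∧ A x' = y := by
  have h : (x, y) ∈ (A.graph : Set (X × Y)) :=
    _root_.IsClosed.mem_of_tendsto hclosed (hu.prodMk_nhds hAu)
      (Eventually.of_forall fun n => A.mem_graph (u n))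
  exact (LinearPMap.mem_graph_iff A).1 h

/-- Abstract Poincaré inequality: compactness of `D(A) ∩ closure (R(A*)) ↪ X` implies that `A` is
bounded below on `D(A) ∩ closure (R(A*))`. -/
lemma LinearPMap.exists_norm_le_mul_norm_apply [CompleteSpace X] {A : X →ₗ.[ℝ] Y}
    (hdense : Dense (A.domain : Set X)) (hclosed : A.IsClosed)
    (hcomp : ∀ u : ℕ → A.domain,
      (∀ n, (u n : X) ∈ _root_.closure (A.adjoint.pmRange : Set X)) →
      (∃ C : ℝ, ∀ n, ‖(u n : X)‖ ^ 2 + ‖A (u n)‖ ^ 2 ≤ C) →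
      ∃ (x : X) (φ : ℕ → ℕ), StrictMono φ ∧
        Tendsto (fun n => (u (φ n) : X)) atTop (𝓝 x)) :
    ∃ c : ℝ, 0 ≤ c ∧ ∀ x : A.domain, (x : X) ∈ A.adjoint.pmRange.topologicalClosure →
      ‖(x : X)‖ ≤ c * ‖A x‖ := by
  by_contra! hcon
  choose v hvM hv using fun n : ℕ => hcon ((n : ℝ) + 1) (by positivity)
  have hpos : ∀ n, 0 < ‖(v n : X)‖ := fun n => lt_of_le_of_lt (by positivity) (hv n)
  let u : ℕ → A.domain := fun n => ‖(v n : X)‖⁻¹ • v n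
  have hu1 : ∀ n, ‖(u n : X)‖ = 1 := fun n => by
    simp [u, norm_smul, (hpos n).ne']
  have huM : ∀ n, (u n : X) ∈ A.adjoint.pmRange.topologicalClosure := fun n =>
    Submodule.smul_mem _ _ (hvM n)
  have hAu : ∀ n, ‖A (u n)‖ ≤ 1 / ((n : ℝ) + 1) := fun n => by
    have h := (hv n).le
    have hn : (0 : ℝ) < n + 1 := by positivity
    simp only [u, LinearPMap.map_smul, norm_smul, norm_inv, norm_norm]
    rw [inv_mul_le_iff₀ (hpos n), mul_one_div, le_div_iff₀ hn]
    linarith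
  have hAu0 : Tendsto (fun n => A (u n)) atTop (𝓝 0) :=
    squeeze_zero_norm hAu tendsto_one_div_add_atTop_nhds_zero_nat
  obtain ⟨x, φ, hφ, hx⟩ := hcomp u huM ⟨2, fun n => by
    have h1 : ‖A (u n)‖ ≤ 1 := (hAu n).trans (by
      rw [div_le_one (by positivity)]
      linarith [(Nat.cast_nonneg n : (0 : ℝ) ≤ n)])
    rw [hu1]
    nlinarith [norm_nonneg (A (u n))]⟩
  obtain ⟨x', rfl, hx'⟩ := hclosed.exists_apply_eq_of_tendsto hx (hAu0.comp hφ.tendsto_atTop)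
  have hxM : (x' : X) ∈ A.adjoint.pmRange.topologicalClosure :=
    (Submodule.isClosed_topologicalClosure _).mem_of_tendsto hx
      (Eventually.of_forall fun n => huM (φ n))
  have hxO : (x' : X) ∈ A.adjoint.pmRange.topologicalClosureᗮ := by
    rw [Submodule.orthogonal_closure, Submodule.mem_orthogonal]
    rintro _ ⟨y, rfl⟩
    exact (LinearPMap.adjoint_isFormalAdjoint hdense y x').trans (by rw [hx', inner_zero_right])
  have h0 : (x' : X) = 0 := inner_self_eq_zero.1 ((Submodule.mem_orthogonal _ _).1 hxO _ hxM)
  have h1 : ‖(x' : X)‖ = 1 :=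
    tendsto_nhds_unique hx.norm (by simp [hu1])
  simp [h0] at h1

/-- Every point of the domain of a closed operator `A` agrees, modulo the kernel of `A`, with its
orthogonal projection to `closure (R(A*))`. -/
lemma LinearPMap.exists_mem_closure_adjoint_range [CompleteSpace X] [CompleteSpace Y]
    {A : X →ₗ.[ℝ] Y}
    (hdense : Dense (A.domain : Set X)) (hclosed : A.IsClosed) (x : A.domain) :
    ∃ x' : A.domain, (x' : X) ∈ A.adjoint.pmRange.topologicalClosure ∧ A x' = A x ∧
      ∀ z ∈ A.adjoint.pmRange.topologicalClosure, ⟪z, (x' : X)⟫_ℝ = ⟪z, (x : X)⟫_ℝ := by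
  set M := A.adjoint.pmRange.topologicalClosure
  have : CompleteSpace M := (Submodule.isClosed_topologicalClosure _).completeSpace_coe
  have hO : (x : X) - M.starProjection x ∈ Mᗮ := Submodule.sub_starProjection_mem_orthogonal _
  obtain ⟨k, hk, hAk⟩ := LinearPMap.exists_apply_eq_zero_of_inner_adjoint hdense hclosed
    (fun y => (Submodule.mem_orthogonal _ _).1 hO _
      (Submodule.le_topologicalClosure _ ⟨y, rfl⟩))
  refine ⟨x - k, ?_, by rw [LinearPMap.map_sub, hAk, sub_zero], fun z hz => ?_⟩
  · simp [hk]
  · have h := (Submodule.mem_orthogonal _ _).1 hO z hz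
    rw [← hk] at h
    rw [Submodule.coe_sub, inner_sub_right, h, sub_zero]

end ClosedRange

/-- Under the compactness of the embedding `D(A) ∩ closure (R(A*)) ↪ X`,
the ranges `R(A) ⊆ Y` and `R(A*) ⊆ X` are closed. -/
theorem stmt2
    {X Y : Type*} [NormedAddCommGroup X] [InnerProductSpace ℝ X] [CompleteSpace X]
    [NormedAddCommGroup Y] [InnerProductSpace ℝ Y] [CompleteSpace Y]
    (A : X →ₗ.[ℝ] Y) (hdense : Dense (A.domain : Set X)) (hclosed : A.IsClosed)
    (hcomp : ∀ u : ℕ → A.domain,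
      (∀ n, (u n : X) ∈ closure (A.adjoint.pmRange : Set X)) →
      (∃ C : ℝ, ∀ n, ‖(u n : X)‖ ^ 2 + ‖A (u n)‖ ^ 2 ≤ C) →
      ∃ (x : X) (φ : ℕ → ℕ), StrictMono φ ∧
        Filter.Tendsto (fun n => (u (φ n) : X)) Filter.atTop (nhds x)) :
    IsClosed (A.pmRange : Set Y) ∧ IsClosed (A.adjoint.pmRange : Set X) := by
  obtain ⟨c, hc0, hc⟩ := LinearPMap.exists_norm_le_mul_norm_apply hdense hclosed hcomp
  have hproj := LinearPMap.exists_mem_closure_adjoint_range hdense hclosed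
  constructor
  · refine IsSeqClosed.isClosed fun y y₀ hy hlim => ?_
    have hex : ∀ n, ∃ x : A.domain,
        (x : X) ∈ A.adjoint.pmRange.topologicalClosure ∧ A x = y n := fun n => by
      obtain ⟨x, hx⟩ := hy n
      obtain ⟨x', hx', hA, -⟩ := hproj x
      exact ⟨x', hx', hA.trans hx⟩
    choose x hxM hx using hex
    have hcau : CauchySeq fun n => (x n : X) := by
      have hyc := hlim.cauchySeq
      rw [Metric.cauchySeq_iff] at hyc ⊢
      intro ε hε
      obtain ⟨N, hN⟩ := hyc (ε / (c + 1)) (by positivity)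
      refine ⟨N, fun m hm n hn => ?_⟩
      have h1 := hN m hm n hn
      have h2 := hc (x m - x n) (Submodule.sub_mem _ (hxM m) (hxM n))
      rw [LinearPMap.map_sub, hx, hx, Submodule.coe_sub, ← dist_eq_norm, ← dist_eq_norm] at h2
      rw [lt_div_iff₀ (by positivity)] at h1
      nlinarith [dist_nonneg (x := y m) (y := y n)]
    obtain ⟨x₀, hx₀⟩ := cauchySeq_tendsto_of_complete hcau
    obtain ⟨x', -, h⟩ := hclosed.exists_apply_eq_of_tendsto hx₀ (by simpa only [hx] using hlim)
    exact ⟨x', h⟩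
  · refine isClosed_of_closure_subset fun z hz => ?_
    have hbound : ∀ x : A.domain, ‖⟪z, (x : X)⟫_ℝ‖ ≤ ‖z‖ * c * ‖A x‖ := fun x => by
      obtain ⟨x', hx', hA, hin⟩ := hproj x
      rw [← hin z hz, ← hA, mul_assoc]
      exact (norm_inner_le_norm _ _).trans
        (mul_le_mul_of_nonneg_left (hc x' hx') (norm_nonneg _))
    obtain ⟨g, hg⟩ := A.toFun.rangeRestrict.exists_rightInverse_of_surjective
      A.toFun.range_rangeRestrict
    have hAg : ∀ y, A (g y) = y := fun y => congrArg Subtype.val (LinearMap.congr_fun hg y)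
    let f : StrongDual ℝ (LinearMap.range A.toFun) :=
      (((innerₛₗ ℝ z).comp A.domain.subtype).comp g).mkContinuous (‖z‖ * c) fun y => by
        have h := hbound (g y)
        rw [hAg] at h
        exact h
    obtain ⟨F, hF, -⟩ := exists_extension_norm_eq _ f
    have hw : ∀ x : A.domain, ⟪z, (x : X)⟫_ℝ = ⟪(InnerProductSpace.toDual ℝ Y).symm F, A x⟫_ℝ := by
      intro x
      rw [InnerProductSpace.toDual_symm_apply]
      have h1 : F (A x) = ⟪z, (g (A.toFun.rangeRestrict x) : X)⟫_ℝ :=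
        hF (A.toFun.rangeRestrict x)
      have h2 := hbound (x - g (A.toFun.rangeRestrict x))
      have h3 : A (g (A.toFun.rangeRestrict x)) = A x := hAg _
      rw [LinearPMap.map_sub, h3, sub_self, norm_zero, mul_zero, norm_le_zero_iff,
        Submodule.coe_sub, inner_sub_right, sub_eq_zero] at h2
      rw [h1, h2]
    have hd := LinearPMap.mem_adjoint_domain_of_exists (T := A) _ ⟨z, hw⟩
    exact ⟨⟨_, hd⟩, LinearPMap.adjoint_apply_eq hdense ⟨_, hd⟩ hw⟩
end

section
/- Suppose the embedding D(A) ∩ closure(R(A*)) ↪ X is compact. Then the orthogonal decompositions X = N(A) ⊕ R(A*) and Y = N(A*) ⊕ R(A) hold, i.e., R(A*) is the orthogonal complement of N(A) in X and R(A) is the orthogonal complement of N(A*) in Y (without closures on the ranges). -/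
open scoped InnerProductSpace

namespace LinearPMap

section Algebra

variable {R E F : Type*} [Ring R] [AddCommGroup E] [Module R E] [AddCommGroup F] [Module R F]

lemma mem_pmRange_iff {T : E →ₗ.[R] F} {y : F} : y ∈ T.pmRange ↔ ∃ x : T.domain, T x = y :=
  Iff.rfl

lemma mem_pmKer_iff {T : E →ₗ.[R] F} {x : E} : x ∈ T.pmKer ↔ (x, (0 : F)) ∈ T.graph := by
  rw [mem_graph_iff]
  constructor
  · rintro ⟨z, hz, rfl⟩
    exact ⟨z, rfl, hz⟩
  · rintro ⟨z, hz, h0⟩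
    exact ⟨z, h0, hz⟩

end Algebra

variable {X Y : Type*} [NormedAddCommGroup X] [InnerProductSpace ℝ X]
  [NormedAddCommGroup Y] [InnerProductSpace ℝ Y]

lemma IsClosed.isClosed_pmKer {T : X →ₗ.[ℝ] Y} (hT : T.IsClosed) :
    _root_.IsClosed (T.pmKer : Set X) := by
  have : (T.pmKer : Set X) = (fun x : X => (x, (0 : Y))) ⁻¹' (T.graph : Set (X × Y)) := by
    ext x
    exact mem_pmKer_iff
  rw [this]
  exact _root_.IsClosed.preimage (by fun_prop) hT

lemma exists_mem_orthogonal_pmKer [CompleteSpace X] {T : X →ₗ.[ℝ] Y} (hT : T.IsClosed)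
    (x : T.domain) : ∃ z : T.domain, (z : X) ∈ T.pmKerᗮ ∧ T z = T x := by
  have : CompleteSpace T.pmKer := hT.isClosed_pmKer.completeSpace_coe
  obtain ⟨p, hp, q, hq, hpq⟩ := T.pmKer.exists_add_mem_mem_orthogonal (x : X)
  obtain ⟨p', hp', rfl⟩ := hp
  refine ⟨x - p', ?_, ?_⟩
  · have : ((x - p' : T.domain) : X) = q := by
      rw [Submodule.coe_sub, hpq]
      simp
    rwa [this]
  · have h0 : T p' = 0 := hp'
    rw [map_sub, h0, sub_zero]

/-- A closed operator which is bounded below on the orthogonal complement of its kernel has closed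
range. -/
lemma IsClosed.isClosed_pmRange [CompleteSpace X] [CompleteSpace Y] {T : X →ₗ.[ℝ] Y}
    (hT : T.IsClosed) {c : ℝ}
    (hc : ∀ x : T.domain, (x : X) ∈ T.pmKerᗮ → ‖(x : X)‖ ≤ c * ‖T x‖) :
    _root_.IsClosed (T.pmRange : Set Y) := by
  let G : Submodule ℝ (X × Y) := T.graph ⊓ T.pmKerᗮ.comap (LinearMap.fst ℝ X Y)
  have hG : _root_.IsClosed (G : Set (X × Y)) :=
    _root_.IsClosed.inter hT ((Submodule.isClosed_orthogonal _).preimage continuous_fst)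
  have : CompleteSpace G := hG.completeSpace_coe
  let f : G →L[ℝ] Y := (ContinuousLinearMap.snd ℝ X Y).comp G.subtypeL
  have hf : AntilipschitzWith (max c 1).toNNReal f := by
    refine f.antilipschitz_of_bound ?_
    rintro ⟨⟨x, y⟩, hx, hx'⟩
    obtain ⟨z, rfl, rfl⟩ := (mem_graph_iff _).1 hx
    rw [Real.coe_toNNReal _ (by positivity)]
    refine max_le ?_ ?_
    · exact (hc z hx').trans (mul_le_mul_of_nonneg_right (le_max_left _ _) (norm_nonneg _))
    · exact le_mul_of_one_le_left (norm_nonneg _) (le_max_right _ _)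
  convert hf.isClosed_range f.uniformContinuous
  ext y
  constructor
  · rintro ⟨x, rfl⟩
    obtain ⟨z, hz, hzx⟩ := exists_mem_orthogonal_pmKer hT x
    exact ⟨⟨(z, T z), T.mem_graph z, hz⟩, hzx⟩
  · rintro ⟨⟨⟨x, y⟩, hx, hx'⟩, rfl⟩
    obtain ⟨z, rfl, rfl⟩ := (mem_graph_iff _).1 hx
    exact ⟨z, rfl⟩

lemma orthogonal_pmRange [CompleteSpace X] {T : X →ₗ.[ℝ] Y} (hT : Dense (T.domain : Set X)) :
    T.pmRangeᗮ = T.adjoint.pmKer := by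
  ext y
  rw [mem_pmKer_iff, adjoint_graph_eq_graph_adjoint hT, Submodule.mem_adjoint_iff,
    Submodule.mem_orthogonal]
  simp only [inner_zero_right, sub_zero]
  constructor
  · intro h a b hab
    obtain ⟨z, rfl, rfl⟩ := (mem_graph_iff _).1 hab
    exact h _ ⟨z, rfl⟩
  · rintro h _ ⟨z, rfl⟩
    exact h z _ (T.mem_graph z)

lemma orthogonal_pmRange_adjoint [CompleteSpace X] [CompleteSpace Y] {T : X →ₗ.[ℝ] Y}
    (hT : Dense (T.domain : Set X)) (hcl : T.IsClosed) :
    T.adjoint.pmRangeᗮ = T.pmKer := by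
  ext x
  constructor
  · intro hx
    let G : Submodule ℝ (WithLp 2 (X × Y)) :=
      T.graph.comap (WithLp.linearEquiv 2 ℝ (X × Y)).toLinearMap
    have hG : _root_.IsClosed (G : Set (WithLp 2 (X × Y))) :=
      _root_.IsClosed.preimage (WithLp.prod_continuous_ofLp 2 X Y) hcl
    have : CompleteSpace G := hG.completeSpace_coe
    rw [mem_pmKer_iff]
    suffices h : WithLp.toLp 2 (x, (0 : Y)) ∈ Gᗮᗮ by
      rw [Submodule.orthogonal_orthogonal] at h
      exact h
    rw [Submodule.mem_orthogonal]
    intro w hw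
    rw [Submodule.mem_orthogonal] at hw
    have hmem : (w.snd, -w.fst) ∈ T.adjoint.graph := by
      rw [adjoint_graph_eq_graph_adjoint hT, Submodule.mem_adjoint_iff]
      intro a b hab
      have h := hw (WithLp.toLp 2 (a, b)) hab
      rw [WithLp.prod_inner_apply] at h
      simp only [inner_neg_right]
      simp only [WithLp.ofLp_fst, WithLp.ofLp_snd] at h
      linarith
    obtain ⟨z, -, hz⟩ := (mem_graph_iff _).1 hmem
    have h := (Submodule.mem_orthogonal _ _).1 hx _ ⟨z, hz⟩
    rw [WithLp.prod_inner_apply]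
    simpa [inner_neg_left] using h
  · rintro ⟨z, hz, rfl⟩
    rw [Submodule.mem_orthogonal]
    rintro _ ⟨y, rfl⟩
    have h0 : T z = 0 := hz
    have h := adjoint_isFormalAdjoint hT y z
    rw [h0, inner_zero_right] at h
    exact h

/-- If `D(T) ∩ M` embeds compactly into `X` for a closed subspace `M` which
meets the kernel of `T` trivially, then `T` is bounded below on `D(T) ∩ M`. -/
lemma IsClosed.exists_norm_le {T : X →ₗ.[ℝ] Y} (hT : T.IsClosed) (M : Submodule ℝ X)
    (hM : _root_.IsClosed (M : Set X)) (hdisj : Disjoint T.pmKer M)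
    (hcomp : ∀ u : ℕ → T.domain, (∀ n, (u n : X) ∈ M) →
      (∃ C : ℝ, ∀ n, ‖(u n : X)‖ ^ 2 + ‖T (u n)‖ ^ 2 ≤ C) →
      ∃ (x : X) (φ : ℕ → ℕ), StrictMono φ ∧
        Filter.Tendsto (fun n => (u (φ n) : X)) Filter.atTop (nhds x)) :
    ∃ c : ℝ, 0 ≤ c ∧ ∀ x : T.domain, (x : X) ∈ M → ‖(x : X)‖ ≤ c * ‖T x‖ := by
  by_contra! hcon
  choose u huM hu using fun n : ℕ => hcon (n + 1) (by positivity)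
  have hpos : ∀ n, 0 < ‖(u n : X)‖ := fun n => lt_of_le_of_lt (by positivity) (hu n)
  let v : ℕ → T.domain := fun n => ‖(u n : X)‖⁻¹ • u n
  have hv1 : ∀ n, ‖(v n : X)‖ = 1 := fun n => by
    simp only [v, Submodule.coe_smul, norm_smul, norm_inv, norm_norm]
    exact inv_mul_cancel₀ (hpos n).ne'
  have hTv : ∀ n, ‖T (v n)‖ ≤ 1 / ((n : ℝ) + 1) := fun n => by
    simp only [v, map_smul, norm_smul, norm_inv, norm_norm]
    rw [inv_mul_le_iff₀ (hpos n), mul_one_div, le_div_iff₀ (by positivity), mul_comm]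
    exact (hu n).le
  have hvM : ∀ n, (v n : X) ∈ M := fun n => M.smul_mem _ (huM n)
  obtain ⟨x, φ, hφ, hx⟩ := hcomp v hvM ⟨2, fun n => by
    have h1 : ‖T (v n)‖ ≤ 1 := (hTv n).trans (by
      rw [div_le_one (by positivity)]
      linarith [(Nat.cast_nonneg n : (0 : ℝ) ≤ n)])
    rw [hv1]
    nlinarith [norm_nonneg (T (v n))]⟩
  have hT0 : Filter.Tendsto (fun n => T (v (φ n))) Filter.atTop (nhds 0) :=
    (squeeze_zero_norm hTv tendsto_one_div_add_atTop_nhds_zero_nat).comp hφ.tendsto_atTop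
  have hxK : x ∈ T.pmKer := mem_pmKer_iff.2 <|
    _root_.IsClosed.mem_of_tendsto hT (hx.prodMk_nhds hT0)
      (Filter.Eventually.of_forall fun n => T.mem_graph (v (φ n)))
  have hxM : x ∈ M := hM.mem_of_tendsto hx (Filter.Eventually.of_forall fun n => hvM _)
  have hx0 : x = 0 := Submodule.disjoint_def.1 hdisj x hxK hxM
  have hx1 : ‖x‖ = 1 :=
    tendsto_nhds_unique hx.norm (by simp only [hv1]; exact tendsto_const_nhds)
  simp [hx0] at hx1

end LinearPMap

/-- Under the compactness of the embedding `D(A) ∩ closure (R(A*)) ↪ X`,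
the orthogonal decompositions `X = N(A) ⊕ R(A*)` and `Y = N(A*) ⊕ R(A)` hold, i.e.
`R(A*) = N(A)ᗮ` and `R(A) = N(A*)ᗮ` (no closures on the ranges). -/
theorem stmt3
    {X Y : Type*} [NormedAddCommGroup X] [InnerProductSpace ℝ X] [CompleteSpace X]
    [NormedAddCommGroup Y] [InnerProductSpace ℝ Y] [CompleteSpace Y]
    (A : X →ₗ.[ℝ] Y) (hdense : Dense (A.domain : Set X)) (hclosed : A.IsClosed)
    (hcomp : ∀ u : ℕ → A.domain,
      (∀ n, (u n : X) ∈ closure (A.adjoint.pmRange : Set X)) →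
      (∃ C : ℝ, ∀ n, ‖(u n : X)‖ ^ 2 + ‖A (u n)‖ ^ 2 ≤ C) →
      ∃ (x : X) (φ : ℕ → ℕ), StrictMono φ ∧
        Filter.Tendsto (fun n => (u (φ n) : X)) Filter.atTop (nhds x)) :
    A.adjoint.pmRange = (A.pmKer)ᗮ ∧ A.pmRange = (A.adjoint.pmKer)ᗮ := by
  have hR := LinearPMap.orthogonal_pmRange hdense
  have hRadj := LinearPMap.orthogonal_pmRange_adjoint hdense hclosed
  have hclosure : closure (A.adjoint.pmRange : Set X) = (A.pmKerᗮ : Submodule ℝ X) := by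
    rw [← hRadj, Submodule.orthogonal_orthogonal_eq_closure, Submodule.topologicalClosure_coe]
  simp only [hclosure, SetLike.mem_coe] at hcomp
  obtain ⟨c, hc0, hc⟩ := hclosed.exists_norm_le A.pmKerᗮ (Submodule.isClosed_orthogonal _)
    (Submodule.orthogonal_disjoint _) hcomp
  have hrange : A.pmRange = A.adjoint.pmKerᗮ := by
    rw [← hR, Submodule.orthogonal_orthogonal_eq_closure,
      (hclosed.isClosed_pmRange hc).submodule_topologicalClosure_eq]
  refine ⟨?_, hrange⟩
  have hcadj : ∀ y : A.adjoint.domain, (y : Y) ∈ A.adjoint.pmKerᗮ →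
      ‖(y : Y)‖ ≤ c * ‖A.adjoint y‖ := by
    intro y hy
    rw [← hrange] at hy
    obtain ⟨x, hx⟩ := LinearPMap.mem_pmRange_iff.1 hy
    obtain ⟨z, hz, hzx⟩ := LinearPMap.exists_mem_orthogonal_pmKer hclosed x
    have hAz : A z = y := hzx.trans hx
    have hzc := hc z hz
    rw [hAz] at hzc
    have h := LinearPMap.adjoint_isFormalAdjoint hdense y z
    rw [hAz, real_inner_self_eq_norm_sq] at h
    have hle := real_inner_le_norm (A.adjoint y) (z : X)
    rcases (norm_nonneg (y : Y)).eq_or_lt with h0 | h0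
    · rw [← h0]
      positivity
    · refine le_of_mul_le_mul_right ?_ h0
      calc ‖(y : Y)‖ * ‖(y : Y)‖ = ⟪A.adjoint y, (z : X)⟫_ℝ := by rw [h, sq]
        _ ≤ ‖A.adjoint y‖ * (c * ‖(y : Y)‖) :=
          hle.trans (mul_le_mul_of_nonneg_left hzc (norm_nonneg _))
        _ = c * ‖A.adjoint y‖ * ‖(y : Y)‖ := by ring
  rw [← hRadj, Submodule.orthogonal_orthogonal_eq_closure,
    ((LinearPMap.adjoint_isClosed hdense).isClosed_pmRange hcadj).submodule_topologicalClosure_eq]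
end

section
/- Suppose the embedding D(A) ∩ closure(R(A*)) ↪ X is compact. Then the embedding D(A*) ∩ closure(R(A)) ↪ Y is compact as well, i.e., every sequence in D(A*) ∩ closure(R(A)) that is bounded in the graph norm of A* has a subsequence converging in Y. -/
open scoped InnerProductSpace

namespace LinearPMap

variable {X Y : Type*} [NormedAddCommGroup X] [InnerProductSpace ℝ X] [CompleteSpace X]
    [NormedAddCommGroup Y] [InnerProductSpace ℝ Y]

/-- A vector orthogonal to the range of the adjoint of a closed operator lies in its kernel. -/
theorem mk_zero_mem_graph_of_inner_adjoint_eq_zero [CompleteSpace Y]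
    (A : X →ₗ.[ℝ] Y)
    (hdense : Dense (A.domain : Set X)) (hclosed : A.IsClosed) {q : X}
    (hq : ∀ y : A.adjoint.domain, ⟪A.adjoint y, q⟫_ℝ = 0) : (q, (0 : Y)) ∈ A.graph := by
  let G : Submodule ℝ (WithLp 2 (X × Y)) :=
    A.graph.comap (WithLp.prodContinuousLinearEquiv 2 ℝ X Y).toLinearMap
  have hGc : _root_.IsClosed (G : Set (WithLp 2 (X × Y))) :=
    hclosed.preimage (WithLp.prodContinuousLinearEquiv 2 ℝ X Y).continuous
  have : CompleteSpace G := hGc.completeSpace_coe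
  have key : WithLp.toLp 2 (q, (0 : Y)) ∈ Gᗮᗮ := by
    rw [Submodule.mem_orthogonal]
    intro w hw
    rw [Submodule.mem_orthogonal'] at hw
    have h (x : A.domain) : ⟪-w.fst, (x : X)⟫_ℝ = ⟪w.snd, A x⟫_ℝ := by
      have : ⟪w.fst, (x : X)⟫_ℝ + ⟪w.snd, A x⟫_ℝ = 0 :=
        hw (WithLp.toLp 2 ((x : X), A x)) (A.mem_graph x)
      rw [inner_neg_left]
      linarith
    have hmem := A.mem_adjoint_domain_of_exists w.snd ⟨_, h⟩
    have hval := adjoint_apply_eq hdense ⟨w.snd, hmem⟩ h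
    have := hq ⟨w.snd, hmem⟩
    rw [hval, inner_neg_left, neg_eq_zero] at this
    simpa [WithLp.prod_inner_apply] using this
  rw [Submodule.orthogonal_orthogonal] at key
  exact key

/-- Every value of a closed operator is attained on the closure of the range of the adjoint. -/
theorem exists_mem_closure_pmRange_adjoint [CompleteSpace Y] (A : X →ₗ.[ℝ] Y)
    (hdense : Dense (A.domain : Set X)) (hclosed : A.IsClosed) (x : A.domain) :
    ∃ p : A.domain, (p : X) ∈ _root_.closure (A.adjoint.pmRange : Set X) ∧ A p = A x := by
  set K := A.adjoint.pmRange.topologicalClosure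
  obtain ⟨p, hp, q, hq, hx⟩ := K.exists_add_mem_mem_orthogonal (x : X)
  have hqA : (q, (0 : Y)) ∈ A.graph := by
    refine A.mk_zero_mem_graph_of_inner_adjoint_eq_zero hdense hclosed fun y ↦ ?_
    exact (Submodule.mem_orthogonal _ _).1 hq _
      (Submodule.le_topologicalClosure _ (LinearMap.mem_range_self A.adjoint.toFun y))
  obtain ⟨q', hq', hq0⟩ := A.mem_graph_iff.1 hqA
  simp only at hq' hq0
  refine ⟨x - q', ?_, by rw [A.map_sub, hq0, sub_zero]⟩
  have : ((x - q' : A.domain) : X) = p := by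
    rw [Submodule.coe_sub, hx, hq', add_sub_cancel_right]
  rw [this]
  exact hp

/-- If the embedding of `D(A) ∩ closure (R(A*))` is compact, then a Friedrichs–Poincaré type
estimate holds on this space. -/
theorem exists_norm_le_mul_norm_apply_s4 (A : X →ₗ.[ℝ] Y)
    (hdense : Dense (A.domain : Set X)) (hclosed : A.IsClosed)
    (hcomp : ∀ u : ℕ → A.domain,
      (∀ n, (u n : X) ∈ _root_.closure (A.adjoint.pmRange : Set X)) →
      (∃ C : ℝ, ∀ n, ‖(u n : X)‖ ^ 2 + ‖A (u n)‖ ^ 2 ≤ C) →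
      ∃ (x : X) (φ : ℕ → ℕ), StrictMono φ ∧
        Filter.Tendsto (fun n => (u (φ n) : X)) Filter.atTop (nhds x)) :
    ∃ c : ℝ, 0 ≤ c ∧ ∀ x : A.domain, (x : X) ∈ _root_.closure (A.adjoint.pmRange : Set X) →
      ‖(x : X)‖ ≤ c * ‖A x‖ := by
  by_contra! H
  choose w hw hlt using fun n : ℕ ↦ H (n + 1) (by positivity)
  have hpos (n : ℕ) : 0 < ‖(w n : X)‖ := lt_of_le_of_lt (by positivity) (hlt n)
  set u : ℕ → A.domain := fun n ↦ ‖(w n : X)‖⁻¹ • w n with hu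
  have hu1 (n : ℕ) : ‖(u n : X)‖ = 1 := by
    simp [hu, norm_smul, (hpos n).ne']
  have hAu (n : ℕ) : ‖A (u n)‖ ≤ 1 / ((n : ℝ) + 1) := by
    rw [hu, A.map_smul, norm_smul, norm_inv, norm_norm, inv_mul_le_iff₀ (hpos n),
      mul_one_div, le_div_iff₀ (by positivity), mul_comm]
    exact (hlt n).le
  have hmem (n : ℕ) : (u n : X) ∈ _root_.closure (A.adjoint.pmRange : Set X) :=
    A.adjoint.pmRange.topologicalClosure.smul_mem _ (hw n)
  obtain ⟨x, φ, hφ, hx⟩ := hcomp u hmem ⟨2, fun n ↦ by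
    have h1 : 1 / ((n : ℝ) + 1) ≤ 1 := by
      rw [div_le_one (by positivity)]; linarith [Nat.cast_nonneg (α := ℝ) n]
    have := (hAu n).trans h1
    rw [hu1]
    nlinarith [norm_nonneg (A (u n))]⟩
  have hA0 : Filter.Tendsto (fun n ↦ A (u (φ n))) Filter.atTop (nhds 0) :=
    (squeeze_zero_norm hAu tendsto_one_div_add_atTop_nhds_zero_nat).comp hφ.tendsto_atTop
  have hgraph : (x, (0 : Y)) ∈ A.graph :=
    _root_.IsClosed.mem_of_tendsto hclosed (hx.prodMk_nhds hA0)
      (Filter.Eventually.of_forall fun n ↦ A.mem_graph _)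
  obtain ⟨x', hx', hx0⟩ := A.mem_graph_iff.1 hgraph
  simp only at hx' hx0
  have hxK : x ∈ A.adjoint.pmRange.topologicalClosure :=
    isClosed_closure.mem_of_tendsto hx (Filter.Eventually.of_forall fun n ↦ hmem _)
  have hxO : x ∈ A.adjoint.pmRangeᗮ := by
    rw [Submodule.mem_orthogonal]
    rintro _ ⟨y, rfl⟩
    have := adjoint_isFormalAdjoint hdense y x'
    rw [hx0, inner_zero_right, hx'] at this
    exact this
  rw [← Submodule.orthogonal_closure] at hxO
  have hxx : x = 0 := by
    simpa using (Submodule.mem_orthogonal _ _).1 hxO x hxK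
  have h1 : ‖x‖ = 1 :=
    tendsto_nhds_unique hx.norm (by simp only [hu1]; exact tendsto_const_nhds)
  simp [hxx] at h1

end LinearPMap


/-- If the embedding `D(A) ∩ closure (R(A*)) ↪ X` is compact, then so is the
embedding `D(A*) ∩ closure (R(A)) ↪ Y`: every sequence therein bounded in the graph norm of
`A*` has a subsequence converging in `Y`. -/
theorem stmt4
    {X Y : Type*} [NormedAddCommGroup X] [InnerProductSpace ℝ X] [CompleteSpace X]
    [NormedAddCommGroup Y] [InnerProductSpace ℝ Y] [CompleteSpace Y]
    (A : X →ₗ.[ℝ] Y) (hdense : Dense (A.domain : Set X)) (hclosed : A.IsClosed)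
    (hcomp : ∀ u : ℕ → A.domain,
      (∀ n, (u n : X) ∈ closure (A.adjoint.pmRange : Set X)) →
      (∃ C : ℝ, ∀ n, ‖(u n : X)‖ ^ 2 + ‖A (u n)‖ ^ 2 ≤ C) →
      ∃ (x : X) (φ : ℕ → ℕ), StrictMono φ ∧
        Filter.Tendsto (fun n => (u (φ n) : X)) Filter.atTop (nhds x)) :
    ∀ v : ℕ → A.adjoint.domain,
      (∀ n, (v n : Y) ∈ closure (A.pmRange : Set Y)) →
      (∃ C : ℝ, ∀ n, ‖(v n : Y)‖ ^ 2 + ‖A.adjoint (v n)‖ ^ 2 ≤ C) →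
      ∃ (y : Y) (φ : ℕ → ℕ), StrictMono φ ∧
        Filter.Tendsto (fun n => (v (φ n) : Y)) Filter.atTop (nhds y) := by
  rintro v hv ⟨C, hC⟩
  obtain ⟨c, hc0, hc⟩ := A.exists_norm_le_mul_norm_apply_s4 hdense hclosed hcomp
  have hex (n : ℕ) : ∃ p : A.domain, (p : X) ∈ closure (A.adjoint.pmRange : Set X) ∧
      ‖(v n : Y) - A p‖ < 1 / ((n : ℝ) + 1) := by
    obtain ⟨_, ⟨x, rfl⟩, hx⟩ := Metric.mem_closure_iff.1 (hv n) (1 / ((n : ℝ) + 1))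
      (by positivity)
    obtain ⟨p, hp, hpx⟩ := A.exists_mem_closure_pmRange_adjoint hdense hclosed x
    refine ⟨p, hp, ?_⟩
    rw [hpx, ← dist_eq_norm]
    exact hx
  choose u hu hvu using hex
  set M := max C 1
  have hM1 : 1 ≤ M := le_max_right _ _
  have hvM (n : ℕ) : ‖(v n : Y)‖ ≤ M := by
    have := (hC n).trans (le_max_left C 1)
    nlinarith [sq_nonneg ‖A.adjoint (v n)‖, norm_nonneg (v n : Y)]
  have hAvM (n : ℕ) : ‖A.adjoint (v n)‖ ≤ M := by
    have := (hC n).trans (le_max_left C 1)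
    nlinarith [sq_nonneg ‖(v n : Y)‖, norm_nonneg (A.adjoint (v n))]
  have hAu (n : ℕ) : ‖A (u n)‖ ≤ M + 1 := by
    have h1 : 1 / ((n : ℝ) + 1) ≤ 1 := by
      rw [div_le_one (by positivity)]; linarith [Nat.cast_nonneg (α := ℝ) n]
    have h2 : ‖A (u n)‖ ≤ ‖(v n : Y)‖ + ‖(v n : Y) - A (u n)‖ := by
      simpa using norm_sub_le (v n : Y) ((v n : Y) - A (u n))
    linarith [hvM n, hvu n]
  obtain ⟨x, φ, hφ, hx⟩ := hcomp u hu ⟨(c * (M + 1)) ^ 2 + (M + 1) ^ 2, fun n ↦ by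
    have := (hc (u n) (hu n)).trans (mul_le_mul_of_nonneg_left (hAu n) hc0)
    gcongr
    exact hAu n⟩
  have hbound (n m : ℕ) : ‖(v n : Y) - v m‖ ^ 2 ≤
      2 * M * (‖(u n : X) - u m‖ + ‖(v n : Y) - A (u n)‖ + ‖(v m : Y) - A (u m)‖) := by
    have hadj := LinearPMap.adjoint_isFormalAdjoint hdense (v n - v m) (u n - u m)
    rw [A.map_sub, A.adjoint.map_sub, Submodule.coe_sub, Submodule.coe_sub] at hadj
    have h1 : ‖(v n : Y) - v m‖ ^ 2 =
        ⟪A.adjoint (v n) - A.adjoint (v m), (u n : X) - u m⟫_ℝ +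
        ⟪(v n : Y) - v m, ((v n : Y) - A (u n)) - ((v m : Y) - A (u m))⟫_ℝ := by
      rw [hadj, ← inner_add_right, ← real_inner_self_eq_norm_sq]
      congr 1
      abel
    have h2 : ‖A.adjoint (v n) - A.adjoint (v m)‖ ≤ 2 * M := by
      linarith [norm_sub_le (A.adjoint (v n)) (A.adjoint (v m)), hAvM n, hAvM m]
    have h3 : ‖(v n : Y) - v m‖ ≤ 2 * M := by
      linarith [norm_sub_le (v n : Y) (v m : Y), hvM n, hvM m]
    have h4 := (real_inner_le_norm (A.adjoint (v n) - A.adjoint (v m))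
      ((u n : X) - u m)).trans (mul_le_mul_of_nonneg_right h2 (norm_nonneg _))
    have h5 := (real_inner_le_norm ((v n : Y) - v m)
      (((v n : Y) - A (u n)) - ((v m : Y) - A (u m)))).trans
      (mul_le_mul h3 (norm_sub_le _ _) (norm_nonneg _) (by linarith))
    rw [h1]
    linarith
  have hcauchy : CauchySeq fun n ↦ (v (φ n) : Y) := by
    rw [Metric.cauchySeq_iff]
    intro ε hε
    have hδ : 0 < ε ^ 2 / (6 * M) := by positivity
    obtain ⟨N₁, hN₁⟩ := Metric.cauchySeq_iff.1 hx.cauchySeq _ hδ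
    obtain ⟨N₂, hN₂⟩ := exists_nat_one_div_lt hδ
    have hsmall (n : ℕ) (hn : N₂ ≤ n) :
        ‖(v (φ n) : Y) - A (u (φ n))‖ < ε ^ 2 / (6 * M) := by
      refine (hvu (φ n)).trans (lt_of_le_of_lt ?_ hN₂)
      have : N₂ ≤ φ n := hn.trans (hφ.id_le n)
      gcongr
    refine ⟨max N₁ N₂, fun m hm n hn ↦ ?_⟩
    have h1 := hN₁ m (le_of_max_le_left hm) n (le_of_max_le_left hn)
    rw [dist_eq_norm] at h1 ⊢
    have h2 := hsmall m (le_of_max_le_right hm)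
    have h3 := hsmall n (le_of_max_le_right hn)
    refine lt_of_pow_lt_pow_left₀ 2 hε.le (lt_of_le_of_lt (hbound _ _) ?_)
    have h4 : 2 * M * (3 * (ε ^ 2 / (6 * M))) = ε ^ 2 := by
      field_simp
      norm_num
    rw [← h4]
    gcongr
    linarith
  obtain ⟨y, hy⟩ := cauchySeq_tendsto_of_complete hcauchy
  exact ⟨y, φ, hφ, hy⟩
end

section
/- Suppose the embedding D(A) ∩ closure(R(A*)) ↪ X is compact, and suppose R(A*) ≠ {0}. Then the two best constants coincide: the minimum of ‖A x‖_Y / ‖x‖_X over all nonzero x ∈ D(A) ∩ R(A*) equals the minimum of ‖A* y‖_X / ‖y‖_Y over all nonzero y ∈ D(A*) ∩ R(A), and both minima are attained and are strictly positive. -/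
open scoped InnerProductSpace

open Filter Topology

section CompactOperator

variable {H X : Type*} [NormedAddCommGroup H] [InnerProductSpace ℝ H]
  [NormedAddCommGroup X] [InnerProductSpace ℝ X]

lemma ContinuousLinearMap.exists_seq_norm_apply_tendsto (S : H →L[ℝ] X) (hS : S ≠ 0) :
    ∃ u : ℕ → H, (∀ n, ‖u n‖ = 1) ∧ Tendsto (fun n => ‖S (u n)‖) atTop (𝓝 ‖S‖) := by
  have hS' : 0 < ‖S‖ := norm_pos_iff.mpr hS
  have key : ∀ n : ℕ, ∃ u : H, ‖u‖ = 1 ∧ ‖S‖ - ‖S‖ * (1 / ((n : ℝ) + 1)) ≤ ‖S u‖ := by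
    intro n
    have hn : 0 < 1 / ((n : ℝ) + 1) := by positivity
    have hn1 : 1 / ((n : ℝ) + 1) ≤ 1 := by
      rw [div_le_one (by positivity)]
      have : (0 : ℝ) ≤ n := n.cast_nonneg
      linarith
    have hr : 0 ≤ ‖S‖ - ‖S‖ * (1 / ((n : ℝ) + 1)) := by nlinarith
    have hlt : ‖S‖ - ‖S‖ * (1 / ((n : ℝ) + 1)) < ‖S‖ := by nlinarith
    by_contra! hcon
    refine absurd (S.opNorm_le_bound hr fun x => ?_) (not_le.mpr hlt)
    rcases eq_or_ne x 0 with rfl | hx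
    · simp
    · have hx' : 0 < ‖x‖ := norm_pos_iff.mpr hx
      have h := hcon (‖x‖⁻¹ • x) (norm_smul_inv_norm (𝕜 := ℝ) hx)
      rw [map_smul, norm_smul, norm_inv, norm_norm, inv_mul_lt_iff₀ hx'] at h
      linarith
  choose u hu hSu using key
  refine ⟨u, hu, tendsto_of_tendsto_of_tendsto_of_le_of_le ?_ tendsto_const_nhds hSu fun n => ?_⟩
  · simpa using tendsto_const_nhds.sub
      ((tendsto_one_div_add_atTop_nhds_zero_nat (𝕜 := ℝ)).const_mul ‖S‖)
  · simpa [hu n] using S.le_opNorm (u n)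

/-- A nonzero compact operator attains its norm at a singular vector. -/
lemma ContinuousLinearMap.exists_adjoint_apply_apply_eq [CompleteSpace H]
    [CompleteSpace X] (S : H →L[ℝ] X) (hS : S ≠ 0)
    (hcomp : ∀ u : ℕ → H, (∀ n, ‖u n‖ = 1) →
      ∃ (x : X) (φ : ℕ → ℕ), StrictMono φ ∧ Tendsto (fun n => S (u (φ n))) atTop (𝓝 x)) :
    ∃ u : H, ‖u‖ = 1 ∧ S.adjoint (S u) = (‖S‖ ^ 2) • u := by
  have hS' : 0 < ‖S‖ := norm_pos_iff.mpr hS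
  obtain ⟨u, hu, hlim⟩ := S.exists_seq_norm_apply_tendsto hS
  obtain ⟨x, φ, hφ, hx⟩ := hcomp u hu
  have hbound : ∀ n, ‖S.adjoint (S (u n)) - (‖S‖ ^ 2) • u n‖ ^ 2
      ≤ 2 * ‖S‖ ^ 2 * (‖S‖ ^ 2 - ‖S (u n)‖ ^ 2) := by
    intro n
    have h1 : ‖S.adjoint (S (u n))‖ ≤ ‖S‖ ^ 2 := by
      calc ‖S.adjoint (S (u n))‖ ≤ ‖S.adjoint‖ * ‖S (u n)‖ := S.adjoint.le_opNorm _
        _ ≤ ‖S‖ * (‖S‖ * ‖u n‖) := by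
          rw [LinearIsometryEquiv.norm_map]
          gcongr
          exact S.le_opNorm _
        _ = ‖S‖ ^ 2 := by rw [hu]; ring
    have h2 : ‖S.adjoint (S (u n))‖ ^ 2 ≤ (‖S‖ ^ 2) ^ 2 := by gcongr
    rw [norm_sub_sq_real, inner_smul_right, ContinuousLinearMap.adjoint_inner_left,
      real_inner_self_eq_norm_sq, norm_smul, hu, Real.norm_of_nonneg (by positivity)]
    nlinarith
  have hsq : Tendsto (fun n => ‖S.adjoint (S (u n)) - (‖S‖ ^ 2) • u n‖ ^ 2) atTop (𝓝 0) := by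
    refine squeeze_zero (fun n => by positivity) hbound ?_
    have := ((hlim.pow 2).const_sub (‖S‖ ^ 2)).const_mul (2 * ‖S‖ ^ 2)
    simpa using this
  have hdiff : Tendsto (fun n => S.adjoint (S (u n)) - (‖S‖ ^ 2) • u n) atTop (𝓝 0) := by
    rw [tendsto_zero_iff_norm_tendsto_zero]
    simpa using hsq.sqrt
  have hadj : Tendsto (fun n => S.adjoint (S (u (φ n)))) atTop (𝓝 (S.adjoint x)) :=
    (S.adjoint.continuous.tendsto x).comp hx
  have hconv : Tendsto (fun n => u (φ n)) atTop (𝓝 ((‖S‖ ^ 2)⁻¹ • S.adjoint x)) := by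
    have := (hadj.sub (hdiff.comp hφ.tendsto_atTop)).const_smul ((‖S‖ ^ 2)⁻¹)
    simpa [smul_smul, hS'.ne'] using this
  refine ⟨(‖S‖ ^ 2)⁻¹ • S.adjoint x, ?_, ?_⟩
  · exact tendsto_nhds_unique hconv.norm (by simp [hu])
  · have h1 := (S.continuous.tendsto _).comp hconv
    rw [tendsto_nhds_unique h1 hx, smul_smul, mul_inv_cancel₀ (by positivity), one_smul]

end CompactOperator

namespace LinearPMap

variable {X Y : Type*} [NormedAddCommGroup X] [InnerProductSpace ℝ X]
  [NormedAddCommGroup Y] [InnerProductSpace ℝ Y] {A : X →ₗ.[ℝ] Y}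

lemma mem_pmRange_iff_s5 {y : Y} : y ∈ A.pmRange ↔ ∃ x : A.domain, A x = y := Iff.rfl

lemma IsClosed.exists_apply_eq_of_tendsto_s5 (hclosed : A.IsClosed) {u : ℕ → A.domain} {x : X} {y : Y}
    (hx : Tendsto (fun n => (u n : X)) atTop (𝓝 x)) (hy : Tendsto (fun n => A (u n)) atTop (𝓝 y)) :
    ∃ z : A.domain, (z : X) = x ∧ A z = y := by
  have : (x, y) ∈ A.graph := _root_.IsClosed.mem_of_tendsto hclosed (hx.prodMk_nhds hy)
    (Eventually.of_forall fun n => A.mem_graph (u n))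
  simpa using (A.mem_graph_iff).mp this

variable [CompleteSpace X]

/-- The kernel of a closed operator contains the orthogonal complement of the adjoint's range. -/
lemma IsClosed.exists_apply_eq_zero [CompleteSpace Y] (hclosed : A.IsClosed)
    (hdense : Dense (A.domain : Set X)) {x : X} (hx : x ∈ (A.adjoint.pmRange)ᗮ) :
    ∃ z : A.domain, (z : X) = x ∧ A z = 0 := by
  let e := WithLp.prodContinuousLinearEquiv 2 ℝ X Y
  let G : Submodule ℝ (WithLp 2 (X × Y)) := A.graph.comap e.toLinearEquiv.toLinearMap
  have hG : _root_.IsClosed (G : Set (WithLp 2 (X × Y))) :=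
    _root_.IsClosed.preimage e.continuous hclosed
  have : CompleteSpace G := hG.completeSpace_coe
  have hmem : WithLp.toLp 2 (x, (0 : Y)) ∈ Gᗮᗮ := by
    rw [Submodule.mem_orthogonal]
    intro p hp
    have hp' : ∀ z : A.domain, ⟪-p.fst, (z : X)⟫_ℝ = ⟪p.snd, A z⟫_ℝ := by
      intro z
      have hz : WithLp.toLp 2 ((z : X), A z) ∈ G := A.mem_graph z
      have h := (Submodule.mem_orthogonal' _ _).mp hp _ hz
      rw [WithLp.prod_inner_apply] at h
      simp only [inner_neg_left]
      simp at h
      linarith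
    have hdom : p.snd ∈ A.adjoint.domain := mem_adjoint_domain_of_exists _ ⟨_, hp'⟩
    have hadj := adjoint_apply_eq hdense ⟨p.snd, hdom⟩ hp'
    have h := (Submodule.mem_orthogonal _ _).mp hx _ (mem_pmRange_iff_s5.mpr ⟨_, hadj⟩)
    rw [WithLp.prod_inner_apply]
    simpa using h
  rw [Submodule.orthogonal_orthogonal] at hmem
  have hgraph : (x, (0 : Y)) ∈ A.graph := hmem
  simpa using (A.mem_graph_iff).mp hgraph

lemma eq_zero_of_mem_closure_of_apply_eq_zero (hdense : Dense (A.domain : Set X)) {x : A.domain}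
    (hx : (x : X) ∈ A.adjoint.pmRange.topologicalClosure) (hAx : A x = 0) : (x : X) = 0 := by
  have h : (x : X) ∈ (A.adjoint.pmRange)ᗮ := by
    rw [Submodule.mem_orthogonal]
    rintro _ ⟨y, rfl⟩
    have := adjoint_isFormalAdjoint hdense y x
    rw [hAx, inner_zero_right] at this
    exact this
  rw [← Submodule.orthogonal_closure] at h
  exact inner_self_eq_zero.mp ((Submodule.mem_orthogonal _ _).mp h _ hx)

lemma eq_of_mem_closure_of_apply_eq (hdense : Dense (A.domain : Set X)) {x z : A.domain}
    (hx : (x : X) ∈ A.adjoint.pmRange.topologicalClosure)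
    (hz : (z : X) ∈ A.adjoint.pmRange.topologicalClosure) (h : A x = A z) : x = z := by
  have := eq_zero_of_mem_closure_of_apply_eq_zero hdense (x := x - z)
    (by simpa using Submodule.sub_mem _ hx hz) (by rw [map_sub, h, sub_self])
  exact Subtype.ext (sub_eq_zero.mp (by simpa using this))

lemma IsClosed.exists_mem_closure_apply_eq [CompleteSpace Y] (hclosed : A.IsClosed)
    (hdense : Dense (A.domain : Set X)) (x : A.domain) :
    ∃ z : A.domain, (z : X) ∈ A.adjoint.pmRange.topologicalClosure ∧ A z = A x ∧
      (x : X) - z ∈ (A.adjoint.pmRange.topologicalClosure)ᗮ := by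
  set K := A.adjoint.pmRange.topologicalClosure
  have : CompleteSpace K := A.adjoint.pmRange.isClosed_topologicalClosure.completeSpace_coe
  have hperp : (x : X) - K.starProjection x ∈ Kᗮ := K.sub_starProjection_mem_orthogonal _
  have hperp' : (x : X) - K.starProjection x ∈ (A.adjoint.pmRange)ᗮ := by
    rwa [← Submodule.orthogonal_closure]
  obtain ⟨w, hw, hAw⟩ := hclosed.exists_apply_eq_zero hdense hperp'
  have hxw : ((x - w : A.domain) : X) = K.starProjection x := by
    rw [Submodule.coe_sub, hw, sub_sub_cancel]
  refine ⟨x - w, ?_, by rw [map_sub, hAw, sub_zero], ?_⟩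
  · rw [hxw]
    exact K.starProjection_apply_mem _
  · rwa [hxw]

/-- Every sequence in `D(A) ∩ closure (R(A*))` bounded in the graph norm of `A` has a subsequence
converging in `X`. -/
def HasCompactEmbedding (A : X →ₗ.[ℝ] Y) : Prop :=
  ∀ u : ℕ → A.domain,
    (∀ n, (u n : X) ∈ _root_.closure (A.adjoint.pmRange : Set X)) →
    (∃ C : ℝ, ∀ n, ‖(u n : X)‖ ^ 2 + ‖A (u n)‖ ^ 2 ≤ C) →
    ∃ (x : X) (φ : ℕ → ℕ), StrictMono φ ∧ Tendsto (fun n => (u (φ n) : X)) atTop (𝓝 x)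

/-- The Friedrichs–Poincaré estimate. -/
lemma HasCompactEmbedding.exists_norm_le (hcomp : A.HasCompactEmbedding)
    (hdense : Dense (A.domain : Set X)) (hclosed : A.IsClosed) :
    ∃ c : ℝ, 0 ≤ c ∧ ∀ x : A.domain, (x : X) ∈ A.adjoint.pmRange.topologicalClosure →
      ‖(x : X)‖ ≤ c * ‖A x‖ := by
  by_contra! hcon
  have key : ∀ n : ℕ, ∃ u : A.domain, (u : X) ∈ A.adjoint.pmRange.topologicalClosure ∧
      ‖(u : X)‖ = 1 ∧ ‖A u‖ ≤ 1 / ((n : ℝ) + 1) := by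
    intro n
    obtain ⟨x, hx, hlt⟩ := hcon ((n : ℝ) + 1) (by positivity)
    have hx0 : 0 < ‖(x : X)‖ := lt_of_le_of_lt (by positivity) hlt
    refine ⟨‖(x : X)‖⁻¹ • x, Submodule.smul_mem _ _ hx,
      norm_smul_inv_norm (𝕜 := ℝ) (norm_pos_iff.mp hx0), ?_⟩
    rw [map_smul, norm_smul, norm_inv, norm_norm, inv_mul_le_iff₀ hx0, mul_one_div,
      le_div_iff₀ (by positivity)]
    linarith
  choose u hu hu1 hAu using key
  have hAlim : Tendsto (fun n => A (u n)) atTop (𝓝 0) :=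
    squeeze_zero_norm hAu tendsto_one_div_add_atTop_nhds_zero_nat
  obtain ⟨x, φ, hφ, hx⟩ := hcomp u hu ⟨2, fun n => by
    have h1 : 1 / ((n : ℝ) + 1) ≤ 1 := by
      rw [div_le_one (by positivity)]
      have : (0 : ℝ) ≤ n := n.cast_nonneg
      linarith
    have h2 := (hAu n).trans h1
    rw [hu1]
    nlinarith [norm_nonneg (A (u n))]⟩
  obtain ⟨z, rfl, hAz⟩ := hclosed.exists_apply_eq_of_tendsto_s5 (u := fun n => u (φ n)) hx
    (hAlim.comp hφ.tendsto_atTop)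
  have hzK : (z : X) ∈ A.adjoint.pmRange.topologicalClosure :=
    A.adjoint.pmRange.isClosed_topologicalClosure.mem_of_tendsto hx
      (Eventually.of_forall fun n => hu _)
  have hz0 := eq_zero_of_mem_closure_of_apply_eq_zero hdense hzK hAz
  have hz1 : ‖(z : X)‖ = 1 := tendsto_nhds_unique hx.norm (by simp [hu1])
  simp [hz0] at hz1

lemma HasCompactEmbedding.isClosed_pmRange [CompleteSpace Y] (hcomp : A.HasCompactEmbedding)
    (hdense : Dense (A.domain : Set X)) (hclosed : A.IsClosed) :
    _root_.IsClosed (A.pmRange : Set Y) := by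
  obtain ⟨c, hc, hle⟩ := hcomp.exists_norm_le hdense hclosed
  refine isClosed_of_closure_subset fun y hy => ?_
  obtain ⟨v, hv, hlim⟩ := mem_closure_iff_seq_limit.mp hy
  have hex : ∀ n, ∃ z : A.domain, (z : X) ∈ A.adjoint.pmRange.topologicalClosure ∧ A z = v n := by
    intro n
    obtain ⟨x, hx⟩ := hv n
    obtain ⟨z, hz, hAz, -⟩ := hclosed.exists_mem_closure_apply_eq hdense x
    exact ⟨z, hz, hAz.trans hx⟩
  choose z hz hAz using hex
  have hcauchy : CauchySeq fun n => (z n : X) := by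
    have hd := hlim.cauchySeq
    rw [Metric.cauchySeq_iff] at hd ⊢
    intro ε hε
    obtain ⟨N, hN⟩ := hd (ε / (c + 1)) (by positivity)
    refine ⟨N, fun m hm n hn => ?_⟩
    have h1 := hN m hm n hn
    have h2 := hle (z m - z n) (by simpa using Submodule.sub_mem _ (hz m) (hz n))
    rw [map_sub, hAz, hAz, Submodule.coe_sub] at h2
    rw [dist_eq_norm] at h1 ⊢
    rw [lt_div_iff₀ (by positivity)] at h1
    nlinarith [norm_nonneg (v m - v n)]
  obtain ⟨x, hx⟩ := cauchySeq_tendsto_of_complete hcauchy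
  obtain ⟨w, -, hw⟩ := hclosed.exists_apply_eq_of_tendsto_s5 hx (by simpa [hAz] using hlim)
  exact ⟨w, hw⟩

/-- The bounded inverse of `A` on `D(A) ∩ closure (R(A*))`. -/
lemma HasCompactEmbedding.exists_inverse [CompleteSpace Y] (hcomp : A.HasCompactEmbedding)
    (hdense : Dense (A.domain : Set X)) (hclosed : A.IsClosed) :
    ∃ S : A.pmRange →L[ℝ] X, ∀ h, S h ∈ A.adjoint.pmRange.topologicalClosure ∧
      ∃ hd : S h ∈ A.domain, A ⟨S h, hd⟩ = h := by
  obtain ⟨c, -, hle⟩ := hcomp.exists_norm_le hdense hclosed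
  have hex : ∀ h : A.pmRange, ∃ z : A.domain,
      (z : X) ∈ A.adjoint.pmRange.topologicalClosure ∧ A z = h := by
    rintro ⟨_, x, rfl⟩
    obtain ⟨z, hz, hAz, -⟩ := hclosed.exists_mem_closure_apply_eq hdense x
    exact ⟨z, hz, hAz⟩
  choose s hs hAs using hex
  let L : A.pmRange →ₗ[ℝ] A.domain :=
    { toFun := s
      map_add' := fun a b => eq_of_mem_closure_of_apply_eq hdense (hs _)
        (Submodule.add_mem _ (hs a) (hs b)) (by rw [map_add, hAs, hAs, hAs, Submodule.coe_add])
      map_smul' := fun r a => eq_of_mem_closure_of_apply_eq hdense (hs _)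
        (Submodule.smul_mem _ r (hs a)) (by
          rw [RingHom.id_apply, map_smul, hAs, hAs, Submodule.coe_smul]) }
  refine ⟨(A.domain.subtype ∘ₗ L).mkContinuous c fun h => ?_, fun h => ⟨hs h, (s h).2, hAs h⟩⟩
  have hb := hle (s h) (hs h)
  rwa [hAs] at hb

end LinearPMap

open LinearPMap

/-- If the embedding `D(A) ∩ closure (R(A*)) ↪ X` is compact and
`R(A*) ≠ {0}`, then the best constants coincide: the minimum of `‖A x‖ / ‖x‖` over nonzero
`x ∈ D(A) ∩ R(A*)` and the minimum of `‖A* y‖ / ‖y‖` over nonzero `y ∈ D(A*) ∩ R(A)` are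
both attained, strictly positive, and equal. -/
theorem stmt5
    {X Y : Type*} [NormedAddCommGroup X] [InnerProductSpace ℝ X] [CompleteSpace X]
    [NormedAddCommGroup Y] [InnerProductSpace ℝ Y] [CompleteSpace Y]
    (A : X →ₗ.[ℝ] Y) (hdense : Dense (A.domain : Set X)) (hclosed : A.IsClosed)
    (hcomp : ∀ u : ℕ → A.domain,
      (∀ n, (u n : X) ∈ closure (A.adjoint.pmRange : Set X)) →
      (∃ C : ℝ, ∀ n, ‖(u n : X)‖ ^ 2 + ‖A (u n)‖ ^ 2 ≤ C) →
      ∃ (x : X) (φ : ℕ → ℕ), StrictMono φ ∧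
        Filter.Tendsto (fun n => (u (φ n) : X)) Filter.atTop (nhds x))
    (hne : A.adjoint.pmRange ≠ ⊥) :
    ∃ m : ℝ, 0 < m ∧
      IsLeast {r : ℝ | ∃ u : A.domain, (u : X) ∈ A.adjoint.pmRange ∧ (u : X) ≠ 0 ∧
        r = ‖A u‖ / ‖(u : X)‖} m ∧
      IsLeast {r : ℝ | ∃ v : A.adjoint.domain, (v : Y) ∈ A.pmRange ∧ (v : Y) ≠ 0 ∧
        r = ‖A.adjoint v‖ / ‖(v : Y)‖} m := by
  have hcomp' : A.HasCompactEmbedding := hcomp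
  have hformal := adjoint_isFormalAdjoint hdense
  have : CompleteSpace A.pmRange := (hcomp'.isClosed_pmRange hdense hclosed).completeSpace_coe
  obtain ⟨S, hS⟩ := hcomp'.exists_inverse hdense hclosed
  choose hSK hSdom hAS using hS
  have hS0 : S ≠ 0 := by
    rintro rfl
    have hA : ∀ x : A.domain, A x = 0 := fun x => by
      have h := hAS ⟨A x, x, rfl⟩
      exact h.symm.trans A.map_zero
    refine hne ((Submodule.eq_bot_iff _).mpr ?_)
    rintro _ ⟨y, rfl⟩
    exact adjoint_apply_eq hdense y fun x => by simp [hA]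
  have hSpos : 0 < ‖S‖ := (norm_pos_iff (a := S)).mpr hS0
  have hinv : ∀ x : A.domain, (x : X) ∈ A.adjoint.pmRange.topologicalClosure →
      S ⟨A x, x, rfl⟩ = x := fun x hx =>
    congrArg Subtype.val (eq_of_mem_closure_of_apply_eq hdense (x := ⟨_, hSdom _⟩) (hSK _) hx
      (hAS _))
  have hadj : ∀ z ∈ A.adjoint.pmRange.topologicalClosure, ∀ x : A.domain,
      ⟪z, (x : X)⟫_ℝ = ⟪(S.adjoint z : Y), A x⟫_ℝ := by
    intro z hz x
    obtain ⟨w, hw, hAw, hxw⟩ := hclosed.exists_mem_closure_apply_eq hdense x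
    have h1 : ⟪z, (x : X) - w⟫_ℝ = 0 := (Submodule.mem_orthogonal _ _).mp hxw z hz
    have h2 := S.adjoint_inner_left ⟨A w, w, rfl⟩ z
    rw [hinv w hw, Submodule.coe_inner] at h2
    rw [inner_sub_right] at h1
    rw [← hAw]
    linarith
  have hadjdom : ∀ z ∈ A.adjoint.pmRange.topologicalClosure,
      (S.adjoint z : Y) ∈ A.adjoint.domain := fun z hz =>
    mem_adjoint_domain_of_exists _ ⟨z, hadj z hz⟩
  have hadjapply : ∀ z (hz : z ∈ A.adjoint.pmRange.topologicalClosure),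
      A.adjoint ⟨S.adjoint z, hadjdom z hz⟩ = z := fun z hz =>
    adjoint_apply_eq hdense _ (hadj z hz)
  obtain ⟨u, hu, hSu⟩ := S.exists_adjoint_apply_apply_eq hS0 fun u hu => by
    refine hcomp (fun n => ⟨S (u n), hSdom _⟩) (fun n => hSK _) ⟨‖S‖ ^ 2 + 1, fun n => ?_⟩
    have h1 : ‖S (u n)‖ ≤ ‖S‖ := by simpa [hu n] using S.le_opNorm (u n)
    have h2 : ‖((u n : A.pmRange) : Y)‖ = 1 := hu n
    rw [hAS, h2]
    gcongr
    norm_num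
  have hnorm : ‖S u‖ = ‖S‖ := by
    have h := S.adjoint_inner_left u (S u)
    rw [hSu, inner_smul_left, real_inner_self_eq_norm_sq, real_inner_self_eq_norm_sq, hu] at h
    simp at h
    exact h.symm
  have huY : ‖(u : Y)‖ = 1 := hu
  refine ⟨‖S‖⁻¹, inv_pos.mpr hSpos, ⟨?_, ?_⟩, ⟨?_, ?_⟩⟩
  · refine ⟨⟨S u, hSdom u⟩, ⟨_, hadjapply _ (hSK u)⟩, norm_pos_iff.mp (hnorm ▸ hSpos), ?_⟩
    rw [hAS, huY, hnorm, one_div]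
  · rintro _ ⟨x, hx, hx0, rfl⟩
    have h := S.le_opNorm ⟨A x, x, rfl⟩
    rw [hinv x (Submodule.le_topologicalClosure _ hx), Submodule.coe_norm] at h
    rw [le_div_iff₀ (norm_pos_iff.mpr hx0), inv_mul_le_iff₀ hSpos]
    exact h
  · have hv : ‖(S.adjoint (S u) : Y)‖ = ‖S‖ ^ 2 := by
      rw [hSu, Submodule.coe_smul, norm_smul, huY, Real.norm_of_nonneg (by positivity), mul_one]
    refine ⟨⟨S.adjoint (S u), hadjdom _ (hSK u)⟩, (S.adjoint (S u)).2,
      norm_pos_iff.mp (hv ▸ by positivity), ?_⟩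
    rw [hadjapply _ (hSK u), hnorm, hv]
    field_simp
  · rintro _ ⟨v, hv, hv0, rfl⟩
    have hSv : S.adjoint (A.adjoint v) = ⟨v, hv⟩ := by
      refine ext_inner_right ℝ fun h => ?_
      rw [S.adjoint_inner_left, Submodule.coe_inner]
      have := hformal v ⟨S h, hSdom h⟩
      rwa [hAS] at this
    have h := S.adjoint.le_opNorm (A.adjoint v)
    rw [hSv, LinearIsometryEquiv.norm_map, Submodule.coe_norm] at h
    rw [le_div_iff₀ (norm_pos_iff.mpr hv0), inv_mul_le_iff₀ hSpos]
    exact h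
end

section
/- Let λ be a nonzero real number. Then λ belongs to the resolvent set of M if and only if λ² belongs to the resolvent set of A*A, if and only if λ² belongs to the resolvent set of A A*. -/
open scoped InnerProductSpace

noncomputable section

variable {X Y : Type*}
  [NormedAddCommGroup X] [InnerProductSpace ℝ X] [CompleteSpace X]
  [NormedAddCommGroup Y] [InnerProductSpace ℝ Y] [CompleteSpace Y]

/-- \`lam\` belongs to the resolvent set of the block operator \`M (x, y) = (A* y, A x)\` on the
Hilbert space \`Z = X × Y\`: \`M - lam\` is a bijection from \`D(M) = D(A) × D(A*)\` onto \`Z\`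
whose inverse is bounded (witnessed by the estimate \`‖z‖_Z ≤ c * ‖(M - lam) z‖_Z\`). -/
def InResM (A : X →ₗ.[ℝ] Y) (lam : ℝ) : Prop :=
  (∀ w : X × Y, ∃! z : {p : X × Y // p.1 ∈ A.domain ∧ p.2 ∈ A.adjoint.domain},
      (A.adjoint ⟨z.1.2, z.2.2⟩ - lam • z.1.1, A ⟨z.1.1, z.2.1⟩ - lam • z.1.2) = w) ∧
  ∃ c : ℝ, 0 < c ∧ ∀ z : {p : X × Y // p.1 ∈ A.domain ∧ p.2 ∈ A.adjoint.domain},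
      Real.sqrt (‖z.1.1‖ ^ 2 + ‖z.1.2‖ ^ 2) ≤
        c * Real.sqrt (‖A.adjoint ⟨z.1.2, z.2.2⟩ - lam • z.1.1‖ ^ 2 +
          ‖A ⟨z.1.1, z.2.1⟩ - lam • z.1.2‖ ^ 2)

/-- \`mu\` belongs to the resolvent set of \`A*A\`: the operator \`A*A - mu\` is a bijection from
\`D(A*A) = {x ∈ D(A) : A x ∈ D(A*)}\` onto \`X\` with bounded inverse. -/
def InResAsA (A : X →ₗ.[ℝ] Y) (mu : ℝ) : Prop :=
  (∀ f : X, ∃! x : {u : A.domain // A u ∈ A.adjoint.domain},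
      A.adjoint ⟨A x.1, x.2⟩ - mu • (x.1 : X) = f) ∧
  ∃ c : ℝ, 0 < c ∧ ∀ x : {u : A.domain // A u ∈ A.adjoint.domain},
      ‖(x.1 : X)‖ ≤ c * ‖A.adjoint ⟨A x.1, x.2⟩ - mu • (x.1 : X)‖

/-- \`mu\` belongs to the resolvent set of \`A A*\`: the operator \`A A* - mu\` is a bijection from
\`D(A A*) = {y ∈ D(A*) : A* y ∈ D(A)}\` onto \`Y\` with bounded inverse. -/
def InResAAs (A : X →ₗ.[ℝ] Y) (mu : ℝ) : Prop :=
  (∀ g : Y, ∃! y : {v : A.adjoint.domain // A.adjoint v ∈ A.domain},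
      A ⟨A.adjoint y.1, y.2⟩ - mu • (y.1 : Y) = g) ∧
  ∃ c : ℝ, 0 < c ∧ ∀ y : {v : A.adjoint.domain // A.adjoint v ∈ A.domain},
      ‖(y.1 : Y)‖ ≤ c * ‖A ⟨A.adjoint y.1, y.2⟩ - mu • (y.1 : Y)‖

/-- The orthogonal projection of `(f, g)` onto the graph of a
closed operator `A`, written out in terms of `A` and its adjoint. -/
lemma exists_graph_projection (A : X →ₗ.[ℝ] Y) (hdense : Dense (A.domain : Set X))
    (hclosed : A.IsClosed) (f : X) (g : Y) :
    ∃ (u : A.domain) (h : A u - g ∈ A.adjoint.domain), A.adjoint ⟨A u - g, h⟩ = f - u := by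
  let G : Submodule ℝ (WithLp 2 (X × Y)) :=
    A.graph.comap (WithLp.linearEquiv 2 ℝ (X × Y)).toLinearMap
  have hG : IsClosed (G : Set (WithLp 2 (X × Y))) :=
    IsClosed.preimage (WithLp.prod_continuous_ofLp 2 X Y) hclosed
  have : CompleteSpace G := hG.completeSpace_coe
  obtain ⟨p, hp, q, hq, hpq⟩ := G.exists_add_mem_mem_orthogonal (WithLp.toLp 2 (f, g))
  obtain ⟨u, hu₁, hu₂⟩ := A.mem_graph_iff.1 (show p.ofLp ∈ A.graph from hp)
  have hf : f = u + q.fst := by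
    rw [hu₁]; exact congrArg (fun z => (WithLp.ofLp z).1) hpq
  have hg : g = A u + q.snd := by
    rw [hu₂]; exact congrArg (fun z => (WithLp.ofLp z).2) hpq
  have key (a : A.domain) : ⟪f - u, (a : X)⟫_ℝ = ⟪A u - g, A a⟫_ℝ := by
    have h := (G.mem_orthogonal q).1 hq (WithLp.toLp 2 ((a : X), A a)) (A.mem_graph a)
    rw [WithLp.prod_inner_apply] at h
    change ⟪(a : X), q.fst⟫_ℝ + ⟪A a, q.snd⟫_ℝ = 0 at h
    rw [hf, hg, add_sub_cancel_left, sub_add_cancel_left, inner_neg_left,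
      real_inner_comm, real_inner_comm (A a)]
    linarith
  exact ⟨u, A.mem_adjoint_domain_of_exists _ ⟨f - u, key⟩, A.adjoint_apply_eq hdense _ key⟩

section Regular

variable {E F : Type*} [NormedAddCommGroup E] [InnerProductSpace ℝ E]
  [NormedAddCommGroup F] [InnerProductSpace ℝ F]

/-- `lam` is a regular value of the block operator `(x, y) ↦ (B y, A x)`. -/
def BlockRegular (A : E →ₗ.[ℝ] F) (B : F →ₗ.[ℝ] E) (lam : ℝ) : Prop :=
  (∀ f g, ∃ (x : A.domain) (y : B.domain),
    B y - lam • (x : E) = f ∧ A x - lam • (y : F) = g) ∧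
  ∃ c : ℝ, 0 < c ∧ ∀ (x : A.domain) (y : B.domain),
    ‖(x : E)‖ + ‖(y : F)‖ ≤ c * (‖B y - lam • (x : E)‖ + ‖A x - lam • (y : F)‖)

/-- `mu` is a regular value of the composition `B A`. -/
def CompRegular (A : E →ₗ.[ℝ] F) (B : F →ₗ.[ℝ] E) (mu : ℝ) : Prop :=
  (∀ f, ∃ (x : A.domain) (h : A x ∈ B.domain), B ⟨A x, h⟩ - mu • (x : E) = f) ∧
  ∃ c : ℝ, 0 < c ∧ ∀ (x : A.domain) (h : A x ∈ B.domain),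
    ‖(x : E)‖ ≤ c * ‖B ⟨A x, h⟩ - mu • (x : E)‖

lemma BlockRegular.swap {A : E →ₗ.[ℝ] F} {B : F →ₗ.[ℝ] E} {lam : ℝ}
    (h : BlockRegular A B lam) : BlockRegular B A lam := by
  obtain ⟨hsurj, c, hc, hbd⟩ := h
  refine ⟨fun f g => ?_, c, hc, fun y x => ?_⟩
  · obtain ⟨x, y, h₁, h₂⟩ := hsurj g f
    exact ⟨y, x, h₂, h₁⟩
  · rw [add_comm, add_comm ‖_ - _‖]
    exact hbd x y

lemma BlockRegular.compRegular {A : E →ₗ.[ℝ] F} {B : F →ₗ.[ℝ] E} {lam : ℝ} (hlam : lam ≠ 0)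
    (h : BlockRegular A B lam) : CompRegular A B (lam ^ 2) := by
  obtain ⟨hsurj, c, hc, hbd⟩ := h
  refine ⟨fun f => ?_, c * |lam⁻¹|, by positivity, fun x hx => ?_⟩
  · obtain ⟨x, y, h₁, h₂⟩ := hsurj (lam⁻¹ • f) 0
    have hAx : A x = lam • (y : F) := sub_eq_zero.1 h₂
    have hx : A x ∈ B.domain := hAx ▸ B.domain.smul_mem lam y.2
    have hB : B ⟨A x, hx⟩ = lam • B y := by
      rw [← B.map_smul]; exact congrArg B (Subtype.ext hAx)
    refine ⟨x, hx, ?_⟩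
    rw [hB, pow_two, mul_smul, ← smul_sub, h₁, smul_inv_smul₀ hlam]
  · have h := hbd x (lam⁻¹ • ⟨A x, hx⟩)
    have h₁ : B (lam⁻¹ • ⟨A x, hx⟩) - lam • (x : E) =
        lam⁻¹ • (B ⟨A x, hx⟩ - lam ^ 2 • (x : E)) := by
      rw [B.map_smul, smul_sub, smul_smul]
      congr 2
      field_simp
    have h₂ : A x - lam • ((lam⁻¹ • (⟨A x, hx⟩ : B.domain) : B.domain) : F) = 0 := by
      simp [smul_inv_smul₀ hlam]
    rw [h₁, h₂, norm_zero, add_zero, norm_smul, Real.norm_eq_abs, ← mul_assoc] at h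
    exact (le_add_of_nonneg_right (norm_nonneg _)).trans h

/-- The converse of `BlockRegular.compRegular`, provided that `B A + 1` is onto in the weak sense
that `A u - g ∈ D(B)` and `B (A u - g) = - u` is solvable for every `g`. -/
lemma CompRegular.blockRegular {A : E →ₗ.[ℝ] F} {B : F →ₗ.[ℝ] E} {lam : ℝ} (hlam : lam ≠ 0)
    (hBA : B.IsFormalAdjoint A)
    (hweak : ∀ g, ∃ (u : A.domain) (h : A u - g ∈ B.domain), B ⟨A u - g, h⟩ = -(u : E))
    (h : CompRegular A B (lam ^ 2)) : BlockRegular A B lam := by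
  obtain ⟨hsurj, c, hc, hbd⟩ := h
  have hl : 0 < |lam| := abs_pos.2 hlam
  constructor
  · intro f g
    obtain ⟨u, hu, hBu⟩ := hweak g
    obtain ⟨v, hv, hBv⟩ := hsurj (lam • f + (u : E) + lam ^ 2 • (u : E))
    refine ⟨u + v, lam⁻¹ • (⟨A u - g, hu⟩ + ⟨A v, hv⟩), ?_, ?_⟩
    · rw [B.map_smul, B.map_add, hBu, sub_eq_iff_eq_add.1 hBv, Submodule.coe_add]
      match_scalars <;> field_simp <;> ring
    · rw [A.map_add, Submodule.coe_smul, smul_inv_smul₀ hlam]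
      change A u + A v - (A u - g + A v) = g
      abel
  · obtain ⟨K, hK, hxK⟩ : ∃ K : ℝ, 0 < K ∧ ∀ (x : A.domain) (y : B.domain),
        ‖(x : E)‖ ≤ K * (‖B y - lam • (x : E)‖ + ‖A x - lam • (y : F)‖) := by
      refine ⟨1 + c * (|lam| + (1 + lam ^ 2)), by positivity, fun x y => ?_⟩
      obtain ⟨f, hf⟩ : ∃ f, f = B y - lam • (x : E) := ⟨_, rfl⟩
      obtain ⟨g, hg⟩ : ∃ g, g = A x - lam • (y : F) := ⟨_, rfl⟩
      obtain ⟨u, hu, hBu⟩ := hweak g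
      have hug : ‖(u : E)‖ ≤ ‖g‖ := by
        have h := hBA ⟨A u - g, hu⟩ u
        rw [hBu] at h
        simp only [inner_neg_left, inner_sub_left, real_inner_self_eq_norm_sq] at h
        have := real_inner_le_norm g (A u)
        refine abs_le_of_sq_le_sq' ?_ (norm_nonneg g) |>.2
        nlinarith [sq_nonneg (‖g‖ - ‖A u‖), sq_nonneg ‖A u‖, sq_nonneg ‖g‖]
      have hA : A (x - u) = ((lam • y - ⟨A u - g, hu⟩ : B.domain) : F) := by
        rw [A.map_sub]
        change A x - A u = lam • (y : F) - (A u - g)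
        rw [eq_add_of_sub_eq hg.symm]
        abel
      have hv : A (x - u) ∈ B.domain := hA ▸ Subtype.prop _
      have hBv : B ⟨A (x - u), hv⟩ = lam • B y + (u : E) := by
        rw [show (⟨A (x - u), hv⟩ : B.domain) = lam • y - ⟨A u - g, hu⟩ from Subtype.ext hA,
          B.map_sub, B.map_smul, hBu, sub_neg_eq_add]
      have hres : B ⟨A (x - u), hv⟩ - lam ^ 2 • ((x - u : A.domain) : E) =
          lam • f + (1 + lam ^ 2) • (u : E) := by
        rw [hBv, Submodule.coe_sub, hf]
        module
      have h₁ := hbd (x - u) hv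
      rw [hres] at h₁
      have h₂ : ‖lam • f + (1 + lam ^ 2) • (u : E)‖ ≤
          |lam| * ‖f‖ + (1 + lam ^ 2) * ‖(u : E)‖ := by
        refine (norm_add_le _ _).trans_eq ?_
        rw [norm_smul, norm_smul, Real.norm_eq_abs, Real.norm_of_nonneg (by positivity)]
      have h₃ : ‖(x : E)‖ ≤ ‖(u : E)‖ + ‖((x - u : A.domain) : E)‖ := by
        rw [Submodule.coe_sub]
        exact norm_le_norm_add_norm_sub' _ _
      rw [← hf, ← hg]
      calc ‖(x : E)‖ ≤ ‖g‖ + c * (|lam| * ‖f‖ + (1 + lam ^ 2) * ‖g‖) := by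
            refine h₃.trans (add_le_add hug (h₁.trans ?_))
            gcongr
            exact h₂.trans (by gcongr)
        _ ≤ ‖g‖ + c * (|lam| * ‖f‖ + (1 + lam ^ 2) * ‖g‖) +
            (‖f‖ + c * (|lam| * ‖g‖ + (1 + lam ^ 2) * ‖f‖)) :=
          le_add_of_nonneg_right (by positivity)
        _ = _ := by ring
    refine ⟨K + (K + |lam|⁻¹), by positivity, fun x y => ?_⟩
    have hx := hxK x y
    obtain ⟨f, hf⟩ : ∃ f, f = B y - lam • (x : E) := ⟨_, rfl⟩
    obtain ⟨g, hg⟩ : ∃ g, g = A x - lam • (y : F) := ⟨_, rfl⟩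
    have hsym := hBA y x
    rw [← hf, ← hg] at hx ⊢
    rw [eq_add_of_sub_eq hf.symm, eq_add_of_sub_eq hg.symm] at hsym
    simp only [inner_add_left, inner_add_right, inner_smul_left, inner_smul_right,
      real_inner_self_eq_norm_sq, conj_trivial] at hsym
    obtain ⟨s, hs⟩ : ∃ s, s = ‖f‖ + ‖g‖ := ⟨_, rfl⟩
    have hs0 : 0 ≤ s := hs ▸ by positivity
    rw [← hs] at hx ⊢
    have h₁ : |lam| * ‖(y : F)‖ ^ 2 ≤
        |lam| * ‖(x : E)‖ ^ 2 + ‖f‖ * ‖(x : E)‖ + ‖(y : F)‖ * ‖g‖ := by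
      have hy : lam * ‖(y : F)‖ ^ 2 =
          lam * ‖(x : E)‖ ^ 2 + ⟪f, (x : E)⟫_ℝ - ⟪(y : F), g⟫_ℝ := by linarith
      calc |lam| * ‖(y : F)‖ ^ 2 = |lam * ‖(y : F)‖ ^ 2| := by simp [abs_mul]
        _ ≤ |lam * ‖(x : E)‖ ^ 2| + |⟪f, (x : E)⟫_ℝ| + |⟪(y : F), g⟫_ℝ| := by
          rw [hy]
          exact (abs_sub _ _).trans (by gcongr; exact abs_add_le _ _)
        _ ≤ _ := by
          rw [abs_mul, abs_of_nonneg (sq_nonneg ‖(x : E)‖)]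
          gcongr
          exacts [abs_real_inner_le_norm _ _, abs_real_inner_le_norm _ _]
    have h₂ : |lam| * ‖(y : F)‖ ^ 2 ≤ |lam| * (K * s) ^ 2 + s * (K * s) + ‖(y : F)‖ * s := by
      refine h₁.trans ?_
      gcongr
      exacts [by simp [hs], by simp [hs]]
    have hy : ‖(y : F)‖ ≤ (K + |lam|⁻¹) * s := by
      by_contra! hlt
      have h₃ : |lam| * (K * s) < |lam| * ‖(y : F)‖ - s := by
        have := mul_lt_mul_of_pos_left hlt hl
        rw [← mul_assoc, mul_add, mul_inv_cancel₀ hl.ne'] at this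
        linarith
      have h₄ : (K + |lam|⁻¹) * s * (|lam| * (K * s)) <
          ‖(y : F)‖ * (|lam| * ‖(y : F)‖ - s) :=
        mul_lt_mul'' hlt h₃ (by positivity) (by positivity)
      have h₅ : (K + |lam|⁻¹) * s * (|lam| * (K * s)) = |lam| * (K * s) ^ 2 + s * (K * s) := by
        field_simp
      nlinarith
    linarith

lemma inResM_iff_blockRegular [CompleteSpace E] (A : E →ₗ.[ℝ] F) (lam : ℝ) :
    InResM A lam ↔ BlockRegular A A.adjoint lam := by
  have sqrt_le (a b : ℝ) (ha : 0 ≤ a) (hb : 0 ≤ b) : √(a ^ 2 + b ^ 2) ≤ a + b :=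
    Real.sqrt_le_iff.2 ⟨by positivity, by nlinarith [mul_nonneg ha hb]⟩
  have le_sqrt (a b : ℝ) : a + b ≤ 2 * √(a ^ 2 + b ^ 2) := by
    have ha : a ≤ √(a ^ 2 + b ^ 2) := Real.le_sqrt_of_sq_le (by nlinarith [sq_nonneg b])
    have hb : b ≤ √(a ^ 2 + b ^ 2) := Real.le_sqrt_of_sq_le (by nlinarith [sq_nonneg a])
    linarith
  constructor
  · rintro ⟨hbij, c, hc, hbd⟩
    refine ⟨fun f g => ?_, 2 * c, by positivity, fun x y => ?_⟩
    · obtain ⟨z, hz, -⟩ := hbij (f, g)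
      exact ⟨⟨z.1.1, z.2.1⟩, ⟨z.1.2, z.2.2⟩, (Prod.mk.inj hz).1, (Prod.mk.inj hz).2⟩
    · have h := hbd ⟨((x : E), (y : F)), x.2, y.2⟩
      calc ‖(x : E)‖ + ‖(y : F)‖ ≤ 2 * √(‖(x : E)‖ ^ 2 + ‖(y : F)‖ ^ 2) := le_sqrt _ _
        _ ≤ 2 * (c * (‖A.adjoint y - lam • (x : E)‖ + ‖A x - lam • (y : F)‖)) := by
          gcongr
          refine h.trans ?_
          gcongr
          exact sqrt_le _ _ (norm_nonneg _) (norm_nonneg _)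
        _ = _ := by ring
  · rintro ⟨hsurj, c, hc, hbd⟩
    refine ⟨fun w => ?_, c * 2, by positivity, fun z => ?_⟩
    · obtain ⟨x, y, h₁, h₂⟩ := hsurj w.1 w.2
      refine ⟨⟨((x : E), (y : F)), x.2, y.2⟩, Prod.ext h₁ h₂, fun z hz => ?_⟩
      have hz₁ := congrArg Prod.fst hz
      have hz₂ := congrArg Prod.snd hz
      dsimp only at hz₁ hz₂
      have h := hbd (⟨z.1.1, z.2.1⟩ - x) (⟨z.1.2, z.2.2⟩ - y)
      rw [LinearPMap.map_sub, LinearPMap.map_sub, Submodule.coe_sub, Submodule.coe_sub,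
        smul_sub, smul_sub, sub_sub_sub_comm _ _ (lam • z.1.1),
        sub_sub_sub_comm _ _ (lam • z.1.2), h₁, h₂, hz₁, hz₂, sub_self, sub_self, norm_zero, norm_zero, add_zero, mul_zero] at h
      dsimp only at h
      have n₁ := norm_nonneg (z.1.1 - (x : E))
      have n₂ := norm_nonneg (z.1.2 - (y : F))
      exact Subtype.ext (Prod.ext (sub_eq_zero.1 (norm_eq_zero.1 (by linarith)))
        (sub_eq_zero.1 (norm_eq_zero.1 (by linarith))))
    · refine (sqrt_le _ _ (norm_nonneg _) (norm_nonneg _)).trans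
        ((hbd ⟨z.1.1, z.2.1⟩ ⟨z.1.2, z.2.2⟩).trans ?_)
      rw [mul_assoc]
      gcongr
      exact le_sqrt _ _

/-- `CompRegular A B mu` says that `B A - mu` is a bijection with bounded inverse. -/
lemma compRegular_iff (A : E →ₗ.[ℝ] F) (B : F →ₗ.[ℝ] E) (mu : ℝ) :
    CompRegular A B mu ↔
      (∀ f : E, ∃! x : {u : A.domain // A u ∈ B.domain},
        B ⟨A x.1, x.2⟩ - mu • (x.1 : E) = f) ∧
      ∃ c : ℝ, 0 < c ∧ ∀ x : {u : A.domain // A u ∈ B.domain},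
        ‖(x.1 : E)‖ ≤ c * ‖B ⟨A x.1, x.2⟩ - mu • (x.1 : E)‖ := by
  constructor
  · rintro ⟨hsurj, c, hc, hbd⟩
    refine ⟨fun f => ?_, c, hc, fun x => hbd x.1 x.2⟩
    obtain ⟨x, hx, hf⟩ := hsurj f
    refine ⟨⟨x, hx⟩, hf, fun z hz => ?_⟩
    have hA : A (z.1 - x) = ((⟨A z.1, z.2⟩ - ⟨A x, hx⟩ : B.domain) : F) := A.map_sub _ _
    have hv : A (z.1 - x) ∈ B.domain := hA ▸ Subtype.prop _
    have h := hbd (z.1 - x) hv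
    rw [show (⟨A (z.1 - x), hv⟩ : B.domain) = ⟨A z.1, z.2⟩ - ⟨A x, hx⟩ from Subtype.ext hA,
      LinearPMap.map_sub, Submodule.coe_sub, smul_sub, sub_sub_sub_comm, hf, hz, sub_self,
      norm_zero, mul_zero] at h
    exact Subtype.ext (Subtype.ext (sub_eq_zero.1 (norm_le_zero_iff.1 h)))
  · rintro ⟨hbij, c, hc, hbd⟩
    refine ⟨fun f => ?_, c, hc, fun x hx => hbd ⟨x, hx⟩⟩
    obtain ⟨x, hx, -⟩ := hbij f
    exact ⟨x.1, x.2, hx⟩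

end Regular

/-- For nonzero real `lam`: `lam` belongs to the resolvent set of `M` iff
`lam²` belongs to the resolvent set of `A*A`, iff `lam²` belongs to the resolvent set of
`A A*`. -/
theorem stmt10
    (A : X →ₗ.[ℝ] Y) (hdense : Dense (A.domain : Set X)) (hclosed : A.IsClosed)
    (lam : ℝ) (hlam : lam ≠ 0) :
    (InResM A lam ↔ InResAsA A (lam ^ 2)) ∧ (InResM A lam ↔ InResAAs A (lam ^ 2)) := by
  have hadj := LinearPMap.adjoint_isFormalAdjoint hdense
  rw [inResM_iff_blockRegular]
  refine ⟨Iff.trans ⟨fun h => h.compRegular hlam, fun h => h.blockRegular hlam hadj fun g => ?_⟩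
      (compRegular_iff _ _ _),
    Iff.trans ⟨fun h => h.swap.compRegular hlam,
      fun h => (h.blockRegular hlam hadj.symm fun f => ?_).swap⟩ (compRegular_iff _ _ _)⟩
  · obtain ⟨u, hu, h⟩ := exists_graph_projection A hdense hclosed 0 g
    exact ⟨u, hu, by rw [h, zero_sub]⟩
  · obtain ⟨u, hu, h⟩ := exists_graph_projection A hdense hclosed f 0
    have hAu : A.adjoint ⟨A u - 0, hu⟩ - f = ((-u : A.domain) : X) := by
      rw [h, Submodule.coe_neg]
      abel
    refine ⟨⟨A u - 0, hu⟩, hAu ▸ Subtype.prop _, ?_⟩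
    refine (congrArg A (Subtype.ext hAu)).trans ?_
    change A (-u) = -(A u - 0)
    rw [sub_zero, A.map_neg]
end
end

section
/- Let 𝓐 denote the restriction of A to D(𝓐) := D(A) ∩ closure(R(A*)), regarded as a densely defined operator from the Hilbert space closure(R(A*)) to the Hilbert space closure(R(A)). Then the adjoint of 𝓐 is the restriction of A* to D(A*) ∩ closure(R(A)): that is, y ∈ closure(R(A)) belongs to D(𝓐*) if and only if y ∈ D(A*), and in that case 𝓐* y = A* y (which automatically lies in closure(R(A*))). -/
open scoped InnerProductSpace RealInnerProductSpace

namespace LinearPMap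

variable {𝕜 E F : Type*} [RCLike 𝕜]
  [NormedAddCommGroup E] [InnerProductSpace 𝕜 E] [CompleteSpace E]
  [NormedAddCommGroup F] [InnerProductSpace 𝕜 F]

/-- The orthogonal complement of the range of the adjoint of a closed, densely defined operator
is contained in the kernel of that operator. -/
theorem mk_zero_mem_graph_of_mem_orthogonal_pmRange_adjoint [CompleteSpace F]
    {T : E →ₗ.[𝕜] F} (hT : Dense (T.domain : Set E)) (hc : T.IsClosed) {x : E}
    (hx : x ∈ T.adjoint.pmRangeᗮ) : (x, (0 : F)) ∈ T.graph := by
  set K : Submodule 𝕜 (WithLp 2 (E × F)) :=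
    T.graph.comap (WithLp.linearEquiv 2 𝕜 (E × F)).toLinearMap
  have hKc : _root_.IsClosed (K : Set (WithLp 2 (E × F))) :=
    _root_.IsClosed.preimage (WithLp.prod_continuous_ofLp 2 E F) hc
  have : CompleteSpace K := hKc.completeSpace_coe
  suffices h : WithLp.toLp 2 (x, (0 : F)) ∈ Kᗮᗮ by
    rw [Submodule.orthogonal_orthogonal] at h
    exact h
  rw [Submodule.mem_orthogonal']
  intro p hp
  have hadj : (p.snd, -p.fst) ∈ T.adjoint.graph := by
    rw [adjoint_graph_eq_graph_adjoint hT, Submodule.mem_adjoint_iff]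
    intro a b hab
    have h := (K.mem_orthogonal p).1 hp (WithLp.toLp 2 (a, b)) hab
    rw [WithLp.prod_inner_apply] at h
    simpa [add_comm] using h
  obtain ⟨y, -, hy⟩ := (mem_graph_iff _).1 hadj
  have h := Submodule.inner_left_of_mem_orthogonal
    (show T.adjoint y ∈ T.adjoint.pmRange from ⟨y, rfl⟩) hx
  rw [hy, inner_neg_right, neg_eq_zero] at h
  simpa [WithLp.prod_inner_apply] using h

/-- A functional identity tested on the part of the domain of a closed, densely defined operator
inside the closure of the range of its adjoint extends to the whole domain. -/
theorem inner_eq_of_forall_mem_closure_pmRange_adjoint [CompleteSpace F]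
    {T : E →ₗ.[𝕜] F} (hT : Dense (T.domain : Set E)) (hc : T.IsClosed) {y : F} {w : E}
    (hw : w ∈ T.adjoint.pmRange.topologicalClosure)
    (h : ∀ u : T.domain, (u : E) ∈ T.adjoint.pmRange.topologicalClosure →
      inner 𝕜 (T u) y = inner 𝕜 (u : E) w) (x : T.domain) :
    inner 𝕜 (T x) y = inner 𝕜 (x : E) w := by
  set K := T.adjoint.pmRange.topologicalClosure
  have : CompleteSpace K := (Submodule.isClosed_topologicalClosure _).completeSpace_coe
  obtain ⟨u, hu, n, hn, hx⟩ := K.exists_add_mem_mem_orthogonal (x : E)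
  have hn' : n ∈ T.adjoint.pmRangeᗮ :=
    Submodule.orthogonal_le (Submodule.le_topologicalClosure _) hn
  obtain ⟨n', hn'x, hTn⟩ := (mem_graph_iff _).1
    (mk_zero_mem_graph_of_mem_orthogonal_pmRange_adjoint hT hc hn')
  have hux : ((x - n' : T.domain) : E) = u := by
    rw [Submodule.coe_sub, hn'x, hx, add_sub_cancel_right]
  have hTu : T (x - n') = T x := by rw [map_sub, hTn, sub_zero]
  rw [← hTu, h _ (hux ▸ hu), hux, hx, inner_add_left,
    Submodule.inner_left_of_mem_orthogonal hw hn, add_zero]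

end LinearPMap

/-- Let `𝓐` be the restriction of `A` to `D(A) ∩ closure (R(A*))`, viewed
as a densely defined operator from the Hilbert space `closure (R(A*))` to the Hilbert space
`closure (R(A))`.  Then for `y ∈ closure (R(A))`: `y ∈ D(𝓐*)` (i.e. there is a
`w ∈ closure (R(A*))` with `⟪𝓐 u, y⟫ = ⟪u, w⟫` for all `u ∈ D(𝓐)`) iff `y ∈ D(A*)`,
and in that case `𝓐* y = A* y`: the vector `A* y` lies in `closure (R(A*))` and satisfies
the defining identity of the adjoint of `𝓐`. -/
theorem stmt12
    {X Y : Type*} [NormedAddCommGroup X] [InnerProductSpace ℝ X] [CompleteSpace X]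
    [NormedAddCommGroup Y] [InnerProductSpace ℝ Y] [CompleteSpace Y]
    (A : X →ₗ.[ℝ] Y) (hdense : Dense (A.domain : Set X)) (hclosed : A.IsClosed) :
    ∀ y ∈ closure (A.pmRange : Set Y),
      ((∃ w ∈ closure (A.adjoint.pmRange : Set X),
          ∀ u : A.domain, (u : X) ∈ closure (A.adjoint.pmRange : Set X) →
            ⟪A u, y⟫ = ⟪(u : X), w⟫) ↔ y ∈ A.adjoint.domain) ∧
      ∀ hy : y ∈ A.adjoint.domain,
        A.adjoint ⟨y, hy⟩ ∈ closure (A.adjoint.pmRange : Set X) ∧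
        ∀ u : A.domain, (u : X) ∈ closure (A.adjoint.pmRange : Set X) →
          ⟪A u, y⟫ = ⟪(u : X), A.adjoint ⟨y, hy⟩⟫ := by
  intro y _
  have formal (hy : y ∈ A.adjoint.domain) (u : A.domain) :
      ⟪A u, y⟫ = ⟪(u : X), A.adjoint ⟨y, hy⟩⟫ :=
    (LinearPMap.adjoint_isFormalAdjoint hdense).symm u ⟨y, hy⟩
  have range_mem (hy : y ∈ A.adjoint.domain) :
      A.adjoint ⟨y, hy⟩ ∈ closure (A.adjoint.pmRange : Set X) :=
    subset_closure ⟨⟨y, hy⟩, rfl⟩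
  refine ⟨⟨?_, fun hy => ⟨_, range_mem hy, fun u _ => formal hy u⟩⟩,
    fun hy => ⟨range_mem hy, fun u _ => formal hy u⟩⟩
  rintro ⟨w, hw, h⟩
  refine LinearPMap.mem_adjoint_domain_of_exists y ⟨w, fun x => ?_⟩
  rw [real_inner_comm, real_inner_comm (A x)]
  exact (LinearPMap.inner_eq_of_forall_mem_closure_pmRange_adjoint hdense hclosed hw h x).symm
end

section
/- Suppose the embedding D(A) ∩ closure(R(A*)) ↪ X is compact. Then there exists a constant c_M > 0 such that ‖z‖_Z ≤ c_M ‖M z‖_Z for every z ∈ D(M) ∩ closure(R(M)); equivalently, ‖x‖_X² + ‖y‖_Y² ≤ c_M² (‖A* y‖_X² + ‖A x‖_Y²) for all x ∈ D(A) ∩ closure(R(A*)) and y ∈ D(A*) ∩ closure(R(A)). -/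
open scoped InnerProductSpace RealInnerProductSpace

/-- For a closed densely defined operator, the orthogonal complement of the range of the adjoint
is contained in the kernel. -/
theorem linearPMap_mem_graph_zero_of_mem_orthogonal_adjoint_range
    {X Y : Type*} [NormedAddCommGroup X] [InnerProductSpace ℝ X] [CompleteSpace X]
    [NormedAddCommGroup Y] [InnerProductSpace ℝ Y] [CompleteSpace Y]
    {A : X →ₗ.[ℝ] Y} (hdense : Dense (A.domain : Set X)) (hclosed : A.IsClosed)
    {x : X} (hx : x ∈ A.adjoint.pmRangeᗮ) : (x, (0 : Y)) ∈ A.graph := by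
  let G : Submodule ℝ (WithLp 2 (X × Y)) :=
    A.graph.comap (WithLp.linearEquiv 2 ℝ (X × Y)).toLinearMap
  have hG : IsClosed (G : Set (WithLp 2 (X × Y))) :=
    IsClosed.preimage (WithLp.prod_continuous_ofLp 2 X Y) hclosed
  have : CompleteSpace G := hG.completeSpace_coe
  suffices h : WithLp.toLp 2 (x, (0 : Y)) ∈ Gᗮᗮ by
    rw [Submodule.orthogonal_orthogonal] at h
    exact h
  rw [Submodule.mem_orthogonal]
  intro p hp
  have hp' : ∀ u : A.domain, ⟪-p.fst, (u : X)⟫ = ⟪p.snd, A u⟫ := by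
    intro u
    have h := (Submodule.mem_orthogonal' G p).1 hp (WithLp.toLp 2 ((u : X), A u))
      (A.mem_graph u)
    rw [WithLp.prod_inner_apply] at h
    rw [inner_neg_left]
    exact neg_eq_of_add_eq_zero_right h
  have hmem : p.snd ∈ A.adjoint.domain := A.mem_adjoint_domain_of_exists _ ⟨_, hp'⟩
  have hval : A.adjoint ⟨p.snd, hmem⟩ = -p.fst := A.adjoint_apply_eq hdense _ hp'
  have h0 : ⟪-p.fst, x⟫ = 0 :=
    (Submodule.mem_orthogonal _ _).1 hx _ ⟨⟨p.snd, hmem⟩, hval⟩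
  rw [inner_neg_left, neg_eq_zero] at h0
  simpa using h0

/-- Elements of the kernel are orthogonal to the closure of the range of the adjoint. -/
theorem linearPMap_eq_zero_of_mem_closure_adjoint_range
    {X Y : Type*} [NormedAddCommGroup X] [InnerProductSpace ℝ X] [CompleteSpace X]
    [NormedAddCommGroup Y] [InnerProductSpace ℝ Y]
    {A : X →ₗ.[ℝ] Y} (hdense : Dense (A.domain : Set X)) {u : A.domain} (hu : A u = 0)
    (hmem : (u : X) ∈ closure (A.adjoint.pmRange : Set X)) : (u : X) = 0 := by
  have horth : (u : X) ∈ A.adjoint.pmRangeᗮ := by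
    rw [Submodule.mem_orthogonal]
    rintro _ ⟨v, rfl⟩
    have h := A.adjoint_isFormalAdjoint hdense v u
    rw [hu, inner_zero_right] at h
    exact h
  rw [← Submodule.orthogonal_closure] at horth
  exact inner_self_eq_zero.1 ((Submodule.mem_orthogonal _ _).1 horth _ hmem)

/-- The Poincaré-type estimate for `A` on `D(A) ∩ closure (R(A*))`. -/
theorem linearPMap_exists_norm_le_of_compact_embedding
    {X Y : Type*} [NormedAddCommGroup X] [InnerProductSpace ℝ X] [CompleteSpace X]
    [NormedAddCommGroup Y] [InnerProductSpace ℝ Y]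
    {A : X →ₗ.[ℝ] Y} (hdense : Dense (A.domain : Set X)) (hclosed : A.IsClosed)
    (hcomp : ∀ u : ℕ → A.domain,
      (∀ n, (u n : X) ∈ closure (A.adjoint.pmRange : Set X)) →
      (∃ C : ℝ, ∀ n, ‖(u n : X)‖ ^ 2 + ‖A (u n)‖ ^ 2 ≤ C) →
      ∃ (x : X) (φ : ℕ → ℕ), StrictMono φ ∧
        Filter.Tendsto (fun n => (u (φ n) : X)) Filter.atTop (nhds x)) :
    ∃ c : ℝ, 0 < c ∧ ∀ u : A.domain, (u : X) ∈ closure (A.adjoint.pmRange : Set X) →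
      ‖(u : X)‖ ≤ c * ‖A u‖ := by
  by_contra! hcon
  have hunit : ∀ n : ℕ, ∃ u : A.domain, (u : X) ∈ closure (A.adjoint.pmRange : Set X) ∧
      ‖(u : X)‖ = 1 ∧ ‖A u‖ ≤ 1 / ((n : ℝ) + 1) := by
    intro n
    obtain ⟨w, hw, hlt⟩ := hcon ((n : ℝ) + 1) (by positivity)
    have hpos : 0 < ‖(w : X)‖ := lt_of_le_of_lt (by positivity) hlt
    refine ⟨‖(w : X)‖⁻¹ • w, ?_, ?_, ?_⟩
    · exact A.adjoint.pmRange.topologicalClosure.smul_mem _ hw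
    · rw [Submodule.coe_smul, norm_smul, norm_inv, norm_norm, inv_mul_cancel₀ hpos.ne']
    · rw [LinearPMap.map_smul, norm_smul, norm_inv, norm_norm, inv_mul_eq_div,
        div_le_div_iff₀ hpos (by positivity)]
      linarith
  choose u hu hnorm hA using hunit
  obtain ⟨x, φ, hφ, hlim⟩ := hcomp u hu ⟨2, fun n => by
    have h1 : ‖A (u n)‖ ≤ 1 := (hA n).trans <| by
      rw [div_le_one (by positivity)]
      linarith [(Nat.cast_nonneg n : (0 : ℝ) ≤ n)]
    rw [hnorm]
    nlinarith [norm_nonneg (A (u n))]⟩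
  have hAlim : Filter.Tendsto (fun n => A (u (φ n))) Filter.atTop (nhds 0) :=
    (squeeze_zero_norm hA tendsto_one_div_add_atTop_nhds_zero_nat).comp hφ.tendsto_atTop
  have hgraph : (x, (0 : Y)) ∈ A.graph :=
    IsClosed.mem_of_tendsto hclosed (hlim.prodMk_nhds hAlim)
      (Filter.Eventually.of_forall fun n => A.mem_graph (u (φ n)))
  obtain ⟨w, hw : (w : X) = x, hAw⟩ := A.mem_graph_iff.1 hgraph
  have hxmem : x ∈ closure (A.adjoint.pmRange : Set X) :=
    isClosed_closure.mem_of_tendsto hlim (Filter.Eventually.of_forall fun n => hu (φ n))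
  have hx0 : (w : X) = 0 :=
    linearPMap_eq_zero_of_mem_closure_adjoint_range hdense hAw (by rw [hw]; exact hxmem)
  have hx1 : ‖x‖ = 1 :=
    tendsto_nhds_unique hlim.norm (by simp only [hnorm]; exact tendsto_const_nhds)
  rw [← hw, hx0, norm_zero] at hx1
  exact zero_ne_one hx1

/-- An estimate for `A` on `D(A) ∩ closure (R(A*))` carries over, with the same constant, to the
adjoint on `D(A*) ∩ closure (R(A))`. -/
theorem linearPMap_norm_le_adjoint_of_norm_le
    {X Y : Type*} [NormedAddCommGroup X] [InnerProductSpace ℝ X] [CompleteSpace X]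
    [NormedAddCommGroup Y] [InnerProductSpace ℝ Y] [CompleteSpace Y]
    {A : X →ₗ.[ℝ] Y} (hdense : Dense (A.domain : Set X)) (hclosed : A.IsClosed) {c : ℝ}
    (hc : ∀ u : A.domain, (u : X) ∈ closure (A.adjoint.pmRange : Set X) →
      ‖(u : X)‖ ≤ c * ‖A u‖)
    (v : A.adjoint.domain) (hv : (v : Y) ∈ closure (A.pmRange : Set Y)) :
    ‖(v : Y)‖ ≤ c * ‖A.adjoint v‖ := by
  have hrange : ∀ u : A.domain, ⟪(v : Y), A u⟫ ≤ c * ‖A.adjoint v‖ * ‖A u‖ := by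
    intro u
    obtain ⟨y, hy, z, hz, hyz⟩ :=
      A.adjoint.pmRange.topologicalClosure.exists_add_mem_mem_orthogonal (u : X)
    rw [Submodule.orthogonal_closure] at hz
    obtain ⟨w, hw, hAw⟩ := A.mem_graph_iff.1
      (linearPMap_mem_graph_zero_of_mem_orthogonal_adjoint_range hdense hclosed hz)
    have hy' : ((u - w : A.domain) : X) = y := by
      rw [Submodule.coe_sub, hw, hyz]
      exact add_sub_cancel_right y z
    have hAu : A (u - w) = A u := by
      rw [LinearPMap.map_sub, hAw]
      exact sub_zero _
    have hle := hc (u - w) (by rw [hy']; exact hy)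
    rw [hAu] at hle
    calc ⟪(v : Y), A u⟫ = ⟪A.adjoint v, ((u - w : A.domain) : X)⟫ := by
          rw [A.adjoint_isFormalAdjoint hdense v (u - w), hAu]
      _ ≤ ‖A.adjoint v‖ * ‖((u - w : A.domain) : X)‖ := real_inner_le_norm _ _
      _ ≤ ‖A.adjoint v‖ * (c * ‖A u‖) := by gcongr
      _ = c * ‖A.adjoint v‖ * ‖A u‖ := by ring
  have hclos : ∀ y ∈ closure (A.pmRange : Set Y), ⟪(v : Y), y⟫ ≤ c * ‖A.adjoint v‖ * ‖y‖ := by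
    intro y hy
    refine closure_minimal (t := {y : Y | ⟪(v : Y), y⟫ ≤ c * ‖A.adjoint v‖ * ‖y‖}) ?_
      (isClosed_le (by fun_prop) (by fun_prop)) hy
    rintro _ ⟨u, rfl⟩
    exact hrange u
  have hself := hclos v hv
  rw [real_inner_self_eq_norm_mul_norm] at hself
  rcases (norm_nonneg (v : Y)).eq_or_lt with h0 | hpos
  · have hv0 : v = 0 := Subtype.ext (norm_eq_zero.1 h0.symm)
    rw [hv0, LinearPMap.map_zero]
    simp
  · exact le_of_mul_le_mul_right hself hpos

/-- If the embedding `D(A) ∩ closure (R(A*)) ↪ X` is compact, then there is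
a constant `c > 0` with `‖z‖_Z ≤ c * ‖M z‖_Z` for `z ∈ D(M) ∩ closure (R(M))`, i.e.
`‖x‖² + ‖y‖² ≤ c² * (‖A* y‖² + ‖A x‖²)` for all `x ∈ D(A) ∩ closure (R(A*))` and
`y ∈ D(A*) ∩ closure (R(A))`. -/
theorem stmt13
    {X Y : Type*} [NormedAddCommGroup X] [InnerProductSpace ℝ X] [CompleteSpace X]
    [NormedAddCommGroup Y] [InnerProductSpace ℝ Y] [CompleteSpace Y]
    (A : X →ₗ.[ℝ] Y) (hdense : Dense (A.domain : Set X)) (hclosed : A.IsClosed)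
    (hcomp : ∀ u : ℕ → A.domain,
      (∀ n, (u n : X) ∈ closure (A.adjoint.pmRange : Set X)) →
      (∃ C : ℝ, ∀ n, ‖(u n : X)‖ ^ 2 + ‖A (u n)‖ ^ 2 ≤ C) →
      ∃ (x : X) (φ : ℕ → ℕ), StrictMono φ ∧
        Filter.Tendsto (fun n => (u (φ n) : X)) Filter.atTop (nhds x)) :
    ∃ c : ℝ, 0 < c ∧ ∀ (u : A.domain) (v : A.adjoint.domain),
      (u : X) ∈ closure (A.adjoint.pmRange : Set X) →
      (v : Y) ∈ closure (A.pmRange : Set Y) →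
      ‖(u : X)‖ ^ 2 + ‖(v : Y)‖ ^ 2 ≤ c ^ 2 * (‖A.adjoint v‖ ^ 2 + ‖A u‖ ^ 2) := by
  obtain ⟨c, hc0, hc⟩ := linearPMap_exists_norm_le_of_compact_embedding hdense hclosed hcomp
  refine ⟨c, hc0, fun u v hu hv => ?_⟩
  have h1 := pow_le_pow_left₀ (norm_nonneg _) (hc u hu) 2
  have h2 := pow_le_pow_left₀ (norm_nonneg _)
    (linearPMap_norm_le_adjoint_of_norm_le hdense hclosed hc v hv) 2
  rw [mul_pow] at h1 h2
  linarith
end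

section
/- Suppose the embedding D(A) ∩ closure(R(A*)) ↪ X is compact. Then for every nonzero real number λ, the eigenspace N(M − λ) is contained in R(M) and is finite dimensional. -/
open scoped InnerProductSpace RealInnerProductSpace

noncomputable section

variable {X Y : Type*}
  [NormedAddCommGroup X] [InnerProductSpace ℝ X] [CompleteSpace X]
  [NormedAddCommGroup Y] [InnerProductSpace ℝ Y] [CompleteSpace Y]

/-- The eigenspace \`N(M - lam)\` of the block operator \`M (x, y) = (A* y, A x)\` on
\`Z = X × Y\`, as a subset of \`Z\`: all \`(x, y) ∈ D(A) × D(A*)\` with \`A* y = lam • x\` and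
\`A x = lam • y\`. -/
def kerM (A : X →ₗ.[ℝ] Y) (lam : ℝ) : Set (X × Y) :=
  {z | ∃ (hx : z.1 ∈ A.domain) (hy : z.2 ∈ A.adjoint.domain),
    A.adjoint ⟨z.2, hy⟩ = lam • z.1 ∧ A ⟨z.1, hx⟩ = lam • z.2}

/-- The range \`R(M - lam)\` of \`M - lam\` on \`Z = X × Y\`. -/
def ranM (A : X →ₗ.[ℝ] Y) (lam : ℝ) : Set (X × Y) :=
  {w | ∃ (u : A.domain) (v : A.adjoint.domain),
    (A.adjoint v - lam • (u : X), A u - lam • (v : Y)) = w}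

/-- The eigenspace `kerM A lam` as a submodule of `X × Y`. -/
def kerMSubmodule (A : X →ₗ.[ℝ] Y) (lam : ℝ) : Submodule ℝ (X × Y) where
  carrier := kerM A lam
  zero_mem' := ⟨A.domain.zero_mem, A.adjoint.domain.zero_mem, by
    rw [Prod.fst_zero, smul_zero]
    exact A.adjoint.map_zero, by
    rw [Prod.snd_zero, smul_zero]
    exact A.map_zero⟩
  add_mem' := by
    rintro z w ⟨hx, hy, h₁, h₂⟩ ⟨hx', hy', h₁', h₂'⟩
    refine ⟨A.domain.add_mem hx hx', A.adjoint.domain.add_mem hy hy', ?_, ?_⟩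
    · have h := A.adjoint.map_add ⟨z.2, hy⟩ ⟨w.2, hy'⟩
      rw [h₁, h₁', ← smul_add] at h
      exact h
    · have h := A.map_add ⟨z.1, hx⟩ ⟨w.1, hx'⟩
      rw [h₂, h₂', ← smul_add] at h
      exact h
  smul_mem' := by
    rintro c z ⟨hx, hy, h₁, h₂⟩
    refine ⟨A.domain.smul_mem c hx, A.adjoint.domain.smul_mem c hy, ?_, ?_⟩
    · have h := A.adjoint.map_smul c ⟨z.2, hy⟩
      rw [h₁, smul_comm] at h
      exact h
    · have h := A.map_smul c ⟨z.1, hx⟩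
      rw [h₂, smul_comm] at h
      exact h

theorem mem_pmRange_of_eq_smul {E F : Type*} [AddCommGroup E] [Module ℝ E] [AddCommGroup F]
    [Module ℝ F] (T : E →ₗ.[ℝ] F) {lam : ℝ} (hlam : lam ≠ 0) {x : T.domain} {y : F}
    (h : T x = lam • y) : y ∈ T.pmRange := by
  have hmem : lam • y ∈ T.pmRange := ⟨x, h⟩
  exact (Submodule.smul_mem_iff _ hlam).1 hmem

/-- The two components of an eigenvector of `M` for a nonzero eigenvalue have equal norms. -/
theorem norm_snd_eq_norm_fst_of_mem_kerM (A : X →ₗ.[ℝ] Y) (hdense : Dense (A.domain : Set X))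
    {lam : ℝ} (hlam : lam ≠ 0) {z : X × Y} (hz : z ∈ kerM A lam) : ‖z.2‖ = ‖z.1‖ := by
  obtain ⟨hx, hy, h₁, h₂⟩ := hz
  have h := A.adjoint_isFormalAdjoint hdense ⟨z.2, hy⟩ ⟨z.1, hx⟩
  rw [h₁, h₂, real_inner_smul_left, real_inner_smul_right, real_inner_self_eq_norm_sq,
    real_inner_self_eq_norm_sq] at h
  have hsq := mul_left_cancel₀ hlam h
  exact (sq_eq_sq₀ (norm_nonneg _) (norm_nonneg _)).1 hsq.symm

theorem norm_eq_norm_fst_of_mem_kerM (A : X →ₗ.[ℝ] Y) (hdense : Dense (A.domain : Set X))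
    {lam : ℝ} (hlam : lam ≠ 0) {z : X × Y} (hz : z ∈ kerM A lam) : ‖z‖ = ‖z.1‖ := by
  rw [Prod.norm_def, norm_snd_eq_norm_fst_of_mem_kerM A hdense hlam hz, max_self]

theorem finiteDimensional_kerMSubmodule (A : X →ₗ.[ℝ] Y) (hdense : Dense (A.domain : Set X))
    (hcomp : ∀ u : ℕ → A.domain,
      (∀ n, (u n : X) ∈ closure (A.adjoint.pmRange : Set X)) →
      (∃ C : ℝ, ∀ n, ‖(u n : X)‖ ^ 2 + ‖A (u n)‖ ^ 2 ≤ C) →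
      ∃ (x : X) (φ : ℕ → ℕ), StrictMono φ ∧
        Filter.Tendsto (fun n => (u (φ n) : X)) Filter.atTop (nhds x))
    {lam : ℝ} (hlam : lam ≠ 0) : FiniteDimensional ℝ (kerMSubmodule A lam) := by
  by_contra hfin
  obtain ⟨R, f, -, hbound, hsep⟩ := exists_seq_norm_le_one_le_norm_sub (𝕜 := ℝ) hfin
  have hker : ∀ n, (f n : X × Y) ∈ kerM A lam := fun n => (f n).2
  have hnorm : ∀ w : kerMSubmodule A lam, ‖w‖ = ‖(w : X × Y).1‖ := fun w =>
    norm_eq_norm_fst_of_mem_kerM A hdense hlam w.2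
  choose hx hy h₁ h₂ using hker
  obtain ⟨x, φ, hφ, hlim⟩ := hcomp (fun n => ⟨(f n : X × Y).1, hx n⟩)
    (fun n => subset_closure (mem_pmRange_of_eq_smul A.adjoint hlam (h₁ n)))
    ⟨R ^ 2 + (|lam| * R) ^ 2, fun n => by
      have hfst : ‖(f n : X × Y).1‖ ≤ R := hnorm (f n) ▸ hbound n
      rw [h₂ n, norm_smul, Real.norm_eq_abs,
        norm_snd_eq_norm_fst_of_mem_kerM A hdense hlam (f n).2]
      gcongr⟩
  obtain ⟨N, hN⟩ := Metric.cauchySeq_iff.1 hlim.cauchySeq 1 one_pos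
  have hlt := hN N le_rfl (N + 1) N.le_succ
  have hge : 1 ≤ ‖f (φ N) - f (φ (N + 1))‖ := hsep (hφ N.lt_succ_self).ne
  rw [hnorm] at hge
  rw [dist_eq_norm] at hlt
  exact absurd hge (not_le.2 hlt)

/-- Under the compactness of the embedding `D(A) ∩ closure (R(A*)) ↪ X`,
for every nonzero real `lam` the eigenspace `N(M - lam)` is contained in
`R(M) = R(A*) × R(A)` and is finite dimensional (it is contained in the span of finitely
many vectors). -/
theorem stmt14
    (A : X →ₗ.[ℝ] Y) (hdense : Dense (A.domain : Set X)) (hclosed : A.IsClosed)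
    (hcomp : ∀ u : ℕ → A.domain,
      (∀ n, (u n : X) ∈ closure (A.adjoint.pmRange : Set X)) →
      (∃ C : ℝ, ∀ n, ‖(u n : X)‖ ^ 2 + ‖A (u n)‖ ^ 2 ≤ C) →
      ∃ (x : X) (φ : ℕ → ℕ), StrictMono φ ∧
        Filter.Tendsto (fun n => (u (φ n) : X)) Filter.atTop (nhds x))
    (lam : ℝ) (hlam : lam ≠ 0) :
    (∀ z ∈ kerM A lam, z.1 ∈ A.adjoint.pmRange ∧ z.2 ∈ A.pmRange) ∧
    ∃ (n : ℕ) (b : Fin n → X × Y),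
      kerM A lam ⊆ (Submodule.span ℝ (Set.range b) : Set (X × Y)) := by
  refine ⟨fun z ⟨_, _, h₁, h₂⟩ =>
    ⟨mem_pmRange_of_eq_smul A.adjoint hlam h₁, mem_pmRange_of_eq_smul A hlam h₂⟩, ?_⟩
  have := finiteDimensional_kerMSubmodule A hdense hcomp hlam
  obtain ⟨n, b, hb⟩ := Submodule.fg_iff_exists_fin_generating_family.1
    (Module.Finite.iff_fg.1 this)
  exact ⟨n, b, by rw [hb]; exact fun _ hz => hz⟩
end
end

section
/- Suppose the embedding D(A) ∩ closure(R(A*)) ↪ X is compact, and let λ be a nonzero real number. Then there exists a constant c > 0 such that ‖z‖_Z ≤ c ‖(M − λ) z‖_Z for every z ∈ D(M) ∩ closure(R(M)) that is orthogonal to the eigenspace N(M − λ). -/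
open scoped InnerProductSpace RealInnerProductSpace

noncomputable section

variable {X Y : Type*}
  [NormedAddCommGroup X] [InnerProductSpace ℝ X] [CompleteSpace X]
  [NormedAddCommGroup Y] [InnerProductSpace ℝ Y] [CompleteSpace Y]

open Filter Topology

/-- The differences of a null sequence tend to zero. -/
theorem tendsto_sub_prod_of_tendsto_zero {E : Type*} [NormedAddCommGroup E] {w : ℕ → E}
    (hw : Tendsto w atTop (𝓝 0)) :
    Tendsto (fun p : ℕ × ℕ => w p.1 - w p.2) atTop (𝓝 0) := by
  rw [← prod_atTop_atTop_eq]
  simpa using (hw.comp tendsto_fst).sub (hw.comp tendsto_snd)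

namespace LinearPMap

/-- A closed operator maps the limit of a convergent sequence to the limit of its images. -/
theorem IsClosed.exists_apply_eq_of_tendsto_s15 {E F : Type*}
    [NormedAddCommGroup E] [InnerProductSpace ℝ E]
    [NormedAddCommGroup F] [InnerProductSpace ℝ F] {T : E →ₗ.[ℝ] F} (hT : T.IsClosed)
    {u : ℕ → T.domain} {x : E} {y : F} (hu : Tendsto (fun n => (u n : E)) atTop (𝓝 x))
    (hTu : Tendsto (fun n => T (u n)) atTop (𝓝 y)) :
    ∃ hx : x ∈ T.domain, T ⟨x, hx⟩ = y := by
  have hmem : (x, y) ∈ (T.graph : Set (E × F)) :=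
    _root_.IsClosed.mem_of_tendsto hT (hu.prodMk_nhds hTu)
      (Eventually.of_forall fun n => T.mem_graph (u n))
  obtain ⟨z, hz, hTz⟩ := T.mem_graph_iff.mp hmem
  dsimp only at hz hTz
  subst hz
  exact ⟨z.2, hTz⟩

/-- The identity `⟪A u, v⟫ = ⟪u, A* v⟫` expressed through the residuals of `M - lam`. -/
theorem norm_sq_eq_of_residuals {E F : Type*}
    [NormedAddCommGroup E] [InnerProductSpace ℝ E] [CompleteSpace E]
    [NormedAddCommGroup F] [InnerProductSpace ℝ F]
    (A : E →ₗ.[ℝ] F) (hdense : Dense (A.domain : Set E))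
    {lam : ℝ} (hlam : lam ≠ 0) (u : A.domain) (v : A.adjoint.domain) :
    ‖(v : F)‖ ^ 2 = ‖(u : E)‖ ^ 2 +
      lam⁻¹ * (⟪(u : E), A.adjoint v - lam • (u : E)⟫ - ⟪A u - lam • (v : F), (v : F)⟫) := by
  have h : ⟪A u, (v : F)⟫ = ⟪(u : E), A.adjoint v⟫ :=
    (adjoint_isFormalAdjoint hdense).symm u v
  rw [inner_sub_right, inner_sub_left, h, real_inner_smul_right, real_inner_smul_left,
    real_inner_self_eq_norm_sq, real_inner_self_eq_norm_sq]
  field_simp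
  ring

/-- If the residuals of `M - lam` along a bounded sequence `(u n, v n)` tend to zero and `u`
converges, then `v` is a Cauchy sequence. -/
theorem cauchySeq_of_residuals {E F : Type*}
    [NormedAddCommGroup E] [InnerProductSpace ℝ E] [CompleteSpace E]
    [NormedAddCommGroup F] [InnerProductSpace ℝ F]
    (A : E →ₗ.[ℝ] F) (hdense : Dense (A.domain : Set E))
    {lam : ℝ} (hlam : lam ≠ 0) {u : ℕ → A.domain} {v : ℕ → A.adjoint.domain}
    (hu : CauchySeq fun n => (u n : E)) {C : ℝ} (hv : ∀ n, ‖(v n : F)‖ ≤ C)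
    (he : Tendsto (fun n => A.adjoint (v n) - lam • (u n : E)) atTop (𝓝 0))
    (hf : Tendsto (fun n => A (u n) - lam • (v n : F)) atTop (𝓝 0)) :
    CauchySeq fun n => (v n : F) := by
  have hdu : Tendsto (fun p : ℕ × ℕ => (u p.1 : E) - u p.2) atTop (𝓝 0) := by
    rw [tendsto_zero_iff_norm_tendsto_zero]
    simpa only [dist_eq_norm] using cauchySeq_iff_tendsto_dist_atTop_0.mp hu
  have hinner_f : Tendsto (fun p : ℕ × ℕ =>
      ⟪(A (u p.1) - lam • (v p.1 : F)) - (A (u p.2) - lam • (v p.2 : F)),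
        (v p.1 : F) - v p.2⟫) atTop (𝓝 0) := by
    have hbound := (tendsto_sub_prod_of_tendsto_zero hf).norm.mul_const (C + C)
    rw [norm_zero, zero_mul] at hbound
    refine squeeze_zero_norm (fun p => (norm_inner_le_norm _ _).trans ?_) hbound
    gcongr
    exact (norm_sub_le _ _).trans (add_le_add (hv _) (hv _))
  have hsq : Tendsto (fun p : ℕ × ℕ => ‖(v p.1 : F) - v p.2‖ ^ 2) atTop (𝓝 0) := by
    have hlim := (hdu.norm.pow 2).add
      (((hdu.inner (𝕜 := ℝ) (tendsto_sub_prod_of_tendsto_zero he)).sub hinner_f).const_mul lam⁻¹)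
    simp only [norm_zero, inner_zero_left, sub_zero, mul_zero, add_zero, ne_eq,
      OfNat.ofNat_ne_zero, not_false_eq_true, zero_pow] at hlim
    refine hlim.congr fun p => ?_
    have h := A.norm_sq_eq_of_residuals hdense hlam (u p.1 - u p.2) (v p.1 - v p.2)
    rw [map_sub, map_sub, Submodule.coe_sub, Submodule.coe_sub] at h
    rw [h, smul_sub, smul_sub, sub_sub_sub_comm, sub_sub_sub_comm (A (u p.1))]
  rw [cauchySeq_iff_tendsto_dist_atTop_0]
  simpa [dist_eq_norm] using hsq.sqrt

end LinearPMap

/-- Under the compactness assumption there is no sequence of unit vectors in the reduced domain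
of `M`, orthogonal to `N(M - lam)`, along which `M - lam` tends to zero. -/
theorem not_tendsto_residuals_of_orthogonal_kerM
    (A : X →ₗ.[ℝ] Y) (hdense : Dense (A.domain : Set X)) (hclosed : A.IsClosed)
    (hcomp : ∀ u : ℕ → A.domain,
      (∀ n, (u n : X) ∈ closure (A.adjoint.pmRange : Set X)) →
      (∃ C : ℝ, ∀ n, ‖(u n : X)‖ ^ 2 + ‖A (u n)‖ ^ 2 ≤ C) →
      ∃ (x : X) (φ : ℕ → ℕ), StrictMono φ ∧
        Tendsto (fun n => (u (φ n) : X)) atTop (𝓝 x))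
    {lam : ℝ} (hlam : lam ≠ 0) {u : ℕ → A.domain} {v : ℕ → A.adjoint.domain}
    (hmem : ∀ n, (u n : X) ∈ closure (A.adjoint.pmRange : Set X))
    (hnorm : ∀ n, ‖(u n : X)‖ ^ 2 + ‖(v n : Y)‖ ^ 2 = 1)
    (horth : ∀ n, ∀ w ∈ kerM A lam, ⟪(u n : X), w.1⟫ + ⟪(v n : Y), w.2⟫ = 0)
    (he : Tendsto (fun n => A.adjoint (v n) - lam • (u n : X)) atTop (𝓝 0))
    (hf : Tendsto (fun n => A (u n) - lam • (v n : Y)) atTop (𝓝 0)) : False := by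
  have hv : ∀ n, ‖(v n : Y)‖ ≤ 1 := fun n => by
    nlinarith [hnorm n, sq_nonneg ‖(u n : X)‖, norm_nonneg (v n : Y)]
  obtain ⟨C, hC⟩ := (Metric.isBounded_range_of_tendsto _ hf).exists_norm_le
  have hAu : ∀ n, ‖A (u n)‖ ≤ C + |lam| := fun n => by
    have h1 : ‖lam • (v n : Y)‖ ≤ |lam| := by
      rw [norm_smul, Real.norm_eq_abs]
      exact mul_le_of_le_one_right (abs_nonneg _) (hv n)
    have h2 := norm_add_le (A (u n) - lam • (v n : Y)) (lam • (v n : Y))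
    rw [sub_add_cancel] at h2
    linarith [hC _ (Set.mem_range_self n)]
  obtain ⟨x, φ, hφ, hx⟩ := hcomp u hmem ⟨1 + (C + |lam|) ^ 2, fun n => by
    have := pow_le_pow_left₀ (norm_nonneg _) (hAu n) 2
    nlinarith [hnorm n, sq_nonneg ‖(v n : Y)‖]⟩
  have he' := he.comp hφ.tendsto_atTop
  have hf' := hf.comp hφ.tendsto_atTop
  obtain ⟨y, hy⟩ := cauchySeq_tendsto_of_complete
    (A.cauchySeq_of_residuals hdense hlam (u := u ∘ φ) (v := v ∘ φ) hx.cauchySeq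
      (fun n => hv (φ n)) he' hf')
  have hker : (x, y) ∈ kerM A lam := by
    obtain ⟨hxA, hAx⟩ := hclosed.exists_apply_eq_of_tendsto_s15 (u := u ∘ φ) hx
      (by simpa using hf'.add (hy.const_smul lam))
    obtain ⟨hyA, hAy⟩ := (LinearPMap.adjoint_isClosed hdense).exists_apply_eq_of_tendsto_s15 (u := v ∘ φ) hy
      (by simpa using he'.add (hx.const_smul lam))
    exact ⟨hxA, hyA, hAy, hAx⟩
  have hzero : ⟪x, x⟫ + ⟪y, y⟫ = 0 :=
    tendsto_nhds_unique ((hx.inner tendsto_const_nhds).add (hy.inner tendsto_const_nhds))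
      (tendsto_const_nhds.congr fun n => (horth (φ n) _ hker).symm)
  have hone : ‖x‖ ^ 2 + ‖y‖ ^ 2 = 1 :=
    tendsto_nhds_unique ((hx.norm.pow 2).add (hy.norm.pow 2))
      (tendsto_const_nhds.congr fun n => (hnorm (φ n)).symm)
  rw [real_inner_self_eq_norm_sq, real_inner_self_eq_norm_sq] at hzero
  linarith

/-- Under the compactness of the embedding `D(A) ∩ closure (R(A*)) ↪ X`,
for every nonzero real `lam` there is `c > 0` such that
`‖z‖_Z ≤ c * ‖(M - lam) z‖_Z` for every `z = (x, y) ∈ D(M) ∩ closure (R(M))` orthogonal to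
the eigenspace `N(M - lam)`. -/
theorem stmt15
    (A : X →ₗ.[ℝ] Y) (hdense : Dense (A.domain : Set X)) (hclosed : A.IsClosed)
    (hcomp : ∀ u : ℕ → A.domain,
      (∀ n, (u n : X) ∈ closure (A.adjoint.pmRange : Set X)) →
      (∃ C : ℝ, ∀ n, ‖(u n : X)‖ ^ 2 + ‖A (u n)‖ ^ 2 ≤ C) →
      ∃ (x : X) (φ : ℕ → ℕ), StrictMono φ ∧
        Filter.Tendsto (fun n => (u (φ n) : X)) Filter.atTop (nhds x))
    (lam : ℝ) (hlam : lam ≠ 0) :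
    ∃ c : ℝ, 0 < c ∧ ∀ (x : X) (y : Y) (hx : x ∈ A.domain) (hy : y ∈ A.adjoint.domain),
      x ∈ closure (A.adjoint.pmRange : Set X) →
      y ∈ closure (A.pmRange : Set Y) →
      (∀ w ∈ kerM A lam, ⟪x, w.1⟫ + ⟪y, w.2⟫ = 0) →
      Real.sqrt (‖x‖ ^ 2 + ‖y‖ ^ 2) ≤
        c * Real.sqrt (‖A.adjoint ⟨y, hy⟩ - lam • x‖ ^ 2 + ‖A ⟨x, hx⟩ - lam • y‖ ^ 2) := by
  by_contra! hcon
  have hunit : ∀ n : ℕ, ∃ (u : A.domain) (v : A.adjoint.domain),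
      (u : X) ∈ closure (A.adjoint.pmRange : Set X) ∧
      ‖(u : X)‖ ^ 2 + ‖(v : Y)‖ ^ 2 = 1 ∧
      (∀ w ∈ kerM A lam, ⟪(u : X), w.1⟫ + ⟪(v : Y), w.2⟫ = 0) ∧
      Real.sqrt (‖A.adjoint v - lam • (u : X)‖ ^ 2 + ‖A u - lam • (v : Y)‖ ^ 2)
        ≤ 1 / ((n : ℝ) + 1) := by
    intro n
    obtain ⟨x, y, hx, hy, hxR, -, horth, hlt⟩ := hcon ((n : ℝ) + 1) (by positivity)
    set N := Real.sqrt (‖x‖ ^ 2 + ‖y‖ ^ 2) with hN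
    have hNpos : 0 < N := lt_of_le_of_lt (by positivity) hlt
    have hNsq : N ^ 2 = ‖x‖ ^ 2 + ‖y‖ ^ 2 := Real.sq_sqrt (by positivity)
    refine ⟨N⁻¹ • ⟨x, hx⟩, N⁻¹ • ⟨y, hy⟩, ?_, ?_, ?_, ?_⟩
    · exact A.adjoint.pmRange.topologicalClosure.smul_mem N⁻¹ hxR
    · simp only [Submodule.coe_smul, norm_smul, mul_pow, ← mul_add, ← hNsq, norm_inv,
        Real.norm_of_nonneg hNpos.le]
      field_simp
    · intro w hw
      simp only [Submodule.coe_smul, real_inner_smul_left, ← mul_add, horth w hw, mul_zero]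
    · simp only [LinearPMap.map_smul, Submodule.coe_smul, smul_comm lam N⁻¹, ← smul_sub,
        norm_smul, mul_pow, ← mul_add, norm_inv, Real.norm_of_nonneg hNpos.le]
      rw [Real.sqrt_mul (by positivity), Real.sqrt_sq (by positivity), inv_mul_le_iff₀ hNpos,
        mul_one_div, le_div_iff₀ (by positivity), mul_comm]
      exact hlt.le
  choose u v hmem hnorm horth hres using hunit
  have hlim := tendsto_one_div_add_atTop_nhds_zero_nat (𝕜 := ℝ)
  refine not_tendsto_residuals_of_orthogonal_kerM A hdense hclosed hcomp hlam hmem hnorm horth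
    (squeeze_zero_norm (fun n => ?_) hlim) (squeeze_zero_norm (fun n => ?_) hlim)
  · exact (Real.le_sqrt_of_sq_le (le_add_of_nonneg_right (sq_nonneg _))).trans (hres n)
  · exact (Real.le_sqrt_of_sq_le (le_add_of_nonneg_left (sq_nonneg _))).trans (hres n)
end
end

section
/- Suppose the embedding D(A) ∩ closure(R(A*)) ↪ X is compact, and let λ be a nonzero real number. Then the range R(M − λ) is closed in Z and the orthogonal decomposition Z = N(M − λ) ⊕ R(M − λ) holds. -/
open scoped InnerProductSpace RealInnerProductSpace

noncomputable section

variable {X Y : Type*}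
  [NormedAddCommGroup X] [InnerProductSpace ℝ X] [CompleteSpace X]
  [NormedAddCommGroup Y] [InnerProductSpace ℝ Y] [CompleteSpace Y]

open Filter Topology

/-- A bounded operator between Banach spaces has closed range if every bounded sequence whose
images tend to some limit has a convergent subsequence. -/
theorem ContinuousLinearMap.isClosed_range_of_subseq {G H : Type*}
    [NormedAddCommGroup G] [NormedSpace ℝ G] [CompleteSpace G]
    [NormedAddCommGroup H] [NormedSpace ℝ H] (T : G →L[ℝ] H)
    (hT : ∀ (g : ℕ → G) (C : ℝ) (w : H), (∀ n, ‖g n‖ ≤ C) →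
      Tendsto (fun n => T (g n)) atTop (𝓝 w) →
      ∃ (x : G) (φ : ℕ → ℕ), StrictMono φ ∧ Tendsto (fun n => g (φ n)) atTop (𝓝 x)) :
    IsClosed (Set.range T) := by
  have hker : FiniteDimensional ℝ T.ker := by
    refine FiniteDimensional.of_isCompact_closedBall ℝ (r := 1) one_pos (c := 0) ?_
    refine IsSeqCompact.isCompact fun g hg => ?_
    have hker0 : ∀ n, T (g n : G) = 0 := fun n => LinearMap.mem_ker.1 (g n).2
    obtain ⟨x, φ, hφ, hx⟩ := hT (fun n => (g n : G)) 1 0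
      (fun n => by simpa using hg n) (by simp [hker0])
    have hmem : x ∈ T.ker := T.isClosed_ker.mem_of_tendsto hx
      (Eventually.of_forall fun n => (g (φ n)).2)
    have hlim : Tendsto (g ∘ φ) atTop (𝓝 (⟨x, hmem⟩ : T.ker)) := tendsto_subtype_rng.2 hx
    exact ⟨⟨x, hmem⟩, Metric.isClosed_closedBall.mem_of_tendsto hlim
      (Eventually.of_forall fun n => hg (φ n)), φ, hφ, hlim⟩
  obtain ⟨q, hq, hcompl⟩ :=
    (Submodule.ClosedComplemented.of_finiteDimensional T.ker).exists_isClosed_isCompl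
  have : CompleteSpace q := hq.completeSpace_coe
  have hbound : ∃ c : ℝ, 0 < c ∧ ∀ x : q, c * ‖x‖ ≤ ‖T x‖ := by
    by_contra! hcon
    choose x hx using fun n : ℕ => hcon (1 / ((n : ℝ) + 1)) (by positivity)
    have hpos : ∀ n, 0 < ‖x n‖ := fun n => by
      rw [norm_pos_iff]
      intro h
      simpa [h] using hx n
    have hnorm : ∀ n, ‖(‖x n‖⁻¹ • (x n : G))‖ = 1 := fun n => by
      rw [norm_smul, norm_inv, norm_norm]
      exact inv_mul_cancel₀ (hpos n).ne'
    have hlim : Tendsto (fun n => T (‖x n‖⁻¹ • (x n : G))) atTop (𝓝 0) := by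
      refine squeeze_zero_norm (fun n => ?_) tendsto_one_div_add_atTop_nhds_zero_nat
      rw [map_smul, norm_smul, norm_inv, norm_norm, inv_mul_le_iff₀ (hpos n), mul_comm]
      exact (hx n).le
    obtain ⟨y, φ, hφ, hy⟩ := hT _ 1 0 (fun n => (hnorm n).le) hlim
    have hyq : y ∈ q := hq.mem_of_tendsto hy
      (Eventually.of_forall fun n => q.smul_mem _ (x (φ n)).2)
    have hyker : T y = 0 := tendsto_nhds_unique ((T.continuous.tendsto y).comp hy)
      (hlim.comp hφ.tendsto_atTop)
    have hynorm : ‖y‖ = 1 := tendsto_nhds_unique hy.norm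
      (tendsto_const_nhds.congr fun n => (hnorm (φ n)).symm)
    have hy0 : y = 0 := by
      simpa using hcompl.disjoint.le_bot (Submodule.mem_inf.2 ⟨LinearMap.mem_ker.2 hyker, hyq⟩)
    simp [hy0] at hynorm
  obtain ⟨c, hc, hbd⟩ := hbound
  have hanti : AntilipschitzWith (Real.toNNReal c⁻¹) (T.comp q.subtypeL) := by
    refine AddMonoidHomClass.antilipschitz_of_bound _ fun x => ?_
    rw [Real.coe_toNNReal _ (inv_nonneg.2 hc.le), ← div_eq_inv_mul, le_div_iff₀ hc, mul_comm]
    exact hbd x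
  have hrange : Set.range T = Set.range (T.comp q.subtypeL) := by
    refine Set.Subset.antisymm ?_ ?_
    · rintro _ ⟨g, rfl⟩
      obtain ⟨a, ha, b, hb, rfl⟩ := Submodule.mem_sup.1
        (hcompl.sup_eq_top ▸ Submodule.mem_top : g ∈ T.ker ⊔ q)
      have ha' : T a = 0 := LinearMap.mem_ker.1 ha
      exact ⟨⟨b, hb⟩, by simp [ha']⟩
    · rintro _ ⟨x, rfl⟩
      exact ⟨x, rfl⟩
  rw [hrange]
  exact hanti.isClosed_range (T.comp q.subtypeL).uniformContinuous

/-- Orthogonal decomposition of `X × Y`, with the `L²` inner product, along a closed subspace. -/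
theorem Submodule.exists_add_orthogonal_prod (R : Submodule ℝ (X × Y))
    (hR : IsClosed (R : Set (X × Y))) (z : X × Y) :
    ∃ k : X × Y, ∃ r ∈ R, z = k + r ∧ ∀ s ∈ R, ⟪k.1, s.1⟫ + ⟪k.2, s.2⟫ = 0 := by
  let e := WithLp.prodContinuousLinearEquiv 2 ℝ X Y
  let R' : Submodule ℝ (WithLp 2 (X × Y)) := R.comap e.toLinearEquiv.toLinearMap
  have hR' : IsClosed (R' : Set (WithLp 2 (X × Y))) := hR.preimage e.continuous
  have : CompleteSpace R' := hR'.completeSpace_coe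
  obtain ⟨r, hr, k, hk, hz⟩ := R'.exists_add_mem_mem_orthogonal (WithLp.toLp 2 z)
  refine ⟨e k, e r, hr, ?_, fun s hs => ?_⟩
  · have h := congrArg e hz
    rw [map_add, add_comm] at h
    exact h
  · have h := (Submodule.mem_orthogonal' _ _).1 hk (WithLp.toLp 2 s) hs
    rwa [WithLp.prod_inner_apply] at h

/-- A pair that is formally adjoint to `A.adjoint` lies in the graph of the closed operator `A`. -/
theorem LinearPMap.mem_graph_of_inner_adjoint {A : X →ₗ.[ℝ] Y}
    (hdense : Dense (A.domain : Set X)) (hclosed : A.IsClosed) {x : X} {y : Y}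
    (h : ∀ v : A.adjoint.domain, ⟪A.adjoint v, x⟫ = ⟪(v : Y), y⟫) : (x, y) ∈ A.graph := by
  obtain ⟨k, r, hr, hz, hk⟩ := A.graph.exists_add_orthogonal_prod hclosed (x, y)
  have hadj : ∀ u : A.domain, ⟪-k.1, (u : X)⟫ = ⟪k.2, A u⟫ := fun u => by
    have := hk _ (A.mem_graph u)
    rw [inner_neg_left]
    linarith
  have hmem := A.mem_adjoint_domain_of_exists k.2 ⟨_, hadj⟩
  have hval : A.adjoint ⟨k.2, hmem⟩ = -k.1 := adjoint_apply_eq hdense _ hadj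
  have h1 := h ⟨k.2, hmem⟩
  have h2 := hk r hr
  obtain ⟨hx, hy⟩ := Prod.mk.inj hz
  rw [hval, hx, hy, inner_neg_left, inner_add_right] at h1
  dsimp only at h1
  rw [inner_add_right] at h1
  have hk1 := real_inner_self_nonneg (x := k.1)
  have hk2 := real_inner_self_nonneg (x := k.2)
  have e1 : k.1 = 0 := inner_self_eq_zero.1 (by linarith : ⟪k.1, k.1⟫ = 0)
  have e2 : k.2 = 0 := inner_self_eq_zero.1 (by linarith : ⟪k.2, k.2⟫ = 0)
  have hk0 : k = 0 := Prod.ext e1 e2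
  rw [hz, hk0, zero_add]
  exact hr

/-- A sequence is Cauchy if its squared differences are controlled by those of Cauchy sequences. -/
theorem cauchySeq_of_norm_sq_le {E F₁ F₂ : Type*} [NormedAddCommGroup E]
    [NormedAddCommGroup F₁] [NormedAddCommGroup F₂] {a : ℕ → E} {b : ℕ → F₁} {c : ℕ → F₂}
    (hb : CauchySeq b) (hc : CauchySeq c) (D₁ D₂ : ℝ)
    (h : ∀ m n, ‖a m - a n‖ ^ 2 ≤ D₁ * ‖b m - b n‖ + D₂ * ‖c m - c n‖) : CauchySeq a := by
  rw [cauchySeq_iff_tendsto_dist_atTop_0] at hb hc ⊢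
  have hsum := (hb.const_mul D₁).add (hc.const_mul D₂)
  simp only [dist_eq_norm, mul_zero, add_zero] at hsum ⊢
  have hsq := squeeze_zero (fun p : ℕ × ℕ => sq_nonneg ‖a p.1 - a p.2‖)
    (fun p => h p.1 p.2) hsum
  simpa [Real.sqrt_sq (norm_nonneg _)] using hsq.sqrt

/-- The operator `M - lam` as a bounded operator on the graphs of `A` and `A.adjoint`. -/
def graphShift (A : X →ₗ.[ℝ] Y) (lam : ℝ) : A.graph × A.adjoint.graph →L[ℝ] X × Y :=
  let p := A.graph.subtypeL.comp (ContinuousLinearMap.fst ℝ A.graph A.adjoint.graph)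
  let q := A.adjoint.graph.subtypeL.comp (ContinuousLinearMap.snd ℝ A.graph A.adjoint.graph)
  ((ContinuousLinearMap.snd ℝ Y X).comp q - lam • (ContinuousLinearMap.fst ℝ X Y).comp p).prod
    ((ContinuousLinearMap.snd ℝ X Y).comp p - lam • (ContinuousLinearMap.fst ℝ Y X).comp q)

omit [CompleteSpace Y] in
theorem range_graphShift (A : X →ₗ.[ℝ] Y) (lam : ℝ) :
    Set.range (graphShift A lam) = ranM A lam := by
  ext w
  constructor
  · rintro ⟨⟨⟨⟨x, y⟩, hg⟩, ⟨⟨y', x'⟩, hh⟩⟩, rfl⟩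
    obtain ⟨u, rfl, rfl⟩ := (LinearPMap.mem_graph_iff _).1 hg
    obtain ⟨v, rfl, rfl⟩ := (LinearPMap.mem_graph_iff _).1 hh
    exact ⟨u, v, rfl⟩
  · rintro ⟨u, v, rfl⟩
    exact ⟨(⟨_, A.mem_graph u⟩, ⟨_, A.adjoint.mem_graph v⟩), rfl⟩

omit [CompleteSpace Y] in
theorem LinearPMap.inner_eq_of_mem_graph {A : X →ₗ.[ℝ] Y} (hdense : Dense (A.domain : Set X))
    {g : X × Y} {h : Y × X} (hg : g ∈ A.graph) (hh : h ∈ A.adjoint.graph) :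
    ⟪g.2, h.1⟫ = ⟪g.1, h.2⟫ := by
  obtain ⟨u, hu, hu'⟩ := (LinearPMap.mem_graph_iff _).1 hg
  obtain ⟨v, hv, hv'⟩ := (LinearPMap.mem_graph_iff _).1 hh
  rw [← hu, ← hu', ← hv, ← hv']
  exact (adjoint_isFormalAdjoint hdense).symm u v

/-- Removing the component of `x` orthogonal to the range of the adjoint does not change `A x`. -/
theorem LinearPMap.starProjection_mem_graph {A : X →ₗ.[ℝ] Y} (hdense : Dense (A.domain : Set X))
    (hclosed : A.IsClosed) {g : X × Y} (hg : g ∈ A.graph) :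
    (A.adjoint.pmRange.topologicalClosure.starProjection g.1, g.2) ∈ A.graph := by
  have hker : (g.1 - A.adjoint.pmRange.topologicalClosure.starProjection g.1, (0 : Y)) ∈
      A.graph := by
    refine mem_graph_of_inner_adjoint hdense hclosed fun v => ?_
    rw [inner_zero_right]
    exact (Submodule.mem_orthogonal _ _).1
      (Submodule.sub_starProjection_mem_orthogonal (K := A.adjoint.pmRange.topologicalClosure) g.1)
      _ (Submodule.le_topologicalClosure _ ⟨v, rfl⟩)
  simpa using A.graph.sub_mem hg hker

/-- If `D(A) ∩ closure (R(A*))` embeds compactly, then bounded sequences whose images under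
`M - lam` converge have convergent subsequences. -/
theorem graphShift_subseq
    (A : X →ₗ.[ℝ] Y) (hdense : Dense (A.domain : Set X)) (hclosed : A.IsClosed)
    (hcomp : ∀ u : ℕ → A.domain,
      (∀ n, (u n : X) ∈ closure (A.adjoint.pmRange : Set X)) →
      (∃ C : ℝ, ∀ n, ‖(u n : X)‖ ^ 2 + ‖A (u n)‖ ^ 2 ≤ C) →
      ∃ (x : X) (φ : ℕ → ℕ), StrictMono φ ∧
        Tendsto (fun n => (u (φ n) : X)) atTop (𝓝 x))
    {lam : ℝ} (hlam : lam ≠ 0) (g : ℕ → A.graph × A.adjoint.graph) (C : ℝ) (w : X × Y)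
    (hC : ∀ n, ‖g n‖ ≤ C) (hw : Tendsto (fun n => graphShift A lam (g n)) atTop (𝓝 w)) :
    ∃ (x : A.graph × A.adjoint.graph) (φ : ℕ → ℕ), StrictMono φ ∧
      Tendsto (fun n => g (φ n)) atTop (𝓝 x) := by
  set P := A.adjoint.pmRange.topologicalClosure.starProjection with hP
  let a : ℕ → X × Y := fun n => (g n).1
  let b : ℕ → Y × X := fun n => (g n).2
  have ha : ∀ n, a n ∈ A.graph := fun n => (g n).1.2
  have hb : ∀ n, b n ∈ A.adjoint.graph := fun n => (g n).2.2
  have haC : ∀ n, ‖a n‖ ≤ C := fun n => (norm_fst_le (g n)).trans (hC n)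
  have hbC : ∀ n, ‖b n‖ ≤ C := fun n => (norm_snd_le (g n)).trans (hC n)
  have ha2C : ∀ n, ‖(a n).2‖ ≤ C := fun n => (norm_snd_le (a n)).trans (haC n)
  have hb2C : ∀ n, ‖(b n).2‖ ≤ C := fun n => (norm_snd_le (b n)).trans (hbC n)
  have hw1 : Tendsto (fun n => (b n).2 - lam • (a n).1) atTop (𝓝 w.1) :=
    (continuous_fst.tendsto w).comp hw
  have hw2 : Tendsto (fun n => (a n).2 - lam • (b n).1) atTop (𝓝 w.2) :=
    (continuous_snd.tendsto w).comp hw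
  choose u hu hAu using fun n => (LinearPMap.mem_graph_iff _).1
    (LinearPMap.starProjection_mem_graph hdense hclosed (ha n))
  obtain ⟨x₀, φ, hφ, hx₀⟩ := hcomp u
    (fun n => by
      rw [hu n, ← Submodule.topologicalClosure_coe]
      exact Submodule.starProjection_apply_mem _ _)
    ⟨C ^ 2 + C ^ 2, fun n => by
      have hle : ‖(u n : X)‖ ≤ C := by
        rw [hu n]
        exact (Submodule.norm_starProjection_apply_le _ _).trans
          ((norm_fst_le (a n)).trans (haC n))
      rw [hAu n]
      gcongr
      exact ha2C n⟩
  replace hw1 := hw1.comp hφ.tendsto_atTop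
  replace hw2 := hw2.comp hφ.tendsto_atTop
  have hPb : ∀ n, P (b n).2 = (b n).2 := fun n => by
    rw [hP, Submodule.starProjection_eq_self_iff]
    obtain ⟨v, -, hv⟩ := (LinearPMap.mem_graph_iff _).1 (hb n)
    exact Submodule.le_topologicalClosure _ ⟨v, hv⟩
  have ha1 : ∃ x, Tendsto (fun n => (a (φ n)).1) atTop (𝓝 x) := by
    refine ⟨_, (hx₀.sub ((hw1.sub ((P.continuous.tendsto _).comp hw1)).const_smul lam⁻¹)).congr
      fun n => ?_⟩
    simp only [Function.comp_apply, map_sub, map_smul, hPb, hu, ← hP]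
    have : (b (φ n)).2 - lam • (a (φ n)).1 - ((b (φ n)).2 - lam • P (a (φ n)).1) =
      lam • (P (a (φ n)).1 - (a (φ n)).1) := by module
    rw [this, inv_smul_smul₀ hlam]
    abel
  obtain ⟨x, hx⟩ := ha1
  have hb2 : Tendsto (fun n => (b (φ n)).2) atTop (𝓝 (w.1 + lam • x)) :=
    (hw1.add (hx.const_smul lam)).congr fun n => by simp
  have hcauchy : CauchySeq fun n => (a (φ n)).2 := by
    refine cauchySeq_of_norm_sq_le hw2.cauchySeq hx.cauchySeq (C + C) (|lam| * (C + C))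
      fun m n => ?_
    simp only [Function.comp_apply]
    set da := a (φ m) - a (φ n) with hda
    set db := b (φ m) - b (φ n) with hdb
    have hadj : ⟪da.2, db.1⟫ = ⟪da.1, db.2⟫ := LinearPMap.inner_eq_of_mem_graph hdense
      (A.graph.sub_mem (ha _) (ha _)) (A.adjoint.graph.sub_mem (hb _) (hb _))
    have h2 : ‖da.2‖ ≤ C + C := (norm_sub_le _ _).trans (add_le_add (ha2C _) (ha2C _))
    have h3 : ‖db.2‖ ≤ C + C := (norm_sub_le _ _).trans (add_le_add (hb2C _) (hb2C _))
    have e1 : (a (φ m)).2 - lam • (b (φ m)).1 - ((a (φ n)).2 - lam • (b (φ n)).1) =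
        da.2 - lam • db.1 := by
      simp only [hda, hdb, Prod.fst_sub, Prod.snd_sub]
      module
    rw [e1]
    change ‖da.2‖ ^ 2 ≤ _ + _ * ‖da.1‖
    have e2 : ‖da.2‖ ^ 2 = ⟪da.2, da.2 - lam • db.1⟫ + lam * ⟪da.1, db.2⟫ := by
      rw [inner_sub_right, real_inner_smul_right, hadj, real_inner_self_eq_norm_sq]
      ring
    rw [e2]
    refine add_le_add ((real_inner_le_norm _ _).trans (by gcongr)) ?_
    calc lam * ⟪da.1, db.2⟫ ≤ |lam| * |⟪da.1, db.2⟫| := by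
          rw [← abs_mul]
          exact le_abs_self _
      _ ≤ |lam| * (‖da.1‖ * ‖db.2‖) := by
          gcongr
          exact abs_real_inner_le_norm _ _
      _ ≤ |lam| * (‖da.1‖ * (C + C)) := by gcongr
      _ = |lam| * (C + C) * ‖da.1‖ := by ring
  obtain ⟨y, hy⟩ := cauchySeq_tendsto_of_complete hcauchy
  have hb1 : Tendsto (fun n => (b (φ n)).1) atTop (𝓝 (lam⁻¹ • (y - w.2))) :=
    ((hy.sub hw2).const_smul lam⁻¹).congr fun n => by simp [hlam]
  have hga := hx.prodMk_nhds hy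
  have hgb := hb1.prodMk_nhds hb2
  exact ⟨(⟨_, hclosed.mem_of_tendsto hga (Eventually.of_forall fun n => ha (φ n))⟩,
    ⟨_, (LinearPMap.adjoint_isClosed hdense).mem_of_tendsto hgb
      (Eventually.of_forall fun n => hb (φ n))⟩), φ, hφ,
    (tendsto_subtype_rng.2 hga).prodMk_nhds (tendsto_subtype_rng.2 hgb)⟩

/-- Under the compactness of the embedding `D(A) ∩ closure (R(A*)) ↪ X`,
for every nonzero real `lam` the range `R(M - lam)` is closed in `Z = X × Y` and the
orthogonal decomposition `Z = N(M - lam) ⊕ R(M - lam)` holds: the two sets are orthogonal,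
and every `z ∈ Z` is the sum of an element of `N(M - lam)` and an element of
`R(M - lam)`. -/
theorem stmt16
    (A : X →ₗ.[ℝ] Y) (hdense : Dense (A.domain : Set X)) (hclosed : A.IsClosed)
    (hcomp : ∀ u : ℕ → A.domain,
      (∀ n, (u n : X) ∈ closure (A.adjoint.pmRange : Set X)) →
      (∃ C : ℝ, ∀ n, ‖(u n : X)‖ ^ 2 + ‖A (u n)‖ ^ 2 ≤ C) →
      ∃ (x : X) (φ : ℕ → ℕ), StrictMono φ ∧
        Filter.Tendsto (fun n => (u (φ n) : X)) Filter.atTop (nhds x))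
    (lam : ℝ) (hlam : lam ≠ 0) :
    IsClosed (ranM A lam) ∧
    (∀ k ∈ kerM A lam, ∀ r ∈ ranM A lam, ⟪k.1, r.1⟫ + ⟪k.2, r.2⟫ = 0) ∧
    (∀ z : X × Y, ∃ k ∈ kerM A lam, ∃ r ∈ ranM A lam, z = k + r) := by
  have hrange : IsClosed (ranM A lam) := by
    have : CompleteSpace A.graph := hclosed.completeSpace_coe
    have : CompleteSpace A.adjoint.graph :=
      (LinearPMap.adjoint_isClosed hdense).completeSpace_coe
    rw [← range_graphShift]
    exact (graphShift A lam).isClosed_range_of_subseq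
      (graphShift_subseq A hdense hclosed hcomp hlam)
  refine ⟨hrange, ?_, fun z => ?_⟩
  · rintro ⟨k₁, k₂⟩ ⟨hx, hy, h1, h2⟩ _ ⟨u, v, rfl⟩
    have e1 := LinearPMap.adjoint_isFormalAdjoint hdense ⟨k₂, hy⟩ u
    have e2 := (LinearPMap.adjoint_isFormalAdjoint hdense).symm ⟨k₁, hx⟩ v
    dsimp only at h1 h2 e1 e2 ⊢
    rw [h1, real_inner_smul_left] at e1
    rw [h2, real_inner_smul_left] at e2
    rw [inner_sub_right, inner_sub_right, real_inner_smul_right, real_inner_smul_right]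
    linarith
  · have hcoe : ((graphShift A lam).range : Set (X × Y)) = ranM A lam := by
      rw [← range_graphShift]
      rfl
    obtain ⟨k, r, hr, hz, hk⟩ := (graphShift A lam).range.exists_add_orthogonal_prod
      (hcoe ▸ hrange) z
    replace hk : ∀ (u : A.domain) (v : A.adjoint.domain),
        ⟪k.1, A.adjoint v - lam • (u : X)⟫ + ⟪k.2, A u - lam • (v : Y)⟫ = 0 := fun u v =>
      hk _ (hcoe.ge ⟨u, v, rfl⟩)
    have hadj : ∀ u : A.domain, ⟪lam • k.1, (u : X)⟫ = ⟪k.2, A u⟫ := fun u => by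
      have := hk u 0
      simp only [LinearPMap.map_zero, ZeroMemClass.coe_zero, smul_zero, sub_zero, zero_sub,
        inner_neg_right, real_inner_smul_right] at this
      rw [real_inner_smul_left]
      linarith
    have hgraph : (k.1, lam • k.2) ∈ A.graph := by
      refine LinearPMap.mem_graph_of_inner_adjoint hdense hclosed fun v => ?_
      have := hk 0 v
      simp only [LinearPMap.map_zero, ZeroMemClass.coe_zero, smul_zero, sub_zero, zero_sub,
        inner_neg_right, real_inner_smul_right] at this
      rw [real_inner_smul_right, real_inner_comm, real_inner_comm k.2]
      linarith
    obtain ⟨u, hu, hAu⟩ := (LinearPMap.mem_graph_iff _).1 hgraph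
    dsimp only at hu hAu
    refine ⟨k, ⟨hu ▸ u.2, LinearPMap.mem_adjoint_domain_of_exists _ ⟨_, hadj⟩,
      LinearPMap.adjoint_apply_eq hdense _ hadj, ?_⟩, r, hcoe.le hr, hz⟩
    rw [← hAu]
    congr 1
    exact Subtype.ext hu.symm
end
end

section
/- Suppose the embedding D(A) ∩ closure(R(A*)) ↪ X is compact and that R(A*) is infinite dimensional. Then there exist a monotone increasing sequence of positive real numbers (λ_n) with λ_n → ∞ and a sequence (x_n) ⊆ D(A*A) ∩ R(A*) such that (x_n) is a complete orthonormal system in R(A*) and A*A x_n = λ_n² x_n for all n; moreover, the vectors y_n := λ_n⁻¹ A x_n form a complete orthonormal system in R(A) and satisfy A A* y_n = λ_n² y_n for all n. -/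
open scoped InnerProductSpace RealInnerProductSpace

noncomputable section

variable {X Y : Type*}
  [NormedAddCommGroup X] [InnerProductSpace ℝ X] [CompleteSpace X]
  [NormedAddCommGroup Y] [InnerProductSpace ℝ Y] [CompleteSpace Y]

section Abstract

open Filter Topology

variable {E G : Type*} [NormedAddCommGroup E] [InnerProductSpace ℝ E]
  [NormedAddCommGroup G] [InnerProductSpace ℝ G]

/-- Sequential closedness of a linear map: graph-Cauchy sequences converge in the graph. -/
def GraphComplete (T : E →ₗ[ℝ] G) : Prop :=
  ∀ u : ℕ → E, CauchySeq u → CauchySeq (fun n => T (u n)) →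
    ∃ x, Tendsto u atTop (𝓝 x) ∧ Tendsto (fun n => T (u n)) atTop (𝓝 (T x))

/-- Sequences bounded in the graph norm have Cauchy subsequences. -/
def GraphCompact (T : E →ₗ[ℝ] G) : Prop :=
  ∀ u : ℕ → E, (∃ C : ℝ, ∀ n, ‖u n‖ ^ 2 + ‖T (u n)‖ ^ 2 ≤ C) →
    ∃ φ : ℕ → ℕ, StrictMono φ ∧ CauchySeq (fun n => u (φ n))

theorem cauchySeq_map_of_minimizing (T : E →ₗ[ℝ] G) {K : Submodule ℝ E} {m : ℝ} (hm0 : 0 ≤ m)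
    (hm : ∀ v ∈ K, m * ‖v‖ ≤ ‖T v‖) {u : ℕ → E} (huK : ∀ n, u n ∈ K) (hu1 : ∀ n, ‖u n‖ = 1)
    (hu : CauchySeq u) (hTu : Tendsto (fun n => ‖T (u n)‖) atTop (𝓝 m)) :
    CauchySeq (fun n => T (u n)) := by
  have key : ∀ k l, ‖T (u k) - T (u l)‖ ^ 2 ≤
      2 * (‖T (u k)‖ ^ 2 - m ^ 2) + 2 * (‖T (u l)‖ ^ 2 - m ^ 2) + m ^ 2 * ‖u k - u l‖ ^ 2 := by
    intro k l
    have h1 := parallelogram_law_with_norm ℝ (T (u k)) (T (u l))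
    have h2 := parallelogram_law_with_norm ℝ (u k) (u l)
    have h3 := hm _ (K.add_mem (huK k) (huK l))
    rw [map_add] at h3
    have h4 := pow_le_pow_left₀ (by positivity) h3 2
    rw [hu1, hu1] at h2
    rw [mul_pow] at h4
    nlinarith
  have hz : Tendsto (fun p : ℕ × ℕ => 2 * (‖T (u p.1)‖ ^ 2 - m ^ 2) +
      2 * (‖T (u p.2)‖ ^ 2 - m ^ 2) + m ^ 2 * ‖u p.1 - u p.2‖ ^ 2) atTop (𝓝 0) := by
    have h1 : Tendsto (fun p : ℕ × ℕ => ‖T (u p.1)‖) atTop (𝓝 m) :=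
      hTu.comp (by rw [← prod_atTop_atTop_eq]; exact tendsto_fst)
    have h2 : Tendsto (fun p : ℕ × ℕ => ‖T (u p.2)‖) atTop (𝓝 m) :=
      hTu.comp (by rw [← prod_atTop_atTop_eq]; exact tendsto_snd)
    have h3 : Tendsto (fun p : ℕ × ℕ => ‖u p.1 - u p.2‖) atTop (𝓝 0) := by
      have := cauchySeq_iff_tendsto_dist_atTop_0.1 hu
      simpa only [dist_eq_norm] using this
    have := ((((h1.pow 2).sub_const (m ^ 2)).const_mul 2).add
      (((h2.pow 2).sub_const (m ^ 2)).const_mul 2)).add ((h3.pow 2).const_mul (m ^ 2))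
    simpa using this
  have hs : Tendsto (fun p : ℕ × ℕ => ‖T (u p.1) - T (u p.2)‖ ^ 2) atTop (𝓝 0) :=
    squeeze_zero (fun _ => by positivity) (fun p => key p.1 p.2) hz
  rw [cauchySeq_iff_tendsto_dist_atTop_0]
  have := hs.sqrt
  simpa [dist_eq_norm, Real.sqrt_sq] using this

theorem exists_unit_minimizer {T : E →ₗ[ℝ] G} (hT : GraphComplete T) (hc : GraphCompact T)
    {K : Submodule ℝ E} (hK : IsClosed (K : Set E)) (hK0 : K ≠ ⊥) :
    ∃ x ∈ K, ‖x‖ = 1 ∧ ∀ v ∈ K, ‖T x‖ * ‖v‖ ≤ ‖T v‖ := by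
  set S : Set ℝ := (fun v => ‖T v‖) '' {v | v ∈ K ∧ ‖v‖ = 1}
  have hne : S.Nonempty := by
    obtain ⟨v, hv, hv0⟩ := Submodule.exists_mem_ne_zero_of_ne_bot hK0
    exact ⟨_, ‖v‖⁻¹ • v, ⟨K.smul_mem _ hv, norm_smul_inv_norm (𝕜 := ℝ) hv0⟩, rfl⟩
  have hbdd : BddBelow S := ⟨0, by rintro _ ⟨v, -, rfl⟩; exact norm_nonneg _⟩
  have hm0 : 0 ≤ sInf S := Real.sInf_nonneg (by rintro _ ⟨v, -, rfl⟩; exact norm_nonneg _)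
  have hm : ∀ v ∈ K, sInf S * ‖v‖ ≤ ‖T v‖ := by
    intro v hv
    rcases eq_or_ne v 0 with rfl | hv0
    · simp
    have h : sInf S ≤ ‖T (‖v‖⁻¹ • v)‖ :=
      csInf_le hbdd ⟨‖v‖⁻¹ • v, ⟨K.smul_mem _ hv, norm_smul_inv_norm (𝕜 := ℝ) hv0⟩, rfl⟩
    rwa [map_smul, norm_smul, norm_inv, norm_norm, inv_mul_eq_div,
      le_div_iff₀ (norm_pos_iff.2 hv0)] at h
  obtain ⟨a, -, ha, haS⟩ := exists_seq_tendsto_sInf hne hbdd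
  choose w hw hwa using haS
  obtain rfl : (fun n => ‖T (w n)‖) = a := funext hwa
  obtain ⟨B, hB⟩ := ha.bddAbove_range
  obtain ⟨φ, hφ, hcau⟩ := hc w ⟨1 + B ^ 2, fun n => by
    rw [(hw n).2, one_pow]
    gcongr
    exact hB ⟨n, rfl⟩⟩
  have hlim := ha.comp hφ.tendsto_atTop
  obtain ⟨x, hx, hTx⟩ := hT _ hcau (cauchySeq_map_of_minimizing T hm0 hm
    (fun n => (hw (φ n)).1) (fun n => (hw (φ n)).2) hcau hlim)
  have hTm : ‖T x‖ = sInf S := tendsto_nhds_unique hTx.norm hlim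
  refine ⟨x, hK.mem_of_tendsto hx (Eventually.of_forall fun n => (hw _).1), ?_, ?_⟩
  · exact tendsto_nhds_unique hx.norm (by simp [(hw _).2])
  · rwa [hTm]

/-- The Euler–Lagrange equation of a constrained minimizer of `‖T x‖`. -/
theorem inner_map_eq_of_minimizer {T : E →ₗ[ℝ] G} {K : Submodule ℝ E} {x : E} (hxK : x ∈ K)
    (hx1 : ‖x‖ = 1) (hx : ∀ v ∈ K, ‖T x‖ * ‖v‖ ≤ ‖T v‖) {v : E} (hv : v ∈ K) :
    ⟪T x, T v⟫ = ‖T x‖ ^ 2 * ⟪x, v⟫ := by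
  have key : ∀ t : ℝ, 0 ≤ (‖T v‖ ^ 2 - ‖T x‖ ^ 2 * ‖v‖ ^ 2) * (t * t) +
      2 * (⟪T x, T v⟫ - ‖T x‖ ^ 2 * ⟪x, v⟫) * t + 0 := by
    intro t
    have h := pow_le_pow_left₀ (by positivity) (hx _ (K.add_mem hxK (K.smul_mem t hv))) 2
    rw [mul_pow, map_add, map_smul, norm_add_sq_real, norm_add_sq_real, norm_smul, norm_smul,
      inner_smul_right, inner_smul_right, hx1, mul_pow, mul_pow, Real.norm_eq_abs, sq_abs] at h
    nlinarith
  have h := discrim_le_zero key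
  rw [discrim] at h
  nlinarith [sq_nonneg (⟪T x, T v⟫ - ‖T x‖ ^ 2 * ⟪x, v⟫)]

/-- Singular value decomposition of an injective graph-complete, graph-compact linear map. -/
theorem exists_singular_system {T : E →ₗ[ℝ] G} (hT : GraphComplete T) (hc : GraphCompact T)
    (hinj : Function.Injective T) (hinf : ¬ FiniteDimensional ℝ E) :
    ∃ (lam : ℕ → ℝ) (u : ℕ → E), (∀ n, 0 < lam n) ∧ Monotone lam ∧ Tendsto lam atTop atTop ∧
      Orthonormal ℝ u ∧ (∀ n v, ⟪T (u n), T v⟫ = lam n ^ 2 * ⟪u n, v⟫) ∧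
      (∀ v, lam 0 * ‖v‖ ≤ ‖T v‖) ∧
      Dense (Submodule.span ℝ (Set.range u) : Set E) := by
  have step : ∀ F : Submodule ℝ E, ∃ x : E, FiniteDimensional ℝ F →
      x ∈ Fᗮ ∧ ‖x‖ = 1 ∧ ∀ v ∈ Fᗮ, ‖T x‖ * ‖v‖ ≤ ‖T v‖ := by
    intro F
    by_cases hF : FiniteDimensional ℝ F
    · have hne : Fᗮ ≠ ⊥ := by
        intro h
        rw [Submodule.orthogonal_eq_bot_iff] at h
        subst h
        exact hinf (Submodule.topEquiv.finiteDimensional)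
      obtain ⟨x, h⟩ := exists_unit_minimizer hT hc F.isClosed_orthogonal hne
      exact ⟨x, fun _ => h⟩
    · exact ⟨0, fun h => absurd h hF⟩
  choose next hnext using step
  let F : ℕ → Submodule ℝ E := fun n =>
    Nat.rec (motive := fun _ => Submodule ℝ E) ⊥ (fun _ S => S ⊔ Submodule.span ℝ {next S}) n
  let u : ℕ → E := fun n => next (F n)
  have hFs : ∀ n, F (n + 1) = F n ⊔ Submodule.span ℝ {u n} := fun _ => rfl
  have hfin : ∀ n, FiniteDimensional ℝ (F n) := by
    intro n
    induction n with
    | zero => exact inferInstanceAs (FiniteDimensional ℝ (⊥ : Submodule ℝ E))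
    | succ n ih => rw [hFs]; infer_instance
  have hu : ∀ n, u n ∈ (F n)ᗮ ∧ ‖u n‖ = 1 ∧ ∀ v ∈ (F n)ᗮ, ‖T (u n)‖ * ‖v‖ ≤ ‖T v‖ :=
    fun n => hnext (F n) (hfin n)
  have hmono : Monotone F := monotone_nat_of_le_succ fun n => by rw [hFs]; exact le_sup_left
  have hmem : ∀ {i n}, i < n → u i ∈ F n := fun {i n} h =>
    hmono (Nat.succ_le_of_lt h) (by
      rw [Nat.succ_eq_add_one, hFs]
      exact Submodule.mem_sup_right (Submodule.mem_span_singleton_self _))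
  have hspan : ∀ n, F n ≤ Submodule.span ℝ (Set.range u) := by
    intro n
    induction n with
    | zero => exact bot_le
    | succ n ih =>
      rw [hFs]
      exact sup_le ih (Submodule.span_mono (by simp))
  have hperp : ∀ {i n}, i < n → ⟪u i, u n⟫ = 0 := fun {i n} h =>
    (Submodule.mem_orthogonal _ _).1 (hu n).1 _ (hmem h)
  have hon : Orthonormal ℝ u := by
    refine ⟨fun n => (hu n).2.1, fun i j hij => ?_⟩
    rcases lt_or_gt_of_ne hij with h | h
    · exact hperp h
    · rw [real_inner_comm]; exact hperp h
  have hdec : ∀ n, ∀ p ∈ F n, ∀ v ∈ (F n)ᗮ, ⟪T p, T v⟫ = 0 := by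
    intro n
    induction n with
    | zero =>
      intro p hp v _
      rw [(Submodule.mem_bot ℝ).1 hp]
      simp
    | succ n ih =>
      intro p hp v hv
      have hv' : v ∈ (F n)ᗮ := Submodule.orthogonal_le (hmono n.le_succ) hv
      have huv : ⟪u n, v⟫ = 0 := (Submodule.mem_orthogonal _ _).1 hv _ (hmem n.lt_succ_self)
      rw [hFs] at hp
      obtain ⟨q, hq, r, hr, rfl⟩ := Submodule.mem_sup.1 hp
      obtain ⟨c, rfl⟩ := Submodule.mem_span_singleton.1 hr
      rw [map_add, map_smul, inner_add_left, inner_smul_left, ih q hq v hv',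
        inner_map_eq_of_minimizer (hu n).1 (hu n).2.1 (hu n).2.2 hv', huv]
      simp
  have hsplit : ∀ n v, ∃ p ∈ F n, ∃ q ∈ (F n)ᗮ, p + q = v := by
    intro n v
    have := hfin n
    obtain ⟨p, hp, q, hq, h⟩ := (F n).exists_add_mem_mem_orthogonal v
    exact ⟨p, hp, q, hq, h.symm⟩
  have heig : ∀ n v, ⟪T (u n), T v⟫ = ‖T (u n)‖ ^ 2 * ⟪u n, v⟫ := by
    intro n v
    obtain ⟨p, hp, q, hq, rfl⟩ := hsplit n v
    rw [map_add, inner_add_right, inner_add_right,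
      inner_map_eq_of_minimizer (hu n).1 (hu n).2.1 (hu n).2.2 hq,
      real_inner_comm, hdec n p hp _ (hu n).1, (Submodule.mem_orthogonal' _ _).1 (hu n).1 _ hp,
      zero_add, zero_add]
  have hpos : ∀ n, 0 < ‖T (u n)‖ := fun n => by
    rw [norm_pos_iff]
    intro h
    have := hon.ne_zero n
    exact this (hinj (by rw [h, map_zero]))
  have hlmono : Monotone fun n => ‖T (u n)‖ := monotone_nat_of_le_succ fun n => by
    have := (hu n).2.2 (u (n + 1)) (Submodule.orthogonal_le (hmono n.le_succ) (hu (n + 1)).1)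
    rwa [(hu (n + 1)).2.1, mul_one] at this
  have htop : Tendsto (fun n => ‖T (u n)‖) atTop atTop := by
    rcases tendsto_atTop_of_monotone hlmono with h | ⟨l, hl⟩
    · exact h
    exfalso
    obtain ⟨B, hB⟩ := hl.bddAbove_range
    obtain ⟨φ, hφ, hcau⟩ := hc u ⟨1 + B ^ 2, fun n => by
      rw [(hu n).2.1, one_pow]
      gcongr
      exact hB ⟨n, rfl⟩⟩
    obtain ⟨N, hN⟩ := Metric.cauchySeq_iff.1 hcau 1 one_pos
    have h := hN N le_rfl (N + 1) N.le_succ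
    have h2 : ‖u (φ N) - u (φ (N + 1))‖ ^ 2 = 2 := by
      rw [norm_sub_sq_real, (hu _).2.1, (hu _).2.1, hperp (hφ N.lt_succ_self)]
      norm_num
    rw [dist_eq_norm] at h
    nlinarith [norm_nonneg (u (φ N) - u (φ (N + 1)))]
  refine ⟨fun n => ‖T (u n)‖, u, hpos, hlmono, htop, hon, heig, fun v => ?_, fun v => ?_⟩
  · refine (hu 0).2.2 v ?_
    change v ∈ (⊥ : Submodule ℝ E)ᗮ
    simp
  · have hlim : Tendsto (fun n => ‖T v‖ / ‖T (u n)‖) atTop (𝓝 0) :=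
      tendsto_const_nhds.div_atTop htop
    rw [Metric.mem_closure_iff]
    intro ε hε
    obtain ⟨n, hn⟩ := (hlim.eventually (gt_mem_nhds hε)).exists
    obtain ⟨p, hp, q, hq, rfl⟩ := hsplit n v
    refine ⟨p, hspan n hp, lt_of_le_of_lt ?_ hn⟩
    rw [dist_eq_norm, add_sub_cancel_left, le_div_iff₀ (hpos n), mul_comm]
    refine ((hu n).2.2 q hq).trans ?_
    have h := norm_add_sq_eq_norm_sq_add_norm_sq_real (hdec n p hp q hq)
    rw [map_add]
    nlinarith [norm_nonneg (T p), norm_nonneg (T q), norm_nonneg (T p + T q)]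

end Abstract

namespace LinearPMap

open Filter Topology

variable {E G : Type*} [NormedAddCommGroup E] [InnerProductSpace ℝ E]
  [NormedAddCommGroup G] [InnerProductSpace ℝ G]

theorem exists_mem_domain_of_tendsto {T : E →ₗ.[ℝ] G} (hT : T.IsClosed) {u : ℕ → T.domain}
    {x : E} {y : G} (hx : Tendsto (fun n => (u n : E)) atTop (𝓝 x))
    (hy : Tendsto (fun n => T (u n)) atTop (𝓝 y)) : ∃ h : x ∈ T.domain, T ⟨x, h⟩ = y := by
  have h : (x, y) ∈ T.graph :=
    hT.mem_of_tendsto (hx.prodMk_nhds hy) (Eventually.of_forall fun n => T.mem_graph (u n))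
  rw [mem_graph_iff] at h
  obtain ⟨v, rfl, rfl⟩ := h
  exact ⟨v.2, rfl⟩

/-- If `T` vanishes on `Vᗮ`, then its values are attained on `V`. -/
theorem exists_mem_map_eq_of_orthogonal_le_ker (T : E →ₗ.[ℝ] G) (V : Submodule ℝ E)
    [V.HasOrthogonalProjection] (hV : ∀ x ∈ Vᗮ, ∃ h : x ∈ T.domain, T ⟨x, h⟩ = 0)
    (x : T.domain) : ∃ v : T.domain, (v : E) ∈ V ∧ (x : E) - v ∈ Vᗮ ∧ T v = T x := by
  obtain ⟨p, hp, q, hq, hpq⟩ := V.exists_add_mem_mem_orthogonal (x : E)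
  obtain ⟨hqd, hq0⟩ := hV q hq
  have hpx : p = (x : E) - q := by rw [hpq, add_sub_cancel_right]
  refine ⟨x - ⟨q, hqd⟩, ?_, ?_, ?_⟩
  · simpa [← hpx] using hp
  · simpa using hq
  · rw [map_sub, hq0, sub_zero]

theorem isClosed_pmRange_of_le_norm [CompleteSpace E] {T : E →ₗ.[ℝ] G} (hT : T.IsClosed)
    {V : Submodule ℝ E} {c : ℝ} (hc : 0 < c)
    (hbound : ∀ x : T.domain, (x : E) ∈ V → c * ‖(x : E)‖ ≤ ‖T x‖)
    (hV : ∀ x : T.domain, ∃ v : T.domain, (v : E) ∈ V ∧ T v = T x) :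
    _root_.IsClosed (T.pmRange : Set G) := by
  refine IsSeqClosed.isClosed fun y z hy hz => ?_
  have hex : ∀ n, ∃ v : T.domain, (v : E) ∈ V ∧ T v = y n := fun n => by
    obtain ⟨x, hx⟩ := hy n
    obtain ⟨v, hv, hvx⟩ := hV x
    exact ⟨v, hv, hvx.trans hx⟩
  choose v hv hvy using hex
  have hcau : CauchySeq fun n => (v n : E) := by
    rw [Metric.cauchySeq_iff]
    intro ε hε
    obtain ⟨N, hN⟩ := Metric.cauchySeq_iff.1 hz.cauchySeq (c * ε) (by positivity)
    refine ⟨N, fun m hm n hn => ?_⟩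
    have h1 := hbound (v m - v n) (V.sub_mem (hv m) (hv n))
    have h2 := hN m hm n hn
    rw [map_sub, hvy, hvy, ← dist_eq_norm] at h1
    rw [dist_eq_norm]
    exact lt_of_mul_lt_mul_left (h1.trans_lt h2) hc.le
  obtain ⟨x, hx⟩ := cauchySeq_tendsto_of_complete hcau
  obtain ⟨h, hxz⟩ := exists_mem_domain_of_tendsto hT hx (by simpa only [hvy] using hz)
  exact ⟨⟨x, h⟩, hxz⟩

theorem adjoint_eq_zero_of_mem_orthogonal_pmRange [CompleteSpace E] {T : E →ₗ.[ℝ] G}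
    (hT : Dense (T.domain : Set E)) {y : G} (hy : y ∈ T.pmRangeᗮ) :
    ∃ h : y ∈ T.adjoint.domain, T.adjoint ⟨y, h⟩ = 0 := by
  have h0 : ∀ x : T.domain, ⟪(0 : E), x⟫ = ⟪y, T x⟫ := fun x => by
    rw [inner_zero_left]
    exact ((Submodule.mem_orthogonal' _ _).1 hy _ ⟨x, rfl⟩).symm
  exact ⟨mem_adjoint_domain_of_exists y ⟨0, h0⟩, adjoint_apply_eq hT _ h0⟩

theorem eq_zero_of_mem_orthogonal_adjoint_pmRange [CompleteSpace E] [CompleteSpace G]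
    {T : E →ₗ.[ℝ] G}
    (hT : Dense (T.domain : Set E)) (hcl : T.IsClosed) {x : E} (hx : x ∈ T.adjoint.pmRangeᗮ) :
    ∃ h : x ∈ T.domain, T ⟨x, h⟩ = 0 := by
  let g : Submodule ℝ (WithLp 2 (E × G)) :=
    T.graph.comap (WithLp.linearEquiv 2 ℝ (E × G)).toLinearMap
  have hg : _root_.IsClosed (g : Set (WithLp 2 (E × G))) :=
    IsClosed.preimage (WithLp.prod_continuous_ofLp 2 E G) hcl
  have hmem : WithLp.toLp 2 (x, (0 : G)) ∈ gᗮᗮ := by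
    rw [Submodule.mem_orthogonal]
    intro w hw
    have h0 : ∀ v : T.domain, ⟪-w.fst, (v : E)⟫ = ⟪w.snd, T v⟫ := fun v => by
      have := (Submodule.mem_orthogonal' _ _).1 hw (WithLp.toLp 2 ((v : E), T v)) (T.mem_graph v)
      rw [WithLp.prod_inner_apply] at this
      rw [inner_neg_left]
      exact neg_eq_of_add_eq_zero_right this
    have hw' : w.snd ∈ T.adjoint.domain := mem_adjoint_domain_of_exists _ ⟨_, h0⟩
    have := (Submodule.mem_orthogonal _ _).1 hx _ ⟨⟨w.snd, hw'⟩, adjoint_apply_eq hT _ h0⟩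
    rw [inner_neg_left, neg_eq_zero] at this
    rw [WithLp.prod_inner_apply]
    change ⟪w.fst, x⟫ + ⟪w.snd, (0 : G)⟫ = 0
    rw [this, inner_zero_right, add_zero]
  rw [Submodule.orthogonal_orthogonal_eq_closure, hg.submodule_topologicalClosure_eq] at hmem
  have h : (x, (0 : G)) ∈ T.graph := hmem
  rw [mem_graph_iff] at h
  obtain ⟨v, rfl, hv⟩ := h
  exact ⟨v.2, hv⟩

theorem mem_orthogonal_adjoint_pmRange_of_eq_zero [CompleteSpace E] {T : E →ₗ.[ℝ] G}
    (hT : Dense (T.domain : Set E)) {x : T.domain} (hx : T x = 0) :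
    (x : E) ∈ T.adjoint.pmRangeᗮ := by
  rw [Submodule.mem_orthogonal]
  rintro _ ⟨y, rfl⟩
  exact (adjoint_isFormalAdjoint hT y x).trans (by rw [hx, inner_zero_right])

/-- The restriction of `T` to the part of its domain lying in `V`. -/
def reduced (T : E →ₗ.[ℝ] G) (V : Submodule ℝ E) : ↥(T.domain ⊓ V) →ₗ[ℝ] G :=
  T.toFun ∘ₗ Submodule.inclusion inf_le_left

theorem graphComplete_reduced [CompleteSpace E] [CompleteSpace G] {T : E →ₗ.[ℝ] G}
    (hT : T.IsClosed) {V : Submodule ℝ E} (hV : _root_.IsClosed (V : Set E)) : GraphComplete (T.reduced V) := by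
  intro u hu hTu
  obtain ⟨x, hx⟩ := cauchySeq_tendsto_of_complete
    (uniformContinuous_subtype_val.comp_cauchySeq hu)
  obtain ⟨y, hy⟩ := cauchySeq_tendsto_of_complete hTu
  obtain ⟨hxd, hxy⟩ := exists_mem_domain_of_tendsto hT
    (u := fun n => Submodule.inclusion inf_le_left (u n)) hx hy
  have hxV : x ∈ V := hV.mem_of_tendsto hx (Eventually.of_forall fun n => (u n).2.2)
  refine ⟨⟨x, hxd, hxV⟩, tendsto_subtype_rng.2 hx, ?_⟩
  convert hy
  exact hxy

theorem le_closure_domain_inf {T : E →ₗ.[ℝ] G} (hT : Dense (T.domain : Set E))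
    {V : Submodule ℝ E} [V.HasOrthogonalProjection]
    (hV : ∀ x ∈ Vᗮ, ∃ h : x ∈ T.domain, T ⟨x, h⟩ = 0) :
    (V : Set E) ⊆ _root_.closure ((T.domain ⊓ V : Submodule ℝ E) : Set E) := by
  intro z hz
  rw [← Submodule.starProjection_eq_self_iff.2 hz]
  refine map_mem_closure V.starProjection.continuous (hT z) fun x hx => ?_
  obtain ⟨v, hvV, hvx, -⟩ := T.exists_mem_map_eq_of_orthogonal_le_ker V hV ⟨x, hx⟩
  have : V.starProjection x = v := Submodule.eq_starProjection_of_mem_orthogonal hvV hvx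
  rw [this]
  exact ⟨v.2, hvV⟩

end LinearPMap

/-- Suppose the embedding `D(A) ∩ closure (R(A*)) ↪ X` is compact and
`R(A*)` is infinite dimensional.  Then there are a monotone increasing sequence
`(lam n) ⊆ (0, ∞)` with `lam n → ∞` and a sequence `(u n) ⊆ D(A*A) ∩ R(A*)` such that
`(u n)` is a complete orthonormal system of `R(A*)` with `A*A (u n) = (lam n)² • u n`,
and the vectors `y n := (lam n)⁻¹ • A (u n)` form a complete orthonormal system of `R(A)`
with `A A* (y n) = (lam n)² • y n`. -/
theorem stmt17
    (A : X →ₗ.[ℝ] Y) (hdense : Dense (A.domain : Set X)) (hclosed : A.IsClosed)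
    (hcomp : ∀ u : ℕ → A.domain,
      (∀ n, (u n : X) ∈ closure (A.adjoint.pmRange : Set X)) →
      (∃ C : ℝ, ∀ n, ‖(u n : X)‖ ^ 2 + ‖A (u n)‖ ^ 2 ≤ C) →
      ∃ (x : X) (φ : ℕ → ℕ), StrictMono φ ∧
        Filter.Tendsto (fun n => (u (φ n) : X)) Filter.atTop (nhds x))
    (hinf : ¬ FiniteDimensional ℝ A.adjoint.pmRange) :
    ∃ (lam : ℕ → ℝ) (u : ℕ → A.domain),
      (∀ n, 0 < lam n) ∧ Monotone lam ∧
      Filter.Tendsto lam Filter.atTop Filter.atTop ∧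
      (∀ n, (u n : X) ∈ A.adjoint.pmRange) ∧
      Orthonormal ℝ (fun n => (u n : X)) ∧
      closure ((Submodule.span ℝ (Set.range fun n => (u n : X)) : Submodule ℝ X) : Set X) =
        (A.adjoint.pmRange : Set X) ∧
      (∀ n, ∃ hAu : A (u n) ∈ A.adjoint.domain,
        A.adjoint ⟨A (u n), hAu⟩ = (lam n) ^ 2 • (u n : X)) ∧
      (∀ n, (lam n)⁻¹ • A (u n) ∈ A.pmRange) ∧
      Orthonormal ℝ (fun n => (lam n)⁻¹ • A (u n)) ∧
      closure ((Submodule.span ℝ (Set.range fun n => (lam n)⁻¹ • A (u n)) :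
          Submodule ℝ Y) : Set Y) = (A.pmRange : Set Y) ∧
      (∀ n, ∃ (hy : (lam n)⁻¹ • A (u n) ∈ A.adjoint.domain)
          (hAy : A.adjoint ⟨(lam n)⁻¹ • A (u n), hy⟩ ∈ A.domain),
        A ⟨A.adjoint ⟨(lam n)⁻¹ • A (u n), hy⟩, hAy⟩ =
          (lam n) ^ 2 • ((lam n)⁻¹ • A (u n))) := by
  set V : Submodule ℝ X := A.adjoint.pmRange.topologicalClosure
  have hVcl : IsClosed (V : Set X) := Submodule.isClosed_topologicalClosure _
  have : CompleteSpace V := hVcl.completeSpace_coe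
  have hVorth : Vᗮ = A.adjoint.pmRangeᗮ := Submodule.orthogonal_closure _
  have hVker : ∀ x ∈ Vᗮ, ∃ h : x ∈ A.domain, A ⟨x, h⟩ = 0 := fun x hx =>
    LinearPMap.eq_zero_of_mem_orthogonal_adjoint_pmRange hdense hclosed (hVorth ▸ hx)
  set T := A.reduced V
  have hred : ∀ x : A.domain, ∃ e : ↥(A.domain ⊓ V), (x : X) - e ∈ Vᗮ ∧ T e = A x := fun x => by
    obtain ⟨v, hvV, hvx, hv⟩ := A.exists_mem_map_eq_of_orthogonal_le_ker V hVker x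
    exact ⟨⟨v, v.2, hvV⟩, hvx, hv⟩
  have hinj : Function.Injective T := by
    rw [injective_iff_map_eq_zero]
    intro e he
    have h1 : (e : X) ∈ Vᗮ :=
      hVorth ▸ LinearPMap.mem_orthogonal_adjoint_pmRange_of_eq_zero hdense he
    exact Subtype.ext (inner_self_eq_zero.1 ((Submodule.mem_orthogonal _ _).1 h1 _ e.2.2))
  have hcompact : GraphCompact T := by
    intro w hw
    obtain ⟨x, φ, hφ, hx⟩ := hcomp (fun n => ⟨w n, (w n).2.1⟩) (fun n => (w n).2.2) hw
    exact ⟨φ, hφ, cauchySeq_iff_tendsto_dist_atTop_0.2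
      (cauchySeq_iff_tendsto_dist_atTop_0.1 hx.cauchySeq)⟩
  have hVdense := LinearPMap.le_closure_domain_inf hdense hVker
  have hEinf : ¬ FiniteDimensional ℝ ↥(A.domain ⊓ V) := by
    intro h
    have hcl := (A.domain ⊓ V).closed_of_finiteDimensional
    rw [hcl.closure_eq] at hVdense
    have hle : A.adjoint.pmRange ≤ A.domain ⊓ V :=
      fun z hz => hVdense (Submodule.le_topologicalClosure _ hz)
    exact hinf (Submodule.finiteDimensional_of_le hle)
  obtain ⟨lam, u, hpos, hmono, htop, hon, heig, hbound, hdn⟩ :=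
    exists_singular_system (LinearPMap.graphComplete_reduced hclosed hVcl) hcompact hinj hEinf
  have hRcl : IsClosed (A.pmRange : Set Y) := by
    refine LinearPMap.isClosed_pmRange_of_le_norm hclosed (V := V) (hpos 0)
      (fun x hx => hbound ⟨x, x.2, hx⟩) fun x => ?_
    obtain ⟨e, -, he⟩ := hred x
    exact ⟨⟨e, e.2.1⟩, e.2.2, he⟩
  have : CompleteSpace A.pmRange := hRcl.completeSpace_coe
  have hRadj : IsClosed (A.adjoint.pmRange : Set X) := by
    refine LinearPMap.isClosed_pmRange_of_le_norm (LinearPMap.adjoint_isClosed hdense)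
      (V := A.pmRange) (hpos 0) ?_ fun y => ?_
    · rintro y ⟨x, hx⟩
      obtain ⟨e, -, he⟩ := hred x
      have hey : T e = y := he.trans hx
      have h1 : ⟪A.adjoint y, (e : X)⟫ = ‖(y : Y)‖ ^ 2 := by
        rw [← real_inner_self_eq_norm_sq]
        nth_rewrite 2 [← hey]
        exact LinearPMap.adjoint_isFormalAdjoint hdense y ⟨e, e.2.1⟩
      have h2 := real_inner_le_norm (A.adjoint y) (e : X)
      have h3 : lam 0 * ‖(e : X)‖ ≤ ‖(y : Y)‖ := hey ▸ hbound e
      rw [h1] at h2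
      rcases (norm_nonneg (y : Y)).eq_or_lt with h0 | h0
      · rw [← h0, mul_zero]
        exact norm_nonneg _
      · refine le_of_mul_le_mul_right ?_ h0
        have h4 := mul_le_mul_of_nonneg_left h3 (norm_nonneg (A.adjoint y))
        nlinarith [hpos 0, mul_le_mul_of_nonneg_left h2 (hpos 0).le]
    · obtain ⟨v, hv, -, hvy⟩ := A.adjoint.exists_mem_map_eq_of_orthogonal_le_ker A.pmRange
        (fun y hy => LinearPMap.adjoint_eq_zero_of_mem_orthogonal_pmRange hdense hy) y
      exact ⟨v, hv, hvy⟩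
  have hweak : ∀ n (v : A.domain), ⟪lam n ^ 2 • (u n : X), (v : X)⟫ = ⟪T (u n), A v⟫ := by
    intro n v
    obtain ⟨e, hve, he⟩ := hred v
    have h1 := (Submodule.mem_orthogonal _ _).1 hve _ (u n).2.2
    rw [inner_sub_right, sub_eq_zero] at h1
    rw [← he, heig, inner_smul_left, h1]
    rfl
  have hAu : ∀ n, ∃ h : T (u n) ∈ A.adjoint.domain,
      A.adjoint ⟨T (u n), h⟩ = lam n ^ 2 • (u n : X) := fun n =>
    ⟨LinearPMap.mem_adjoint_domain_of_exists _ ⟨_, hweak n⟩,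
      LinearPMap.adjoint_apply_eq hdense _ (hweak n)⟩
  have hne : ∀ n, lam n ≠ 0 := fun n => (hpos n).ne'
  have humem : ∀ n, (u n : X) ∈ A.adjoint.pmRange := by
    intro n
    obtain ⟨h, hn⟩ := hAu n
    have hm : lam n ^ 2 • (u n : X) ∈ A.adjoint.pmRange := ⟨_, hn⟩
    have := A.adjoint.pmRange.smul_mem (lam n ^ 2)⁻¹ hm
    rwa [inv_smul_smul₀ (pow_ne_zero 2 (hne n))] at this
  have hymem : ∀ n, (lam n)⁻¹ • T (u n) ∈ A.pmRange := fun n =>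
    A.pmRange.smul_mem _ ⟨_, rfl⟩
  refine ⟨lam, fun n => ⟨u n, (u n).2.1⟩, hpos, hmono, htop, humem, ?_, ?_, hAu, hymem, ?_, ?_, ?_⟩
  · exact hon.comp_linearIsometry (A.domain ⊓ V).subtypeₗᵢ
  · apply Set.Subset.antisymm
    · refine closure_minimal ?_ hRadj
      rw [SetLike.coe_subset_coe, Submodule.span_le]
      rintro _ ⟨n, rfl⟩
      exact humem n
    · intro z hz
      refine closure_minimal (fun x hx => ?_) isClosed_closure
        (hVdense (Submodule.le_topologicalClosure _ hz))
      refine map_mem_closure continuous_subtype_val (hdn ⟨x, hx⟩) fun e he => ?_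
      have := Submodule.mem_map_of_mem (f := (A.domain ⊓ V).subtype) he
      rwa [Submodule.map_span, ← Set.range_comp] at this
  · rw [orthonormal_iff_ite]
    intro i j
    change ⟪(lam i)⁻¹ • T (u i), (lam j)⁻¹ • T (u j)⟫ = _
    rw [inner_smul_left, inner_smul_right, heig, orthonormal_iff_ite.1 hon]
    split_ifs with h
    · subst h
      have := hne i
      simp
      field_simp
    · simp
  · set S := Submodule.span ℝ (Set.range fun n => (lam n)⁻¹ • T (u n))
    have hSR : S.topologicalClosure ≤ A.pmRange := by
      refine Submodule.topologicalClosure_minimal _ ?_ hRcl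
      rw [Submodule.span_le]
      rintro _ ⟨n, rfl⟩
      exact hymem n
    have : CompleteSpace S.topologicalClosure :=
      S.isClosed_topologicalClosure.completeSpace_coe
    refine Set.Subset.antisymm hSR fun z hz => ?_
    obtain ⟨p, hp, q, hq, rfl⟩ := S.topologicalClosure.exists_add_mem_mem_orthogonal z
    obtain ⟨x, hx⟩ : q ∈ A.pmRange := by
      have := A.pmRange.sub_mem hz (hSR hp)
      rwa [add_sub_cancel_left] at this
    obtain ⟨e, -, he⟩ := hred x
    have heq : T e = q := he.trans hx
    have hort : ∀ n, ⟪u n, e⟫ = 0 := by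
      intro n
      have h1 := (Submodule.mem_orthogonal _ _).1 hq _
        (Submodule.le_topologicalClosure _ (Submodule.subset_span ⟨n, rfl⟩))
      rw [← heq, inner_smul_left, heig] at h1
      simpa [hne n] using h1
    have he0 : e = 0 := by
      refine hdn.eq_zero_of_inner_right ℝ fun v hv => ?_
      induction hv using Submodule.span_induction with
      | mem v hv => obtain ⟨n, rfl⟩ := hv; exact hort n
      | zero => simp
      | add v w _ _ hv hw => rw [inner_add_left, hv, hw, add_zero]
      | smul c v _ hv => rw [inner_smul_left, hv, mul_zero]
    rw [← heq, he0, map_zero, add_zero]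
    exact hp
  · intro n
    obtain ⟨h, hn⟩ := hAu n
    have hy := A.adjoint.domain.smul_mem (lam n)⁻¹ h
    have hval : A.adjoint ⟨(lam n)⁻¹ • T (u n), hy⟩ = lam n • (u n : X) := by
      have h1 := A.adjoint.map_smul (lam n)⁻¹ ⟨T (u n), h⟩
      rw [hn, smul_smul, pow_two, inv_mul_cancel_left₀ (hne n)] at h1
      exact h1
    have hAy : A.adjoint ⟨(lam n)⁻¹ • T (u n), hy⟩ ∈ A.domain :=
      hval ▸ A.domain.smul_mem _ (u n).2.1
    refine ⟨hy, hAy, ?_⟩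
    have h2 : (⟨_, hAy⟩ : A.domain) = lam n • ⟨u n, (u n).2.1⟩ := Subtype.ext hval
    have h3 : A ⟨_, hAy⟩ = lam n • T (u n) := by rw [h2, A.map_smul]; rfl
    refine h3.trans ?_
    change _ = lam n ^ 2 • (lam n)⁻¹ • T (u n)
    rw [smul_smul, pow_two, mul_assoc, mul_inv_cancel₀ (hne n), mul_one]
end
end
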